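/- Let K be a number field or a function field of characteristic 0, let n ≥ 2, let f ∈ K[X] be a disintegrated polynomial of degree d ≥ 2, and let φ = (f,…,f) : (P^1_K)^n → (P^1_K)^n. Let V be a φ-preperiodic, absolutely irreducible curve or hypersurface in (P^1_K)^n, and let P ∈ (P^1)^n(K) be such that V(K) ∩ O_φ(P) = ∅. Then for infinitely many non-archimedean places 𝔭 of K, the 𝔭-adic closure of O_φ(P) in (P^1)^n(K_𝔭) does not intersect V(K_𝔭); consequently, for any finite set S of places of K containing the archimedean ones, V(K,S) ∩ 𝒞(O_φ(P)) = ∅. -/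

import Mathlib

open Polynomial OnePoint

/-- Action of a polynomial on the projective line `P^1(L) = L ∪ {∞}`:
`∞ ↦ ∞` and `a ↦ f(a)`. -/
def polyEvalP1 {L : Type} [CommRing L] (f : Polynomial L) : OnePoint L → OnePoint L :=
  OnePoint.map fun a => f.eval a

/-- The diagonally split self-map `(f,…,f)` of `(P^1)^n` (coordinatewise action). -/
def splitMap {L : Type} [CommRing L] {ι : Type} (f : Polynomial L)
    (x : ι → OnePoint L) : ι → OnePoint L :=
  fun i => polyEvalP1 f (x i)

/-- The forward orbit of a point under a self-map. -/
def fwdOrbit {X : Type*} (φ : X → X) (P : X) : Set X :=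
  Set.range fun k : ℕ => φ^[k] P

/-- Homogeneous coordinates of a point of `P^1(L)`: `a ↦ (a, 1)`, `∞ ↦ (1, 0)`. -/
def homCoords {L : Type} [CommRing L] (x : OnePoint L) : Fin 2 → L :=
  Option.elim x ![1, 0] (fun a => ![a, 1])

/-- A polynomial in variables `(i, 0), (i, 1)` (`i : ι`) is multihomogeneous if it is
homogeneous in the pair of variables indexed by each `i` separately. -/
def MultiHomog {K : Type} [CommSemiring K] {ι : Type} [DecidableEq ι]
    (p : MvPolynomial (ι × Fin 2) K) : Prop :=
  ∀ i : ι, ∃ d : ℕ,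
    p.IsWeightedHomogeneous (fun jk => if jk.1 = i then (1 : ℕ) else 0) d

/-- A closed subvariety of `(P^1_K)^ι`, given by a set of multihomogeneous equations over `K`. -/
structure ClosedSubvar (K : Type) [CommRing K] (ι : Type) [DecidableEq ι] where
  polys : Set (MvPolynomial (ι × Fin 2) K)
  homog : ∀ p ∈ polys, MultiHomog p

/-- Whether a multihomogeneous polynomial vanishes at a point of `(P^1(L))^ι`. -/
def vanishesAt {K : Type} [CommRing K] {ι : Type} [DecidableEq ι] {L : Type} [CommRing L]
    (φ : K →+* L) (p : MvPolynomial (ι × Fin 2) K) (x : ι → OnePoint L) : Prop :=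
  MvPolynomial.eval (fun jk => homCoords (x jk.1) jk.2) (MvPolynomial.map φ p) = 0

/-- The `L`-points of a closed subvariety, for a `K`-algebra `L` via `φ : K →+* L`. -/
def ClosedSubvar.pts {K : Type} [CommRing K] {ι : Type} [DecidableEq ι]
    (V : ClosedSubvar K ι) {L : Type} [CommRing L] (φ : K →+* L) :
    Set (ι → OnePoint L) :=
  {x | ∀ p ∈ V.polys, vanishesAt φ p x}

/-- A subset of `(P^1(L))^ι` is Zariski closed if it is the common zero set of a family of
multihomogeneous polynomials over `L`. -/
def IsZarClosed {L : Type} [CommRing L] {ι : Type} [DecidableEq ι]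
    (S : Set (ι → OnePoint L)) : Prop :=
  ∃ V : ClosedSubvar L ι, S = V.pts (RingHom.id L)

/-- The Zariski closure of a set of points. -/
def zarClosure {L : Type} [CommRing L] {ι : Type} [DecidableEq ι]
    (S : Set (ι → OnePoint L)) : Set (ι → OnePoint L) :=
  ⋂₀ {Z | IsZarClosed Z ∧ S ⊆ Z}

/-- An irreducible (closed) subvariety of `(P^1(L))^ι`, as a set of points. -/
def IrrSubvar {L : Type} [CommRing L] {ι : Type} [DecidableEq ι]
    (S : Set (ι → OnePoint L)) : Prop :=
  S.Nonempty ∧ IsZarClosed S ∧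
    ∀ Z₁ Z₂ : Set (ι → OnePoint L), IsZarClosed Z₁ → IsZarClosed Z₂ →
      S ⊆ Z₁ ∪ Z₂ → S ⊆ Z₁ ∨ S ⊆ Z₂

/-- The dimension of a (closed) subvariety, as the Krull dimension of the poset of
irreducible closed subsets contained in it. -/
noncomputable def varDim {L : Type} [CommRing L] {ι : Type} [DecidableEq ι]
    (S : Set (ι → OnePoint L)) : WithBot ℕ∞ :=
  Order.krullDim {T : Set (ι → OnePoint L) // IrrSubvar T ∧ T ⊆ S}

/-- `T` is an irreducible component of `S`: a maximal irreducible closed subset of `S`. -/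
def IsComponentOf {L : Type} [CommRing L] {ι : Type} [DecidableEq ι]
    (T S : Set (ι → OnePoint L)) : Prop :=
  IrrSubvar T ∧ T ⊆ S ∧ ∀ T', IrrSubvar T' → T ⊆ T' → T' ⊆ S → T' = T

/-- A hypersurface in `(P^1(L))^n`: a nonempty Zariski closed set all of whose irreducible
components have dimension `n - 1`. -/
def IsHypersurfaceSet {L : Type} [CommRing L] {n : ℕ}
    (S : Set (Fin n → OnePoint L)) : Prop :=
  S.Nonempty ∧ IsZarClosed S ∧
    ∀ T, IsComponentOf T S → varDim T = ((n - 1 : ℕ) : ℕ∞)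

/-- A set of points (e.g. a subvariety) is periodic under the split map `(f,…,f)`. -/
def SubvarPeriodic {L : Type} [CommRing L] {ι : Type} (f : Polynomial L)
    (S : Set (ι → OnePoint L)) : Prop :=
  ∃ m : ℕ, 1 ≤ m ∧ (splitMap f)^[m] '' S = S

/-- A set of points (e.g. a subvariety) is preparation under `(f,…,f)`. -/
def SubvarPreperiodic {L : Type} [CommRing L] {ι : Type} (f : Polynomial L)
    (S : Set (ι → OnePoint L)) : Prop :=
  ∃ k : ℕ, SubvarPeriodic f ((splitMap f)^[k] '' S)

/-- A place of a field `K`, represented by a nontrivial absolute value. -/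
structure PlaceK (K : Type) [Field K] where
  v : AbsoluteValue K ℝ
  nontrivial : ∃ x : K, x ≠ 0 ∧ v x ≠ 1

/-- A place is non-archimedean if its absolute value satisfies the ultrametric inequality. -/
def PlaceK.IsNonarch {K : Type} [Field K] (w : PlaceK K) : Prop :=
  ∀ x y : K, w.v (x + y) ≤ max (w.v x) (w.v y)

/-- Equivalence of places (equality of the associated topologies / unit balls). -/
def PlaceK.Equiv {K : Type} [Field K] (w w' : PlaceK K) : Prop :=
  ∀ x : K, w.v x < 1 ↔ w'.v x < 1

/-- A choice of completion of `K` at a place `w`: a field `carrier` with an absolute value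
extending that of `w` through `emb`, which is complete and in which `K` is dense. -/
structure CompletionOf {K : Type} [Field K] (w : PlaceK K) where
  carrier : Type
  [field : Field carrier]
  emb : K →+* carrier
  absv : AbsoluteValue carrier ℝ
  compat : ∀ x : K, absv (emb x) = w.v x
  complete : ∀ s : ℕ → carrier,
    (∀ ε : ℝ, 0 < ε → ∃ N : ℕ, ∀ m ≥ N, ∀ k ≥ N, absv (s m - s k) < ε) →
    ∃ a : carrier, ∀ ε : ℝ, 0 < ε → ∃ N : ℕ, ∀ m ≥ N, absv (s m - a) < ε
  dense : ∀ a : carrier, ∀ ε : ℝ, 0 < ε → ∃ x : K, absv (a - emb x) < ε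

attribute [instance] CompletionOf.field

/-- The chordal metric on `P^1(L)` attached to an absolute value on `L`. -/
noncomputable def p1Dist {L : Type} [Field L] (w : AbsoluteValue L ℝ) :
    OnePoint L → OnePoint L → ℝ :=
  fun x y =>
    Option.elim x
      (Option.elim y 0 fun b => 1 / max 1 (w b))
      (fun a => Option.elim y (1 / max 1 (w a))
        (fun b => w (a - b) / (max 1 (w a) * max 1 (w b))))

/-- The topology on `P^1(L)` generated by the balls of the chordal metric. -/
noncomputable def p1Top {L : Type} [Field L] (w : AbsoluteValue L ℝ) :
    TopologicalSpace (OnePoint L) :=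
  TopologicalSpace.generateFrom
    {U | ∃ (x : OnePoint L) (ε : ℝ), 0 < ε ∧ U = {y | p1Dist w x y < ε}}

/-- The topology on `(P^1(L))^ι` induced by the chordal metric topology on each factor. -/
noncomputable def pnTop {L : Type} [Field L] (ι : Type) (w : AbsoluteValue L ℝ) :
    TopologicalSpace (ι → OnePoint L) :=
  @Pi.topologicalSpace ι (fun _ => OnePoint L) (fun _ => p1Top w)

/-- The closure of a set of points of `(P^1(L))^ι` in the topology induced by an
absolute value on `L`. -/
noncomputable def adicClosure {L : Type} [Field L] {ι : Type} (w : AbsoluteValue L ℝ)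
    (S : Set (ι → OnePoint L)) : Set (ι → OnePoint L) :=
  @closure _ (pnTop ι w) S

/-- Base change of a point of `P^1(K)` along a field embedding. -/
def mapPoint {K L : Type} [Field K] [Field L] (φ : K →+* L) :
    OnePoint K → OnePoint L :=
  OnePoint.map φ

/-- `K` is a number field, or a function field of characteristic zero over the ground
field `κ` (finitely generated of transcendence degree 1 over `κ`, with `κ` relatively
algebraically closed in `K`). -/
def NumberFieldOrFunctionFieldOver (K : Type) [Field K] (κ : Subfield K) : Prop :=
  NumberField K ∨
    (CharZero K ∧
      (∃ t : K, Transcendental κ t ∧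
        FiniteDimensional (IntermediateField.adjoin κ {t}) K) ∧
      (∀ x : K, IsAlgebraic κ x → x ∈ κ))

/-- The places of `K` relevant for the theorems: in the number field case all places are
allowed; in the function field case only places trivial on the ground field `κ`. -/
def PlaceK.IsPlaceOver {K : Type} [Field K] (κ : Subfield K) (w : PlaceK K) : Prop :=
  NumberField K ∨ (∀ c : K, c ∈ κ → c ≠ 0 → w.v c = 1)

/-- The `m`-th compositional iterate of a polynomial. -/
noncomputable def polIter {F : Type} [CommSemiring F] (f : Polynomial F) : ℕ → Polynomial F
  | 0 => X
  | m + 1 => f.comp (polIter f m)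

/-- Two polynomials commute under composition. -/
def PolyCommute {F : Type} [CommSemiring F] (f g : Polynomial F) : Prop :=
  f.comp g = g.comp f

/-- `g` commutes with some iterate `f^m` (`m ≥ 1`) of `f`. -/
def CommutesWithIterate {F : Type} [CommSemiring F] (f g : Polynomial F) : Prop :=
  ∃ m : ℕ, 1 ≤ m ∧ PolyCommute (polIter f m) g

/-- `c` is the Chebyshev polynomial of degree `d`, characterized by
`c(x + 1/x) = x^d + 1/x^d`. -/
def IsChebyshevPoly {F : Type} [Field F] (d : ℕ) (c : Polynomial F) : Prop :=
  ∀ x : F, x ≠ 0 → c.eval (x + x⁻¹) = x ^ d + (x⁻¹) ^ d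

/-- A polynomial over an algebraically closed field (or any field containing the relevant
conjugating data) is special if it is affinely conjugate to `X^d` or to `±C_d`. -/
def IsSpecialPolyAux {F : Type} [Field F] (f : Polynomial F) : Prop :=
  ∃ (a b : F), a ≠ 0 ∧
    ∃ g : Polynomial F,
      (g = X ^ f.natDegree ∨ IsChebyshevPoly f.natDegree g ∨
        IsChebyshevPoly f.natDegree (-g)) ∧
      (C a * X + C b).comp g = f.comp (C a * X + C b)

/-- A polynomial over `K` is special if it becomes special (conjugate to `X^d` or `±C_d`)
over an algebraic closure of `K`. -/
def IsSpecialPoly {K : Type} [Field K] (f : Polynomial K) : Prop :=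
  IsSpecialPolyAux (f.map (algebraMap K (AlgebraicClosure K)))

/-- A polynomial of degree at least 2 is disintegrated if it is not special. -/
def IsDisintegrated {K : Type} [Field K] (f : Polynomial K) : Prop :=
  2 ≤ f.natDegree ∧ ¬ IsSpecialPoly f

/-- A point of `P^1` is periodic under (the `P^1`-action of) a polynomial. -/
def P1Periodic {L : Type} [CommRing L] (f : Polynomial L) (ζ : OnePoint L) : Prop :=
  ∃ N : ℕ, 1 ≤ N ∧ (OnePoint.map fun a => f.eval a)^[N] ζ = ζ

/-- A point of `P^1` is preperiodic under a polynomial. -/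
def P1Preperiodic {L : Type} [CommRing L] (f : Polynomial L) (ζ : OnePoint L) : Prop :=
  ∃ k : ℕ, P1Periodic f ((OnePoint.map fun a => f.eval a)^[k] ζ)

/-- At the place `w`, the `w`-adic closure of the `(f,…,f)`-orbit of `P` does not meet
`V(K_w)`: for every completion of `K` at `w`, the `w`-adic closure of the orbit in
`(P^1)^n` of the completion is disjoint from the set of points of `V` over the
completion. -/
def OrbitClosureAvoids {K : Type} [Field K] {n : ℕ} (w : PlaceK K)
    (f : Polynomial K) (P : Fin n → OnePoint K) (V : ClosedSubvar K (Fin n)) : Prop :=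
  ∀ C : CompletionOf w,
    adicClosure C.absv
        (fwdOrbit (splitMap (f.map C.emb)) fun i => mapPoint C.emb (P i)) ∩
      V.pts C.emb = ∅

/-- There are infinitely many (pairwise inequivalent) non-archimedean places of `K`
(trivial on the ground field `κ` in the function field case) satisfying `Q`. -/
def InfinitelyManyPlaces (K : Type) [Field K] (κ : Subfield K)
    (Q : PlaceK K → Prop) : Prop :=
  ∃ T : Set (PlaceK K), T.Infinite ∧
    (T.Pairwise fun w w' => ¬ PlaceK.Equiv w w') ∧
    ∀ w ∈ T, w.IsNonarch ∧ w.IsPlaceOver κ ∧ Q w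

/-- All but finitely many non-archimedean places of `K` (trivial on the ground field `κ`
in the function field case) satisfy `Q`. -/
def AllButFinitelyManyPlaces (K : Type) [Field K] (κ : Subfield K)
    (Q : PlaceK K → Prop) : Prop :=
  ∃ T : Set (PlaceK K), T.Finite ∧
    ∀ w : PlaceK K, w.IsNonarch → w.IsPlaceOver κ →
      (∃ w' ∈ T, PlaceK.Equiv w w') ∨ Q w
/-- The index type of the product `∏_{v ∉ S}`: places of `K` (over `κ`) having no
equivalent representative in `S`. -/
def IdxNotS (K : Type) [Field K] (κ : Subfield K) (S : Set (PlaceK K)) : Type :=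
  {w : PlaceK K // w.IsPlaceOver κ ∧ ∀ w' ∈ S, ¬ PlaceK.Equiv w w'}

/-- The space `(P^1)^n(K,S) = ∏_{v ∉ S} (P^1)^n(K_v)` (relative to a choice of
completions `C`). -/
def AdelicSpace (K : Type) [Field K] (κ : Subfield K) (S : Set (PlaceK K))
    (C : ∀ w : PlaceK K, CompletionOf w) (n : ℕ) : Type :=
  ∀ w : IdxNotS K κ S, Fin n → OnePoint (C w.1).carrier

/-- The product of the `v`-adic topologies on `(P^1)^n(K,S)`. -/
noncomputable def adelicTop (K : Type) [Field K] (κ : Subfield K) (S : Set (PlaceK K))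
    (C : ∀ w : PlaceK K, CompletionOf w) (n : ℕ) :
    TopologicalSpace (AdelicSpace K κ S C n) :=
  @Pi.topologicalSpace _ _ fun w => pnTop (Fin n) (C w.1).absv

/-- The diagonal embedding of `(P^1)^n(K)` into `(P^1)^n(K,S)`. -/
def adelicDiag (K : Type) [Field K] (κ : Subfield K) (S : Set (PlaceK K))
    (C : ∀ w : PlaceK K, CompletionOf w) (n : ℕ) (x : Fin n → OnePoint K) :
    AdelicSpace K κ S C n :=
  fun w i => mapPoint (C w.1).emb (x i)

/-- The subset `V(K,S) = ∏_{v ∉ S} V(K_v)` of `(P^1)^n(K,S)`. -/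
def VKS (K : Type) [Field K] (κ : Subfield K) (S : Set (PlaceK K))
    (C : ∀ w : PlaceK K, CompletionOf w) (n : ℕ) (V : ClosedSubvar K (Fin n)) :
    Set (AdelicSpace K κ S C n) :=
  {y | ∀ w : IdxNotS K κ S, y w ∈ V.pts (C w.1).emb}

/-- `S` is a finite set of places containing all archimedean places of `K`. -/
def IsAdmissibleS (K : Type) [Field K] (S : Set (PlaceK K)) : Prop :=
  S.Finite ∧ ∀ w : PlaceK K, ¬ w.IsNonarch → ∃ w' ∈ S, PlaceK.Equiv w w'

/-- The point of `(P^1)^ι` with coordinate `∞` at the indices in `M` and `x i` elsewhere. -/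
noncomputable def chartPt {L ι : Type} (M : Set ι) (x : ι → L) : ι → OnePoint L :=
  open Classical in fun i => if i ∈ M then ∞ else (x i : OnePoint L)

/-- Specialization of multihomogeneous coordinates to the stratum of points `chartPt M x`. -/
noncomputable def specZ (K : Type) [CommRing K] {ι : Type} (M : Set ι) :
    MvPolynomial (ι × Fin 2) K →ₐ[K] MvPolynomial ι K :=
  open Classical in MvPolynomial.aeval fun jk =>
    if jk.1 ∈ M then (if jk.2 = 0 then 1 else 0)
    else (if jk.2 = 0 then MvPolynomial.X jk.1 else 1)

lemma vanishesAt_chartPt {K L ι : Type} [CommRing K] [CommRing L] [DecidableEq ι]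
    (φ : K →+* L) (p : MvPolynomial (ι × Fin 2) K) (M : Set ι) (x : ι → L) :
    vanishesAt φ p (chartPt M x) ↔ MvPolynomial.eval₂ φ x (specZ K M p) = 0 := by
  unfold vanishesAt specZ
  rw [MvPolynomial.eval_map, ← MvPolynomial.coe_eval₂Hom φ x,
    ← RingHom.coe_coe (MvPolynomial.aeval _), ← RingHom.comp_apply,
    ← MvPolynomial.coe_eval₂Hom φ]
  congr! 2
  apply MvPolynomial.ringHom_ext
  · intro r; simp
  · rintro ⟨i, k⟩
    by_cases h : i ∈ M <;> fin_cases k <;> simp [h, chartPt, homCoords]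
    · rfl
    · rfl
    · rfl
    · rfl

lemma splitMap_chartPt {L ι : Type} [CommRing L] (f : L[X]) (M : Set ι) (x : ι → L) :
    splitMap f (chartPt M x) = chartPt M fun i => f.eval (x i) := by
  funext i
  by_cases h : i ∈ M <;> simp [h, chartPt, splitMap, polyEvalP1]

lemma splitMap_iterate_chartPt {L ι : Type} [CommRing L] (f : L[X]) (M : Set ι) (x : ι → L)
    (s : ℕ) : (splitMap f)^[s] (chartPt M x) = chartPt M fun i => (f.eval)^[s] (x i) := by
  induction s with
  | zero => rfl
  | succ s ih => simp only [Function.iterate_succ_apply', ih, splitMap_chartPt]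

lemma exists_eq_chartPt {L ι : Type} [Zero L] (P : ι → OnePoint L) :
    ∃ x : ι → L, (∀ i, P i = ∞ → x i = 0) ∧ P = chartPt {i | P i = ∞} x := by
  refine ⟨fun i => (P i).elim 0 id, fun i hi => by simp [hi], funext fun i => ?_⟩
  by_cases h : P i = ∞
  · simp [chartPt, h]
  · obtain ⟨y, hy⟩ := OnePoint.ne_infty_iff_exists.1 h
    simp [chartPt, ← hy]

/-- The ring of integers of a nonarchimedean absolute value. -/
def absInt {K : Type} [Field K] (v : AbsoluteValue K ℝ)
    (hv : ∀ x y : K, v (x + y) ≤ max (v x) (v y)) : Subring K where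
  carrier := {x | v x ≤ 1}
  mul_mem' {x y} hx hy := by
    simp only [Set.mem_ofPred_eq, map_mul] at *
    exact mul_le_one₀ hx (v.nonneg _) hy
  one_mem' := by simp
  add_mem' {x y} hx hy := (hv x y).trans (max_le hx hy)
  zero_mem' := by simp
  neg_mem' {x} hx := by simpa using hx

lemma mem_absInt {K : Type} [Field K] {v : AbsoluteValue K ℝ}
    {hv : ∀ x y : K, v (x + y) ≤ max (v x) (v y)} {x : K} : x ∈ absInt v hv ↔ v x ≤ 1 := Iff.rfl

lemma Polynomial.eval_mem_subring {K : Type} [Field K] (R : Subring K) {f : K[X]}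
    (hf : ∀ i, f.coeff i ∈ R) {y : K} (hy : y ∈ R) : f.eval y ∈ R := by
  rw [eval_eq_sum_range]
  exact sum_mem fun i _ => mul_mem (hf i) (pow_mem hy i)

lemma Polynomial.iterate_eval_mem_subring {K : Type} [Field K] (R : Subring K) {f : K[X]}
    (hf : ∀ i, f.coeff i ∈ R) {y : K} (hy : y ∈ R) (s : ℕ) : (f.eval)^[s] y ∈ R := by
  induction s with
  | zero => exact hy
  | succ s ih => rw [Function.iterate_succ_apply']; exact eval_mem_subring R hf ih

lemma MvPolynomial.exists_abv_eval₂_sub_le {K L ι : Type} [Field K] [Field L]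
    (φ : K →+* L) (v : AbsoluteValue L ℝ) (A : MvPolynomial ι K) (R : ℝ) (hR : 0 ≤ R) :
    ∃ C : ℝ, 0 ≤ C ∧ ∀ x y : ι → L, (∀ i, v (x i) ≤ R) → (∀ i, v (y i) ≤ R) →
      ∀ δ : ℝ, 0 ≤ δ → (∀ i, v (x i - y i) ≤ δ) →
        v (MvPolynomial.eval₂ φ x A) ≤ C ∧
        v (MvPolynomial.eval₂ φ x A - MvPolynomial.eval₂ φ y A) ≤ C * δ := by
  induction A using MvPolynomial.induction_on with
  | C r =>
    refine ⟨v (φ r), v.nonneg _, fun x y _ _ δ hδ _ => ?_⟩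
    simp only [MvPolynomial.eval₂_C, sub_self, map_zero, le_refl, true_and]
    exact mul_nonneg (v.nonneg _) hδ
  | add p q hp hq =>
    obtain ⟨C, hC, h⟩ := hp
    obtain ⟨D, hD, h'⟩ := hq
    refine ⟨C + D, by positivity, fun x y hx hy δ hδ hxy => ?_⟩
    obtain ⟨h1, h2⟩ := h x y hx hy δ hδ hxy
    obtain ⟨h3, h4⟩ := h' x y hx hy δ hδ hxy
    simp only [MvPolynomial.eval₂_add]
    refine ⟨(v.add_le _ _).trans (add_le_add h1 h3), ?_⟩
    rw [add_sub_add_comm, add_mul]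
    exact (v.add_le _ _).trans (add_le_add h2 h4)
  | mul_X p i hp =>
    obtain ⟨C, hC, h⟩ := hp
    refine ⟨C * R + C, by positivity, fun x y hx hy δ hδ hxy => ?_⟩
    obtain ⟨h1, h2⟩ := h x y hx hy δ hδ hxy
    obtain ⟨h3, -⟩ := h y x hy hx δ hδ fun i => by rw [v.map_sub]; exact hxy i
    simp only [MvPolynomial.eval₂_mul, MvPolynomial.eval₂_X]
    constructor
    · rw [map_mul]
      have := mul_le_mul h1 (hx i) (v.nonneg _) hC
      linarith
    · rw [show MvPolynomial.eval₂ φ x p * x i - MvPolynomial.eval₂ φ y p * y i =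
        (MvPolynomial.eval₂ φ x p - MvPolynomial.eval₂ φ y p) * x i +
          MvPolynomial.eval₂ φ y p * (x i - y i) by ring]
      refine (v.add_le _ _).trans ?_
      rw [map_mul, map_mul]
      have e1 := mul_le_mul h2 (hx i) (v.nonneg _) (by positivity)
      have e2 := mul_le_mul h3 (hxy i) (v.nonneg _) hC
      linarith

/-- If `A` vanishes on the stratum of `V` over the algebraic closure, it does so over any
extension field. -/
lemma eval₂_eq_zero_of_mem_pts {K ι : Type} [Field K] [Finite ι] [DecidableEq ι]
    (V : ClosedSubvar K ι) (M : Set ι) (A : MvPolynomial ι K)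
    (hA : ∀ x : ι → AlgebraicClosure K,
      chartPt M x ∈ V.pts (algebraMap K (AlgebraicClosure K)) → MvPolynomial.aeval x A = 0)
    {L : Type} [Field L] (φ : K →+* L) (x : ι → L) (hx : chartPt M x ∈ V.pts φ) :
    MvPolynomial.eval₂ φ x A = 0 := by
  have h1 : A ∈ (Ideal.span (specZ K M '' V.polys)).radical := by
    rw [← MvPolynomial.vanishingIdeal_zeroLocus_eq_radical (K := AlgebraicClosure K)]
    intro y hy
    apply hA
    intro p hp
    rw [vanishesAt_chartPt]
    exact hy _ (Ideal.subset_span ⟨p, hp, rfl⟩)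
  obtain ⟨r, hr⟩ := h1
  have h2 : Ideal.span (specZ K M '' V.polys) ≤ RingHom.ker (MvPolynomial.eval₂Hom φ x) := by
    rw [Ideal.span_le]
    rintro _ ⟨p, hp, rfl⟩
    exact (vanishesAt_chartPt φ p M x).1 (hx p hp)
  have h3 := h2 hr
  rw [RingHom.mem_ker, map_pow] at h3
  exact eq_zero_of_pow_eq_zero h3

lemma p1Dist_coe_coe {L : Type} [Field L] (w : AbsoluteValue L ℝ) (a b : L) :
    p1Dist w a b = w (a - b) / (max 1 (w a) * max 1 (w b)) := rfl
lemma p1Dist_coe_infty {L : Type} [Field L] (w : AbsoluteValue L ℝ) (a : L) :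
    p1Dist w a ∞ = 1 / max 1 (w a) := rfl
lemma p1Dist_infty_coe {L : Type} [Field L] (w : AbsoluteValue L ℝ) (a : L) :
    p1Dist w ∞ a = 1 / max 1 (w a) := rfl

lemma exists_p1Dist_lt_of_mem_adicClosure {L ι : Type} [Field L] [Finite ι]
    (w : AbsoluteValue L ℝ) {S : Set (ι → OnePoint L)} {Q : ι → OnePoint L}
    (hQ : Q ∈ adicClosure w S) (ε : ι → ℝ) (hε : ∀ i, 0 < ε i) :
    ∃ y ∈ S, ∀ i, p1Dist w (Q i) (y i) < ε i := by
  let := p1Top w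
  have hQ' : Q ∈ closure S := hQ
  have ho : IsOpen (Set.pi Set.univ fun i => {y | p1Dist w (Q i) y < ε i}) := by
    apply isOpen_set_pi Set.finite_univ
    intro i _
    exact TopologicalSpace.isOpen_generateFrom_of_mem ⟨Q i, ε i, hε i, rfl⟩
  have hself : ∀ z : OnePoint L, p1Dist w z z = 0 := by
    intro z
    induction z using OnePoint.rec with
    | infty => rfl
    | coe a => simp [p1Dist_coe_coe]
  obtain ⟨y, hy1, hy2⟩ := mem_closure_iff.1 hQ' _ ho (fun i _ => by
    simpa [hself] using hε i)
  exact ⟨y, hy2, fun i => hy1 i trivial⟩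

theorem orbitClosureAvoids_of_lower_bound {K : Type} [Field K] {n : ℕ} (w : PlaceK K)
    (hw : w.IsNonarch) (f : K[X]) (hf : ∀ i, w.v (f.coeff i) ≤ 1)
    (V : ClosedSubvar K (Fin n)) (M : Set (Fin n)) (a : Fin n → K) (ha : ∀ i, w.v (a i) ≤ 1)
    (hP : V.pts (RingHom.id K) ∩ fwdOrbit (splitMap f) (chartPt M a) = ∅)
    (𝒜 : Finset (MvPolynomial (Fin n) K))
    (hA : ∀ A ∈ 𝒜, ∀ x : Fin n → AlgebraicClosure K,
      chartPt M x ∈ V.pts (algebraMap K (AlgebraicClosure K)) → MvPolynomial.aeval x A = 0)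
    (c : ℝ) (hc : 0 < c) (s₀ : ℕ)
    (hlow : ∀ s ≥ s₀, ∃ A ∈ 𝒜, c ≤ w.v (MvPolynomial.eval (fun i => (f.eval)^[s] (a i)) A)) :
    OrbitClosureAvoids w f (chartPt M a) V := by
  classical
  have h_int : ∀ s i, w.v ((f.eval)^[s] (a i)) ≤ 1 := fun s i =>
    iterate_eval_mem_subring (absInt w.v hw) hf (ha i) s
  induction s₀ generalizing 𝒜 c with
  | succ m ih =>
    have hm : ∃ p ∈ V.polys,
        MvPolynomial.eval (fun i => (f.eval)^[m] (a i)) (specZ K M p) ≠ 0 := by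
      by_contra! hcon
      have : chartPt M (fun i => (f.eval)^[m] (a i)) ∈
          V.pts (RingHom.id K) ∩ fwdOrbit (splitMap f) (chartPt M a) :=
        ⟨fun p hp => (vanishesAt_chartPt _ p M _).2 (hcon p hp),
          m, splitMap_iterate_chartPt f M a m⟩
      rw [hP] at this
      exact this
    obtain ⟨p, hp, hpe⟩ := hm
    refine ih (insert (specZ K M p) 𝒜) ?_
      (min c (w.v (MvPolynomial.eval (fun i => (f.eval)^[m] (a i)) (specZ K M p))))
      (lt_min hc (w.v.pos hpe)) ?_
    · intro A hAm x hx
      rcases Finset.mem_insert.1 hAm with rfl | h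
      · exact (vanishesAt_chartPt _ p M x).1 (hx p hp)
      · exact hA A h x hx
    · intro s hs
      rcases hs.lt_or_eq with h | h
      · obtain ⟨A, hA1, hA2⟩ := hlow s h
        exact ⟨A, Finset.mem_insert_of_mem hA1, (min_le_left _ _).trans hA2⟩
      · subst h
        exact ⟨_, Finset.mem_insert_self _ _, min_le_right _ _⟩
  | zero =>
    intro C
    rw [Set.eq_empty_iff_forall_notMem]
    rintro Q ⟨hQc, hQV⟩
    have hintC : ∀ s i, C.absv (C.emb ((f.eval)^[s] (a i))) ≤ 1 := fun s i => by
      rw [C.compat]; exact h_int s i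
    have horb : ∀ y ∈ fwdOrbit (splitMap (f.map C.emb)) (fun i => mapPoint C.emb (chartPt M a i)),
        ∃ s, y = chartPt M fun i => C.emb ((f.eval)^[s] (a i)) := by
      rintro y ⟨s, rfl⟩
      refine ⟨s, ?_⟩
      have h0 : (fun i => mapPoint C.emb (chartPt M a i)) = chartPt M fun i => C.emb (a i) := by
        funext i
        by_cases h : i ∈ M <;> simp [h, chartPt, mapPoint]
      show (splitMap (f.map C.emb))^[s] _ = _
      rw [h0, splitMap_iterate_chartPt]
      congr 1
      funext i
      exact (Function.Semiconj.iterate_right (f := C.emb) (ga := f.eval)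
        (gb := (f.map C.emb).eval) (fun x => (eval_map_apply C.emb x).symm) s (a i)).symm
    obtain ⟨q, -, hQ⟩ := exists_eq_chartPt Q
    have hM : {i | Q i = ∞} = M := by
      ext i
      obtain ⟨y, hy, hd⟩ := exists_p1Dist_lt_of_mem_adicClosure C.absv hQc
        (fun i => 1 / max 1 (C.absv (q i))) (fun i => by positivity)
      obtain ⟨s, rfl⟩ := horb y hy
      have hdi := hd i
      have hlt : 1 / max 1 (C.absv (q i)) ≤ 1 := by
        rw [div_le_one (by positivity)]; exact le_max_left _ _
      constructor
      · intro hi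
        by_contra hiM
        have hi' : Q i = ∞ := hi
        simp only [hi', chartPt, hiM, if_false, p1Dist_infty_coe] at hdi
        rw [max_eq_left (hintC s i)] at hdi
        norm_num at hdi
        have := hdi.trans_le (inv_le_one_of_one_le₀ (le_max_left _ _))
        exact lt_irrefl _ this
      · intro hiM
        by_contra hi
        have hi' : Q i = q i := by
          rw [hQ]; simp only [chartPt]; rw [if_neg hi]
        simp only [hi', chartPt, hiM, if_true, p1Dist_coe_infty, lt_irrefl] at hdi
    rw [hM] at hQ
    obtain ⟨R, hR1, hR⟩ : ∃ R : ℝ, 1 ≤ R ∧ ∀ i, C.absv (q i) ≤ R := by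
      obtain ⟨R, hR⟩ := (Set.finite_range fun i => C.absv (q i)).bddAbove
      exact ⟨max 1 R, le_max_left _ _, fun i => (hR ⟨i, rfl⟩).trans (le_max_right _ _)⟩
    have hB : ∃ B : ℝ, 0 < B ∧ ∀ A ∈ 𝒜, ∀ x y : Fin n → C.carrier, (∀ i, C.absv (x i) ≤ R) →
        (∀ i, C.absv (y i) ≤ R) → ∀ δ : ℝ, 0 ≤ δ → (∀ i, C.absv (x i - y i) ≤ δ) →
        C.absv (MvPolynomial.eval₂ C.emb x A - MvPolynomial.eval₂ C.emb y A) ≤ B * δ := by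
      choose B hB0 hB using fun A : MvPolynomial (Fin n) K =>
        MvPolynomial.exists_abv_eval₂_sub_le C.emb C.absv A R (by linarith)
      refine ⟨∑ A ∈ 𝒜, B A + 1, by have := Finset.sum_nonneg fun A (_ : A ∈ 𝒜) => hB0 A; linarith,
        fun A hA x y hx hy δ hδ hxy => (hB A x y hx hy δ hδ hxy).2.trans ?_⟩
      refine mul_le_mul_of_nonneg_right ?_ hδ
      have := Finset.single_le_sum (f := B) (fun A _ => hB0 A) hA
      linarith
    obtain ⟨B, hB0, hB⟩ := hB
    obtain ⟨y, hy, hd⟩ := exists_p1Dist_lt_of_mem_adicClosure C.absv hQc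
      (fun i => c / (2 * B) / R) (fun i => by positivity)
    obtain ⟨s, rfl⟩ := horb y hy
    obtain ⟨A, hA1, hA2⟩ := hlow s (Nat.zero_le _)
    classical
    set q' : Fin n → C.carrier := fun i => if i ∈ M then C.emb ((f.eval)^[s] (a i)) else q i
      with hq'
    have hQ' : Q = chartPt M q' := by
      rw [hQ]
      funext i
      by_cases h : i ∈ M <;> simp [chartPt, h, hq']
    have hvan : MvPolynomial.eval₂ C.emb q' A = 0 :=
      eval₂_eq_zero_of_mem_pts V M A (hA A hA1) C.emb q' (hQ' ▸ hQV)
    have hlt := hB A hA1 (fun i => C.emb ((f.eval)^[s] (a i))) q'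
      (fun i => (hintC s i).trans hR1) (fun i => by
        by_cases h : i ∈ M
        · simpa [hq', h] using (hintC s i).trans hR1
        · simpa [hq', h] using hR i) (c / (2 * B)) (by positivity) (fun i => by
        by_cases h : i ∈ M
        · simp only [hq', h, if_true, sub_self, map_zero]; positivity
        · have := hd i
          simp only [hQ', chartPt, h, if_false, p1Dist_coe_coe] at this
          rw [max_eq_left (hintC s i), mul_one, div_lt_div_iff₀ (by positivity) (by linarith),
            C.absv.map_sub] at this
          have h2 : c / (2 * B) * max 1 (C.absv (q' i)) ≤ c / (2 * B) * R := by
            refine mul_le_mul_of_nonneg_left (max_le hR1 ?_) (by positivity)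
            simpa [hq', h] using hR i
          exact (lt_of_mul_lt_mul_right (this.trans_le h2) (by linarith)).le)
    rw [hvan, sub_zero, show MvPolynomial.eval₂ C.emb (fun i => C.emb ((f.eval)^[s] (a i))) A =
      C.emb (MvPolynomial.eval (fun i => (f.eval)^[s] (a i)) A) from
        (MvPolynomial.eval₂_comp_left C.emb (RingHom.id K) _ A).symm ▸ by
          rw [RingHom.comp_id]; rfl, C.compat] at hlt
    have : B * (c / (2 * B)) = c / 2 := by field_simp
    linarith

lemma exists_mem_not_equiv {K : Type} [Field K] {T S : Set (PlaceK K)} (hT : T.Infinite)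
    (hTp : T.Pairwise fun w w' => ¬ PlaceK.Equiv w w') (hS : S.Finite) :
    ∃ w ∈ T, ∀ w' ∈ S, ¬ PlaceK.Equiv w w' := by
  by_contra! h
  choose! g hg using h
  refine hT (Set.Finite.of_finite_image (f := g) (hS.subset ?_) ?_)
  · rintro _ ⟨w, hw, rfl⟩
    exact (hg w hw).1
  · intro w hw w' hw' he
    by_contra hne
    refine hTp hw hw' hne fun x => ((hg w hw).2 x).trans ?_
    rw [he]
    exact ((hg w' hw').2 x).symm

theorem adelic_inter_eq_empty {K : Type} [Field K] {κ : Subfield K} {n : ℕ} {f : K[X]}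
    {V : ClosedSubvar K (Fin n)} {P : Fin n → OnePoint K}
    (h : InfinitelyManyPlaces K κ fun w => OrbitClosureAvoids w f P V)
    {S : Set (PlaceK K)} (hS : S.Finite) (C : ∀ w : PlaceK K, CompletionOf w) :
    VKS K κ S C n V ∩ @closure _ (adelicTop K κ S C n)
      (adelicDiag K κ S C n '' fwdOrbit (splitMap f) P) = ∅ := by
  obtain ⟨T, hT, hTp, hTw⟩ := h
  obtain ⟨w, hw, hwS⟩ := exists_mem_not_equiv hT hTp hS
  obtain ⟨-, hwκ, hav⟩ := hTw w hw
  rw [Set.eq_empty_iff_forall_notMem]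
  rintro y ⟨hyV, hyc⟩
  let W : IdxNotS K κ S := ⟨w, hwκ, hwS⟩
  have hmem : y W ∈ adicClosure (C w).absv
      (fwdOrbit (splitMap (f.map (C w).emb)) fun i => mapPoint (C w).emb (P i)) ∩
      V.pts (C w).emb := by
    refine ⟨?_, hyV W⟩
    let : ∀ w : IdxNotS K κ S, TopologicalSpace (Fin n → OnePoint (C w.1).carrier) :=
      fun w => pnTop (Fin n) (C w.1).absv
    have hcont : @Continuous (AdelicSpace K κ S C n) _ (adelicTop K κ S C n) _
        (fun y : AdelicSpace K κ S C n => y W) := continuous_apply W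
    have hic := @image_closure_subset_closure_image _ _ (adelicTop K κ S C n) _ _
      (adelicDiag K κ S C n '' fwdOrbit (splitMap f) P) hcont
    refine @closure_mono _ (pnTop (Fin n) (C w).absv) _ _ ?_ _ (hic (Set.mem_image_of_mem _ hyc))
    rintro _ ⟨_, ⟨_, ⟨s, rfl⟩, rfl⟩, rfl⟩
    refine ⟨s, ?_⟩
    have hsemi : Function.Semiconj (fun x : Fin n → OnePoint K => fun i => mapPoint (C w).emb (x i))
        (splitMap f) (splitMap (f.map (C w).emb)) := by
      intro x
      funext i
      cases hx : x i using OnePoint.rec with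
      | infty => simp [splitMap, polyEvalP1, mapPoint, hx]
      | coe b => simp [splitMap, polyEvalP1, mapPoint, hx]
    exact ((hsemi.iterate_right s).eq P).symm
  rw [hav (C w)] at hmem
  exact hmem

/-- A family of absolute values satisfying the product formula: nonarchimedean ones `fin i`,
almost all trivial at a given element, and finitely many others `inf j` with weights `wt j`. -/
structure ProductFormula (K : Type) [Field K] where
  ι : Type
  J : Type
  [fintypeJ : Fintype J]
  [infinite : Infinite ι]
  fin : ι → AbsoluteValue K ℝ
  inf : J → AbsoluteValue K ℝ
  wt : J → ℕ
  wt_pos : ∀ j, 1 ≤ wt j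
  nonarch : ∀ i x y, fin i (x + y) ≤ max (fin i x) (fin i y)
  finite : ∀ x ≠ 0, {i | fin i x ≠ 1}.Finite
  prod : ∀ x ≠ 0, (∏ᶠ i, fin i x) * ∏ j, inf j x ^ wt j = 1

attribute [instance] ProductFormula.fintypeJ ProductFormula.infinite

namespace ProductFormula
variable {K : Type} [Field K] (F : ProductFormula K)

lemma finite_gt_one (x : K) : {i | 1 < F.fin i x}.Finite := by
  by_cases h : x = 0
  · subst h
    convert! Set.finite_empty
    ext i
    simp
  · exact (F.finite x h).subset fun i (hi : 1 < F.fin i x) => hi.ne'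

lemma finite_coeff_gt_one (p : K[X]) : {i | ¬ ∀ k, F.fin i (p.coeff k) ≤ 1}.Finite := by
  refine ((Finset.finite_toSet p.support).biUnion fun k _ => F.finite_gt_one (p.coeff k)).subset ?_
  intro i hi
  have hi' : ¬ ∀ k, F.fin i (p.coeff k) ≤ 1 := hi
  push Not at hi'
  obtain ⟨k, hk⟩ := hi'
  refine Set.mem_biUnion (x := k) ?_ hk
  simp only [Finset.mem_coe, mem_support_iff]
  intro h
  rw [h, map_zero] at hk
  linarith

lemma sum_log (x : K) (hx : x ≠ 0) (B : Finset F.ι) (hB : ∀ i ∉ B, F.fin i x = 1) :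
    ∑ i ∈ B, Real.log (F.fin i x) + ∑ j, (F.wt j : ℝ) * Real.log (F.inf j x) = 0 := by
  have h := F.prod x hx
  rw [finprod_eq_prod_of_mulSupport_subset (s := B) _ (by
    intro i hi; by_contra h; exact hi (hB i h))] at h
  have h2 := congrArg Real.log h
  rw [Real.log_one, Real.log_mul, Real.log_prod, Real.log_prod] at h2
  · simpa [Real.log_pow] using h2
  · intro j _; exact pow_ne_zero _ ((F.inf j).ne_zero hx)
  · intro i _; exact (F.fin i).ne_zero hx
  · exact Finset.prod_ne_zero_iff.2 fun i _ => (F.fin i).ne_zero hx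
  · exact Finset.prod_ne_zero_iff.2 fun j _ => pow_ne_zero _ ((F.inf j).ne_zero hx)

lemma exists_lower_bound (X : Set K) (h0 : ∀ x ∈ X, x ≠ 0) (B : Set F.ι) (hBf : B.Finite)
    (hB : ∀ x ∈ X, ∀ i ∉ B, F.fin i x ≤ 1)
    (hfin : ∀ i ∈ B, ∃ C, ∀ x ∈ X, F.fin i x ≤ C)
    (hinf : ∀ j, ∃ C, ∀ x ∈ X, F.inf j x ≤ C) (i₀ : F.ι) :
    ∃ c > 0, ∀ x ∈ X, c ≤ F.fin i₀ x := by
  classical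
  have hfin' : ∀ i, ∃ C, 0 ≤ C ∧ (i ∉ B → C = 0) ∧ ∀ x ∈ X, Real.log (F.fin i x) ≤ C := by
    intro i
    by_cases h : i ∈ B
    · obtain ⟨C, hC⟩ := hfin i h
      refine ⟨Real.log (max 1 C), Real.log_nonneg (le_max_left _ _), fun h' => absurd h h',
        fun x hx => Real.log_le_log ((F.fin i).pos (h0 x hx)) ((hC x hx).trans (le_max_right _ _))⟩
    · exact ⟨0, le_rfl, fun _ => rfl, fun x hx =>
        Real.log_nonpos ((F.fin i).nonneg _) (hB x hx i h)⟩
  have hinf' : ∀ j, ∃ C, ∀ x ∈ X, Real.log (F.inf j x) ≤ C := by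
    intro j
    obtain ⟨C, hC⟩ := hinf j
    exact ⟨Real.log C, fun x hx => Real.log_le_log ((F.inf j).pos (h0 x hx)) (hC x hx)⟩
  choose C hC0 hCB hC using hfin'
  choose D hD using hinf'
  set M := ∑ i ∈ hBf.toFinset, C i + ∑ j, (F.wt j : ℝ) * D j
  refine ⟨Real.exp (-M), Real.exp_pos _, fun x hx => ?_⟩
  rw [← Real.le_log_iff_exp_le ((F.fin i₀).pos (h0 x hx))]
  set S := insert i₀ ((F.finite x (h0 x hx)).toFinset ∪ hBf.toFinset) with hS
  have h1 := F.sum_log x (h0 x hx) S (fun i hi => by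
    by_contra h; exact hi (by simp [hS, h]))
  rw [← Finset.add_sum_erase S _ (by simp [hS] : i₀ ∈ S)] at h1
  have h2 : ∑ i ∈ S.erase i₀, Real.log (F.fin i x) ≤ ∑ i ∈ hBf.toFinset, C i := by
    refine (Finset.sum_le_sum fun i _ => hC i x hx).trans ?_
    refine (Finset.sum_le_sum_of_subset_of_nonneg (Finset.erase_subset _ _)
      fun i _ _ => hC0 i).trans ?_
    refine (Finset.sum_subset (s₁ := hBf.toFinset) (by
      intro i hi; simp only [hS, Finset.mem_insert, Finset.mem_union]; exact Or.inr (Or.inr hi))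
      fun i _ hi => hCB i (by simpa using hi)).ge
  have h3 : ∑ j, (F.wt j : ℝ) * Real.log (F.inf j x) ≤ ∑ j, (F.wt j : ℝ) * D j :=
    Finset.sum_le_sum fun j _ => mul_le_mul_of_nonneg_left (hD j x hx) (Nat.cast_nonneg _)
  linarith

end ProductFormula

lemma not_eventually_exists_le_of_near_const {B : Type} [Finite B] (E : B → ℕ → ℝ)
    (c C ε : ℝ) (hε : 0 < ε) (d : ℕ) (hd : 2 ≤ d)
    (h1 : ∀ w s, E w s ≤ C * (d : ℝ) ^ s)
    (h2 : ∀ w s, c < E w s → |E w (s + 1) - E w s| ≤ c)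
    (s₀ : ℕ) (hbad : ∀ s ≥ s₀, ∃ w, ε * (d : ℝ) ^ s ≤ E w s) : False := by
  have hd1 : (1 : ℝ) < d := by exact_mod_cast hd
  obtain ⟨J, hJ⟩ := pow_unbounded_of_one_lt ((C + 1) / ε) hd1
  rw [div_lt_iff₀ hε] at hJ
  cases nonempty_fintype B
  set W : ℝ := ((Fintype.card B * J : ℕ) : ℝ) with hW
  obtain ⟨s₁, hs₁⟩ := pow_unbounded_of_one_lt (max (((W + 1) * |c|) / ε) (W * |c|)) hd1
  set s := max s₀ s₁
  have hds : max (((W + 1) * |c|) / ε) (W * |c|) < (d : ℝ) ^ s :=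
    hs₁.trans_le (pow_le_pow_right₀ hd1.le (le_max_right _ _))
  have hbad' : ∀ i : Fin (Fintype.card B + 1), ∃ w, ε * (d : ℝ) ^ (s + i * J) ≤ E w (s + i * J) :=
    fun i => hbad _ ((le_max_left _ _).trans (Nat.le_add_right _ _))
  choose w hw using hbad'
  obtain ⟨i, j, hij, hwij⟩ := Fintype.exists_ne_map_eq_of_card_lt w (by simp)
  wlog hlt : i < j generalizing i j
  · exact this j i hij.symm hwij.symm (lt_of_le_of_ne (not_lt.1 hlt) hij.symm)
  set t := s + i * J
  have hdt : max (((W + 1) * |c|) / ε) (W * |c|) < (d : ℝ) ^ t :=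
    hds.trans_le (pow_le_pow_right₀ hd1.le (Nat.le_add_right _ _))
  obtain ⟨hd2, hd3⟩ := max_lt_iff.1 hdt
  rw [div_lt_iff₀ hε] at hd2
  have hstep : ∀ k : ℕ, (k : ℝ) ≤ W → |E (w i) (t + k) - E (w i) t| ≤ k * |c| := by
    intro k
    induction k with
    | zero => simp
    | succ k ih =>
      intro hk
      push_cast at hk
      have ih' := ih (by linarith)
      have : c < E (w i) (t + k) := by
        have e1 := (abs_le.1 ih').1
        have e2 := hw i
        have e3 : (k : ℝ) * |c| + |c| ≤ W * |c| := by
          have := mul_le_mul_of_nonneg_right hk (abs_nonneg c)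
          linarith
        have e4 := le_abs_self c
        have e5 : ε * (d : ℝ) ^ t ≤ E (w i) t := e2
        have := abs_nonneg c
        by_cases hc : c = 0
        · subst hc
          simp only [abs_zero, mul_zero] at *
          have : 0 < ε * (d : ℝ) ^ t := by positivity
          linarith
        · have : 0 < |c| := abs_pos.2 hc
          linarith
      have h3 := h2 _ _ this
      have h4 := abs_add_le (E (w i) (t + k + 1) - E (w i) (t + k)) (E (w i) (t + k) - E (w i) t)
      have h5 : E (w i) (t + (k + 1)) - E (w i) t =
        (E (w i) (t + k + 1) - E (w i) (t + k)) + (E (w i) (t + k) - E (w i) t) := by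
        rw [← add_assoc]; ring
      rw [h5]
      push_cast
      have := le_abs_self c
      linarith
  obtain ⟨k, hk⟩ : ∃ k, s + j * J = t + k ∧ (k : ℝ) ≤ W ∧ J ≤ k := by
    obtain ⟨l, hl⟩ := Nat.exists_eq_add_of_lt (show (i : ℕ) < j from hlt)
    refine ⟨(l + 1) * J, ?_, ?_, ?_⟩
    · rw [hl]; simp only [t]; ring
    · rw [hW]
      have : l + 1 ≤ Fintype.card B := by have := j.2; omega
      exact_mod_cast Nat.mul_le_mul_right J this
    · nlinarith
  have h6 := hw j
  rw [← hwij, hk.1] at h6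
  have h7 := (abs_le.1 (hstep k hk.2.1)).2
  have h8 := h1 (w i) t
  have h9 : (k : ℝ) * |c| ≤ W * |c| := mul_le_mul_of_nonneg_right hk.2.1 (abs_nonneg c)
  have h10 : ε * ((d : ℝ) ^ t * (d : ℝ) ^ J) ≤ ε * (d : ℝ) ^ (t + k) := by
    rw [← pow_add]
    exact mul_le_mul_of_nonneg_left (pow_le_pow_right₀ hd1.le (by omega)) hε.le
  have h11 : (d : ℝ) ^ t * (C + 1) ≤ (d : ℝ) ^ t * ((d : ℝ) ^ J * ε) :=
    mul_le_mul_of_nonneg_left hJ.le (by positivity)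
  linarith

section Growth
variable {K : Type} [Field K] (v : AbsoluteValue K ℝ)

lemma abv_eval_le (g : K[X]) :
    ∃ C : ℝ, 1 ≤ C ∧ ∀ y, v (g.eval y) ≤ C * max 1 (v y) ^ g.natDegree := by
  refine ⟨1 + ∑ i ∈ Finset.range (g.natDegree + 1), v (g.coeff i), ?_, fun y => ?_⟩
  · have := Finset.sum_nonneg fun i (_ : i ∈ Finset.range (g.natDegree + 1)) =>
      v.nonneg (g.coeff i)
    linarith
  · rw [eval_eq_sum_range, add_mul, Finset.sum_mul]
    refine (v.sum_le _ _).trans ?_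
    have h : 0 ≤ 1 * max 1 (v y) ^ g.natDegree := by positivity
    refine le_trans (Finset.sum_le_sum fun i hi => ?_) (le_add_of_nonneg_left h)
    rw [map_mul, map_pow]
    refine mul_le_mul_of_nonneg_left ?_ (v.nonneg _)
    refine (pow_le_pow_left₀ (v.nonneg _) (le_max_right 1 _) i).trans ?_
    exact pow_le_pow_right₀ (le_max_left _ _) (by rw [Finset.mem_range] at hi; omega)

lemma abv_eval_ge (g : K[X]) (hg : 1 ≤ g.natDegree) :
    ∃ κ > 0, ∃ R : ℝ, 1 ≤ R ∧ ∀ y, R ≤ v y → κ * v y ^ g.natDegree ≤ v (g.eval y) := by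
  obtain ⟨C, hC1, hC⟩ := abv_eval_le v g.eraseLead
  have hl : 0 < v g.leadingCoeff := v.pos (by
    rw [Ne, leadingCoeff_eq_zero]; rintro rfl; simp at hg)
  refine ⟨v g.leadingCoeff / 2, by positivity, max 1 (2 * C / v g.leadingCoeff), le_max_left _ _,
    fun y hy => ?_⟩
  have hy1 : 1 ≤ v y := (le_max_left _ _).trans hy
  have hy2 : 2 * C / v g.leadingCoeff ≤ v y := (le_max_right _ _).trans hy
  rw [div_le_iff₀ hl] at hy2
  have h1 := hC y
  rw [max_eq_right hy1] at h1
  have h2 : v y ^ g.eraseLead.natDegree ≤ v y ^ (g.natDegree - 1) :=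
    pow_le_pow_right₀ hy1 g.eraseLead_natDegree_le
  have h3 : g.eval y = g.leadingCoeff * y ^ g.natDegree + g.eraseLead.eval y := by
    have := congrArg (eval y) (eraseLead_add_C_mul_X_pow g)
    simp only [eval_add, eval_mul, eval_C, eval_pow, eval_X] at this
    rw [add_comm]
    exact this.symm
  have h4 : v (g.leadingCoeff * y ^ g.natDegree) ≤ v (g.eval y) + v (g.eraseLead.eval y) := by
    have := v.add_le (g.eval y) (-g.eraseLead.eval y)
    rwa [v.map_neg, ← sub_eq_add_neg, h3, add_sub_cancel_right, ← h3] at this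
  rw [map_mul, map_pow] at h4
  have h5 : v y ^ g.natDegree = v y * v y ^ (g.natDegree - 1) := by
    rw [← pow_succ']; congr 1; omega
  have h6 : C * v y ^ g.eraseLead.natDegree ≤ C * v y ^ (g.natDegree - 1) :=
    mul_le_mul_of_nonneg_left h2 (by linarith)
  have h7 : 2 * C * v y ^ (g.natDegree - 1) ≤ v y * v g.leadingCoeff * v y ^ (g.natDegree - 1) :=
    mul_le_mul_of_nonneg_right hy2 (by positivity)
  rw [h5] at h4 ⊢
  nlinarith

lemma exists_log_eval_iterate_le (f g : K[X]) (hd : 2 ≤ f.natDegree) (a : K)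
    (h0 : ∀ s, g.eval (f.eval^[s] a) ≠ 0) :
    ∃ C, 0 ≤ C ∧ ∀ s, Real.log (v (g.eval (f.eval^[s] a))) ≤ C * (f.natDegree : ℝ) ^ s := by
  obtain ⟨A, hA1, hA⟩ := abv_eval_le v f
  obtain ⟨B, hB1, hB⟩ := abv_eval_le v g
  have hd' : (2 : ℝ) ≤ f.natDegree := by exact_mod_cast hd
  set L : ℕ → ℝ := fun s => Real.log (max 1 (v (f.eval^[s] a))) with hL
  have hL0 : ∀ s, 0 ≤ L s := fun s => Real.log_nonneg (le_max_left _ _)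
  have hlA := Real.log_nonneg hA1
  have hlB := Real.log_nonneg hB1
  have hstep : ∀ s, L (s + 1) ≤ Real.log A + f.natDegree * L s := by
    intro s
    simp only [hL, Function.iterate_succ_apply']
    rw [← Real.log_pow, ← Real.log_mul (by positivity) (by positivity)]
    refine Real.log_le_log (by positivity) (max_le ?_ (hA _))
    exact one_le_mul_of_one_le_of_one_le hA1 (one_le_pow₀ (le_max_left _ _))
  have hind : ∀ s, L s + Real.log A ≤ (f.natDegree : ℝ) ^ s * (L 0 + Real.log A) := by
    intro s
    induction s with
    | zero => simp
    | succ s ih =>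
      have h1 := hstep s
      have h2 := mul_le_mul_of_nonneg_left ih (by linarith : (0 : ℝ) ≤ f.natDegree)
      rw [pow_succ']
      nlinarith
  refine ⟨Real.log B + g.natDegree * (L 0 + Real.log A), by
    have := hL0 0; positivity, fun s => ?_⟩
  have h1 : Real.log (v (g.eval (f.eval^[s] a))) ≤ Real.log B + g.natDegree * L s := by
    simp only [hL]
    rw [← Real.log_pow, ← Real.log_mul (by positivity) (by positivity)]
    exact Real.log_le_log (v.pos (h0 s)) (hB _)
  have h2 := hind s
  have h3 : (1 : ℝ) ≤ (f.natDegree : ℝ) ^ s := one_le_pow₀ (by linarith)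
  have h4 : (g.natDegree : ℝ) * L s ≤
      g.natDegree * ((f.natDegree : ℝ) ^ s * (L 0 + Real.log A)) :=
    mul_le_mul_of_nonneg_left (by linarith) (Nat.cast_nonneg _)
  nlinarith

lemma exists_le_log_eval_iterate (f g : K[X]) (hd : 2 ≤ f.natDegree) (hg : 1 ≤ g.natDegree)
    (a : K) (hunb : ∀ R : ℝ, ∃ s, R ≤ v (f.eval^[s] a)) :
    ∃ c > 0, ∃ s₀, ∀ s ≥ s₀, c * (f.natDegree : ℝ) ^ s ≤ Real.log (v (g.eval (f.eval^[s] a))) := by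
  obtain ⟨κ, hκ, R₁, hR₁, h₁⟩ := abv_eval_ge v f (by omega)
  obtain ⟨μ, hμ, R₂, hR₂, h₂⟩ := abv_eval_ge v g hg
  have hd' : (2 : ℝ) ≤ f.natDegree := by exact_mod_cast hd
  set M : ℝ := 1 + Real.log (max R₁ R₂) + |Real.log μ| with hM
  have hM1 : 1 ≤ M := by
    have := Real.log_nonneg (hR₁.trans (le_max_left R₁ R₂))
    have := abs_nonneg (Real.log μ)
    linarith
  obtain ⟨s₀, hs₀⟩ := hunb (Real.exp (|Real.log κ| + M))
  have hbig : ∀ k : ℕ, ∀ y, |Real.log κ| + (f.natDegree : ℝ) ^ k * M ≤ Real.log (v y) →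
      0 < v y → max R₁ R₂ ≤ v y := by
    intro k y hy hy0
    rw [← Real.log_le_log_iff (by positivity) hy0]
    have h3 : (1 : ℝ) ≤ (f.natDegree : ℝ) ^ k := one_le_pow₀ (by linarith)
    have := abs_nonneg (Real.log κ)
    have := abs_nonneg (Real.log μ)
    nlinarith
  have hind : ∀ k : ℕ, 0 < v (f.eval^[s₀ + k] a) ∧ |Real.log κ| + (f.natDegree : ℝ) ^ k * M ≤
      Real.log (v (f.eval^[s₀ + k] a)) := by
    intro k
    induction k with
    | zero =>
      have hpos := (Real.exp_pos _).trans_le hs₀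
      refine ⟨hpos, ?_⟩
      rw [Nat.add_zero, pow_zero, one_mul]
      exact (Real.le_log_iff_exp_le hpos).2 hs₀
    | succ k ih =>
      obtain ⟨ih0, ih1⟩ := ih
      have h3 := h₁ _ ((le_max_left _ _).trans (hbig k _ ih1 ih0))
      rw [← add_assoc, Function.iterate_succ_apply']
      have hpos : 0 < κ * v (f.eval^[s₀ + k] a) ^ f.natDegree := by positivity
      refine ⟨hpos.trans_le h3, ?_⟩
      have h4 := Real.log_le_log hpos h3
      rw [Real.log_mul hκ.ne' (by positivity), Real.log_pow] at h4
      have h5 := mul_le_mul_of_nonneg_left ih1 (by linarith : (0 : ℝ) ≤ f.natDegree)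
      have h6 := neg_abs_le (Real.log κ)
      have h7 := abs_nonneg (Real.log κ)
      rw [pow_succ']
      nlinarith
  refine ⟨((f.natDegree : ℝ) ^ s₀)⁻¹, by positivity, s₀, fun s hs => ?_⟩
  obtain ⟨k, rfl⟩ := Nat.exists_eq_add_of_le hs
  obtain ⟨h3, h4⟩ := hind k
  have h5 := hbig k _ h4 h3
  have h6 := h₂ _ ((le_max_right _ _).trans h5)
  have hy1 : 1 ≤ v (f.eval^[s₀ + k] a) := hR₁.trans ((le_max_left _ _).trans h5)
  have h7 : μ * v (f.eval^[s₀ + k] a) ≤ v (g.eval (f.eval^[s₀ + k] a)) :=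
    le_trans (mul_le_mul_of_nonneg_left (le_self_pow₀ hy1 (by omega)) hμ.le) h6
  have h8 := Real.log_le_log (by positivity) h7
  rw [Real.log_mul hμ.ne' h3.ne'] at h8
  rw [pow_add, inv_mul_cancel_left₀ (by positivity)]
  have h9 : (1 : ℝ) ≤ (f.natDegree : ℝ) ^ k := one_le_pow₀ (by linarith)
  have h10 := neg_abs_le (Real.log μ)
  have h11 := abs_nonneg (Real.log μ)
  have h12 := abs_nonneg (Real.log κ)
  have h13 := Real.log_nonneg (hR₁.trans (le_max_left R₁ R₂))
  have h14 : (f.natDegree : ℝ) ^ k * (1 + |Real.log μ|) ≤ (f.natDegree : ℝ) ^ k * M :=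
    mul_le_mul_of_nonneg_left (by linarith) (by positivity)
  nlinarith

lemma exists_log_near_const (f g h : K[X]) (hg : 1 ≤ g.natDegree) (hgh : g.comp f = g * h)
    (hcop : IsCoprime g h) : ∃ c, 0 ≤ c ∧ ∀ y, g.eval y ≠ 0 → g.eval (f.eval y) ≠ 0 →
      c < -Real.log (v (g.eval y)) →
      |Real.log (v (g.eval (f.eval y))) - Real.log (v (g.eval y))| ≤ c := by
  obtain ⟨κ, hκ, R, hR, h₁⟩ := abv_eval_ge v g hg
  obtain ⟨β, α, hab⟩ := hcop
  obtain ⟨A, hA1, hA⟩ := abv_eval_le v α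
  obtain ⟨B, hB1, hB⟩ := abv_eval_le v β
  obtain ⟨H, hH1, hH⟩ := abv_eval_le v h
  set ρ := max R (1 / κ) with hρ
  have hρ1 : 1 ≤ ρ := hR.trans (le_max_left _ _)
  set A' := A * ρ ^ α.natDegree
  set B' := B * ρ ^ β.natDegree
  set H' := H * ρ ^ h.natDegree
  have hA'1 : 1 ≤ A' := one_le_mul_of_one_le_of_one_le hA1 (one_le_pow₀ hρ1)
  have hB'1 : 1 ≤ B' := one_le_mul_of_one_le_of_one_le hB1 (one_le_pow₀ hρ1)
  have hH'1 : 1 ≤ H' := one_le_mul_of_one_le_of_one_le hH1 (one_le_pow₀ hρ1)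
  have l1 := Real.log_nonneg hH'1
  have l2 : 0 ≤ Real.log (2 * A') := Real.log_nonneg (by linarith)
  have l3 : 0 ≤ Real.log (2 * B') := Real.log_nonneg (by linarith)
  refine ⟨Real.log H' + Real.log (2 * A') + Real.log (2 * B'), by linarith, ?_⟩
  intro y hy hfy hc
  have hgy := v.pos hy
  have hlt : v (g.eval y) < (2 * B')⁻¹ := by
    rw [← Real.log_lt_log_iff hgy (by positivity), Real.log_inv]
    linarith
  have hlt1 : v (g.eval y) < 1 := hlt.trans_le (inv_le_one_of_one_le₀ (by linarith))
  have hyρ : v y ≤ ρ := by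
    by_contra! hcon
    have h2 := h₁ y ((le_max_left _ _).trans hcon.le)
    have h3 : 1 / κ < v y := (le_max_right _ _).trans_lt hcon
    rw [div_lt_iff₀ hκ] at h3
    have h4 : v y ≤ v y ^ g.natDegree := le_self_pow₀ (hρ1.trans hcon.le) (by omega)
    nlinarith
  have hmax : max 1 (v y) ≤ ρ := max_le hρ1 hyρ
  have hα : v (α.eval y) ≤ A' := (hA y).trans
    (mul_le_mul_of_nonneg_left (pow_le_pow_left₀ (by positivity) hmax _) (by linarith))
  have hβ : v (β.eval y) ≤ B' := (hB y).trans
    (mul_le_mul_of_nonneg_left (pow_le_pow_left₀ (by positivity) hmax _) (by linarith))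
  have hh : v (h.eval y) ≤ H' := (hH y).trans
    (mul_le_mul_of_nonneg_left (pow_le_pow_left₀ (by positivity) hmax _) (by linarith))
  have hmul : g.eval (f.eval y) = g.eval y * h.eval y := by
    rw [← eval_comp, hgh, eval_mul]
  have hhy : h.eval y ≠ 0 := by
    intro h0; rw [hmul, h0, mul_zero] at hfy; exact hfy rfl
  have hone : (1 : ℝ) ≤ v (β.eval y) * v (g.eval y) + v (α.eval y) * v (h.eval y) := by
    have := congrArg (eval y) hab
    simp only [eval_add, eval_mul, eval_one] at this
    have h2 := v.add_le (β.eval y * g.eval y) (α.eval y * h.eval y)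
    rw [this, map_one, map_mul, map_mul] at h2
    exact h2
  have h3 : v (β.eval y) * v (g.eval y) ≤ 1 / 2 := by
    have := mul_le_mul hβ hlt.le (v.nonneg _) (by linarith)
    refine this.trans (le_of_eq ?_)
    field_simp
  have h4 : (2 * A')⁻¹ ≤ v (h.eval y) := by
    rw [inv_le_iff_one_le_mul₀ (by positivity)]
    have := mul_le_mul_of_nonneg_right hα (v.nonneg (h.eval y))
    linarith
  rw [hmul, map_mul, Real.log_mul hgy.ne' (v.pos hhy).ne', add_sub_cancel_left, abs_le]
  have h5 := Real.log_le_log (by positivity) h4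
  have h6 := Real.log_le_log (v.pos hhy) hh
  rw [Real.log_inv] at h5
  constructor <;> linarith

end Growth

lemma false_of_sum_log_eq_zero {K I : Type} [Field K] [Fintype I] [DecidableEq I]
    (av : I → AbsoluteValue K ℝ)
    (wt : I → ℕ) (hwt : ∀ w, 1 ≤ wt w) (f g h : K[X]) (hd : 2 ≤ f.natDegree)
    (hg : 1 ≤ g.natDegree) (hgh : g.comp f = g * h) (hcop : IsCoprime g h) (a : K)
    (h0 : ∀ s, g.eval (f.eval^[s] a) ≠ 0)
    (hsum : ∀ s, ∑ w, (wt w : ℝ) * Real.log (av w (g.eval (f.eval^[s] a))) = 0)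
    (w₀ : I) (hunb : ∀ R : ℝ, ∃ s, R ≤ av w₀ (f.eval^[s] a)) : False := by
  choose C hC0 hC using fun w => exists_log_eval_iterate_le (av w) f g hd a h0
  choose c hc0 hc using fun w => exists_log_near_const (av w) f g h hg hgh hcop
  obtain ⟨ε, hε, s₀, hlow⟩ := exists_le_log_eval_iterate (av w₀) f g hd hg a hunb
  have hI : (0 : ℝ) < Fintype.card I := by
    have : Nonempty I := ⟨w₀⟩
    exact_mod_cast Fintype.card_pos
  set E : I → ℕ → ℝ := fun w s => -((wt w : ℝ) * Real.log (av w (g.eval (f.eval^[s] a)))) with hE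
  have hEsum : ∀ s, ∑ w, E w s = 0 := fun s => by
    simp only [hE, Finset.sum_neg_distrib, hsum, neg_zero]
  have hEle : ∀ w s, -E w s ≤ (wt w * C w) * (f.natDegree : ℝ) ^ s := fun w s => by
    simp only [hE, neg_neg, mul_assoc]
    exact mul_le_mul_of_nonneg_left (hC w s) (Nat.cast_nonneg _)
  have hterm : ∀ w, 0 ≤ (wt w : ℝ) * c w := fun w => mul_nonneg (Nat.cast_nonneg _) (hc0 w)
  refine not_eventually_exists_le_of_near_const E (∑ w, (wt w : ℝ) * c w)
    (∑ w, (wt w : ℝ) * C w) (ε / Fintype.card I) (by positivity) f.natDegree hd ?_ ?_ s₀ ?_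
  · intro w s
    have h1 := hEsum s
    rw [← Finset.add_sum_erase _ _ (Finset.mem_univ w)] at h1
    have h2 : E w s = ∑ x ∈ Finset.univ.erase w, -E x s := by
      rw [Finset.sum_neg_distrib]; linarith
    rw [h2, Finset.sum_mul]
    refine (Finset.sum_le_sum fun x _ => hEle x s).trans ?_
    refine Finset.sum_le_sum_of_subset_of_nonneg (Finset.erase_subset _ _) fun x _ _ => ?_
    have := hC0 x
    positivity
  · intro w s hs
    have h1 : (wt w : ℝ) * c w ≤ ∑ w, (wt w : ℝ) * c w :=
      Finset.single_le_sum (f := fun w => (wt w : ℝ) * c w) (fun x _ => hterm x)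
        (Finset.mem_univ w)
    have hw : (0 : ℝ) < wt w := by exact_mod_cast hwt w
    have h2 : c w < -Real.log (av w (g.eval (f.eval^[s] a))) := by
      have := h1.trans_lt hs
      simp only [hE, ← mul_neg] at this
      exact lt_of_mul_lt_mul_left this hw.le
    have h3 := hc w _ (h0 s) (by
      have := h0 (s + 1); rwa [Function.iterate_succ_apply'] at this) h2
    refine le_trans ?_ h1
    simp only [hE, Function.iterate_succ_apply']
    rw [neg_sub_neg, ← mul_sub, abs_mul, abs_of_pos hw, abs_sub_comm]
    exact mul_le_mul_of_nonneg_left h3 hw.le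
  · intro s hs
    have h1 := hlow s hs
    have hw : (1 : ℝ) ≤ wt w₀ := by exact_mod_cast hwt w₀
    have h2 : E w₀ s ≤ -(ε * (f.natDegree : ℝ) ^ s) := by
      simp only [hE]
      have : 0 < ε * (f.natDegree : ℝ) ^ s := by
        have : (0 : ℝ) < f.natDegree := by exact_mod_cast (by omega : 0 < f.natDegree)
        positivity
      nlinarith
    by_contra! hcon
    have h3 : ∑ w, E w s ≤
        E w₀ s + ∑ w ∈ Finset.univ.erase w₀, ε / Fintype.card I * (f.natDegree : ℝ) ^ s := by
      rw [← Finset.add_sum_erase _ _ (Finset.mem_univ w₀)]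
      have := Finset.sum_le_sum fun w (_ : w ∈ Finset.univ.erase w₀) => (hcon w).le
      linarith
    rw [hEsum, Finset.sum_const, Finset.card_erase_of_mem (Finset.mem_univ _), Finset.card_univ,
      nsmul_eq_mul] at h3
    have hpos : 0 < (f.natDegree : ℝ) ^ s := by
      have : (0 : ℝ) < f.natDegree := by exact_mod_cast (by omega : 0 < f.natDegree)
      positivity
    have h4 : ((Fintype.card I - 1 : ℕ) : ℝ) = Fintype.card I - 1 := by
      rw [Nat.cast_sub, Nat.cast_one]
      exact_mod_cast hI
    rw [h4] at h3
    have h5 : (Fintype.card I - 1 : ℝ) * (ε / Fintype.card I * (f.natDegree : ℝ) ^ s) =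
      ε * (f.natDegree : ℝ) ^ s - ε / Fintype.card I * (f.natDegree : ℝ) ^ s := by
      field_simp
    have h6 : 0 < ε / Fintype.card I * (f.natDegree : ℝ) ^ s := by positivity
    linarith

lemma exists_irreducible_dvd_sub_X {K : Type} [Field K] [CharZero K] (f : K[X])
    (hd : 2 ≤ f.natDegree) :
    ∃ g h : K[X], Irreducible g ∧ g ∣ f - X ∧ IsCoprime g (derivative f) ∧
      g.comp f = g * h ∧ IsCoprime g h := by
  have hdeg : (f - X).natDegree = f.natDegree :=
    natDegree_sub_eq_left_of_natDegree_lt (by rw [natDegree_X]; omega)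
  have hne : f - X ≠ 0 := by
    intro h; rw [h, natDegree_zero] at hdeg; omega
  obtain ⟨g, hgi, hgd, hgf⟩ : ∃ g : K[X], Irreducible g ∧ g ∣ f - X ∧ ¬ g ∣ derivative f := by
    by_contra! hcon
    have hsq : Squarefree (f - X) := by
      rw [squarefree_iff_irreducible_sq_not_dvd_of_ne_zero hne]
      intro x hx hxx
      have h1 : x ∣ f - X := (dvd_mul_right x x).trans hxx
      have h2 : x ∣ derivative (f - X) := by
        obtain ⟨r, hr⟩ := hxx
        rw [hr, derivative_mul, derivative_mul]
        exact dvd_add ((dvd_add (dvd_mul_left _ _) (dvd_mul_right _ _)).mul_right _)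
          (((dvd_mul_right x x)).mul_right _)
      have h3 := hcon x hx h1
      rw [derivative_sub, derivative_X] at h2
      have h4 := (dvd_sub h3 h2)
      rw [sub_sub_cancel] at h4
      exact hx.not_isUnit (isUnit_of_dvd_one h4)
    have h1 : f - X ∣ derivative f := by
      classical
      obtain ⟨r, hr⟩ := EuclideanDomain.gcd_dvd_left (f - X) (derivative f)
      by_cases hru : IsUnit r
      · have := EuclideanDomain.gcd_dvd_right (f - X) (derivative f)
        rw [hr]
        exact hru.mul_right_dvd.2 this
      · obtain ⟨x, hx, hxr⟩ := WfDvdMonoid.exists_irreducible_factor hru (by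
          rintro rfl; rw [mul_zero] at hr; exact hne hr)
        have hxu : x ∣ f - X := hr ▸ hxr.mul_left _
        have hxg : x ∣ EuclideanDomain.gcd (f - X) (derivative f) :=
          EuclideanDomain.dvd_gcd hxu (hcon x hx hxu)
        exact absurd (hsq x (hr ▸ mul_dvd_mul hxg hxr)) hx.not_isUnit
    have h2 : derivative f ≠ 0 := by
      intro h
      have := derivative_eq_zero.1 h
      omega
    have := natDegree_le_of_dvd h1 h2
    have := natDegree_derivative_lt (p := f) (by omega)
    omega
  have hcomp : ∀ p : K[X], g ∣ p.comp f - p := by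
    intro p
    have : f - X ∣ p.comp f - p := by
      have := sub_dvd_eval_sub f X (p.map C)
      simpa [eval_map, ← eval₂_eq_eval_map, comp] using this
    exact hgd.trans this
  obtain ⟨h, hh⟩ : g ∣ g.comp f := by
    have := dvd_add (hcomp g) (dvd_refl g)
    rwa [sub_add_cancel] at this
  refine ⟨g, h, hgi, hgd, hgi.coprime_iff_not_dvd.2 hgf, hh, hgi.coprime_iff_not_dvd.2 ?_⟩
  intro hgh
  have hd' := congrArg derivative hh
  rw [derivative_comp, derivative_mul] at hd'
  have h1 : g ∣ derivative f * (derivative g).comp f := by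
    rw [hd']
    exact dvd_add (hgh.mul_left _) (dvd_mul_right _ _)
  rcases hgi.prime.dvd_or_dvd h1 with h2 | h2
  · exact hgf h2
  · have h3 : g ∣ derivative g := by
      have := dvd_sub h2 (hcomp (derivative g))
      rwa [sub_sub_cancel] at this
    have hpos := hgi.natDegree_pos
    have h4 : derivative g ≠ 0 := by
      intro h
      have := derivative_eq_zero.1 h
      omega
    have := natDegree_le_of_dvd h3 h4
    have := natDegree_derivative_lt (p := g) (by omega)
    omega

section Residue
variable {K : Type} [Field K] {v : AbsoluteValue K ℝ}
  {hv : ∀ x y : K, v (x + y) ≤ max (v x) (v y)}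

lemma absInt_isUnit_iff {x : absInt v hv} : IsUnit x ↔ v x = 1 := by
  constructor
  · rintro ⟨u, rfl⟩
    have h1 : v (u : absInt v hv) ≤ 1 := (u : absInt v hv).2
    have h2 : v (↑u⁻¹ : absInt v hv) ≤ 1 := (↑u⁻¹ : absInt v hv).2
    have h3 : v (u : absInt v hv) * v (↑u⁻¹ : absInt v hv) = 1 := by
      rw [← map_mul, ← Subring.coe_mul, Units.mul_inv]; simp
    nlinarith [v.nonneg ((u : absInt v hv) : K), v.nonneg ((↑u⁻¹ : absInt v hv) : K)]
  · intro h
    have hx : (x : K) ≠ 0 := by intro h0; rw [h0, map_zero] at h; norm_num at h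
    refine IsUnit.of_mul_eq_one ⟨(x : K)⁻¹, by rw [mem_absInt, map_inv₀, h, inv_one]⟩ ?_
    ext
    simp [hx]

instance : IsLocalRing (absInt v hv) := by
  refine IsLocalRing.of_nonunits_add fun a b ha hb => ?_
  have hlt : ∀ x : absInt v hv, x ∈ nonunits (absInt v hv) ↔ v x < 1 := fun x => by
    rw [mem_nonunits_iff, absInt_isUnit_iff]
    exact ⟨fun h => lt_of_le_of_ne x.2 h, fun h => h.ne⟩
  rw [hlt] at *
  exact (hv _ _).trans_lt (max_lt ha hb)

lemma absInt_residue_eq_zero_iff {x : absInt v hv} :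
    IsLocalRing.residue (absInt v hv) x = 0 ↔ v x < 1 := by
  rw [IsLocalRing.residue_eq_zero_iff, IsLocalRing.mem_maximalIdeal, mem_nonunits_iff,
    absInt_isUnit_iff]
  exact ⟨fun h => lt_of_le_of_ne x.2 h, fun h => h.ne⟩

lemma Polynomial.exists_map_subtype_eq (R : Subring K) {p : K[X]} (hp : ∀ k, p.coeff k ∈ R) :
    ∃ q : R[X], q.map R.subtype = p := by
  have : p ∈ Polynomial.lifts R.subtype := by
    rw [lifts_iff_coeff_lifts]
    intro k
    simpa using hp k
  exact this

lemma absInt_eval_sub_le (v : AbsoluteValue K ℝ)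
    (hv : ∀ x y : K, v (x + y) ≤ max (v x) (v y)) {p : K[X]} (hp : ∀ k, v (p.coeff k) ≤ 1)
    {x y : K} (hx : v x ≤ 1) (hy : v y ≤ 1) :
    v (p.eval x - p.eval y) ≤ v (x - y) ∧
    v (p.eval x - p.eval y) ≤ v (x - y) * max (v ((derivative p).eval y)) (v (x - y)) := by
  obtain ⟨q, rfl⟩ := exists_map_subtype_eq (absInt v hv) hp
  obtain ⟨k, hk⟩ := q.binomExpansion (⟨y, hy⟩ : absInt v hv) (⟨x, hx⟩ - ⟨y, hy⟩)
  have hk' := congrArg (absInt v hv).subtype hk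
  simp only [add_sub_cancel, map_add, map_mul, map_sub, map_pow] at hk'
  rw [← eval_map_apply, ← eval_map_apply, ← eval_map_apply, ← derivative_map] at hk'
  simp only [Subring.subtype_apply] at hk'
  have key : (q.map (absInt v hv).subtype).eval x - (q.map (absInt v hv).subtype).eval y =
      (x - y) * ((derivative (q.map (absInt v hv).subtype)).eval y + k * (x - y)) := by
    rw [hk']; ring
  have hd : v ((derivative (q.map (absInt v hv).subtype)).eval y) ≤ 1 := by
    have : ((derivative q).eval (⟨y, hy⟩ : absInt v hv)).1 =
      (derivative (q.map (absInt v hv).subtype)).eval y := by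
      rw [derivative_map]
      exact (eval_map_apply (absInt v hv).subtype (⟨y, hy⟩ : absInt v hv)).symm
    rw [← this]
    exact mem_absInt.1 (SetLike.coe_mem (eval (⟨y, hy⟩ : absInt v hv) (derivative q)))
  have hxy : v (x - y) ≤ 1 := (absInt v hv).sub_mem hx hy
  have hkxy : v (k * (x - y)) ≤ v (x - y) := by
    rw [map_mul]
    exact mul_le_of_le_one_left (v.nonneg _) k.2
  rw [key, map_mul]
  constructor
  · refine mul_le_of_le_one_right (v.nonneg _) ((hv _ _).trans (max_le hd (hkxy.trans hxy)))
  · exact mul_le_mul_of_nonneg_left ((hv _ _).trans (max_le_max le_rfl hkxy)) (v.nonneg _)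

lemma exists_lt_abv_sub_lt_one (v : AbsoluteValue K ℝ)
    (hv : ∀ x y : K, v (x + y) ≤ max (v x) (v y)) {p : K[X]} (hp : ∀ k, v (p.coeff k) ≤ 1)
    (hp1 : ∃ k, v (p.coeff k) = 1) (y : ℕ → K) (hy : ∀ s, v (y s) ≤ 1) {S : Set ℕ}
    (hS : S.Infinite) (hSp : ∀ s ∈ S, v (p.eval (y s)) < 1) :
    ∃ s ∈ S, ∃ t ∈ S, s < t ∧ v (y t - y s) < 1 := by
  obtain ⟨q, rfl⟩ := exists_map_subtype_eq (absInt v hv) hp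
  set res := IsLocalRing.residue (absInt v hv)
  have hq : q.map res ≠ 0 := by
    obtain ⟨k, hk⟩ := hp1
    intro h0
    have h1 := congrArg (fun r => r.coeff k) h0
    simp only [coeff_map, coeff_zero] at h1
    rw [absInt_residue_eq_zero_iff] at h1
    rw [coeff_map] at hk
    exact h1.ne hk
  have hmaps : Set.MapsTo (fun s => res ⟨y s, hy s⟩) S ((q.map res).rootSet _) := by
    intro s hs
    rw [mem_rootSet]
    refine ⟨hq, ?_⟩
    rw [coe_aeval_eq_eval, eval_map_apply, absInt_residue_eq_zero_iff]
    have := hSp s hs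
    rw [show y s = (absInt v hv).subtype ⟨y s, hy s⟩ from rfl, eval_map_apply] at this
    exact this
  obtain ⟨s, hs, t, ht, hst, he⟩ := hS.exists_ne_map_eq_of_mapsTo hmaps (Set.toFinite _)
  have hsub : v (y s - y t) < 1 := by
    have h1 : res (⟨y s, hy s⟩ - ⟨y t, hy t⟩) = 0 := by
      rw [map_sub, sub_eq_zero]; exact he
    exact absInt_residue_eq_zero_iff.1 h1
  rcases lt_or_gt_of_ne hst with h | h
  · exact ⟨s, hs, t, ht, h, by rwa [v.map_sub]⟩
  · exact ⟨t, ht, s, hs, h, hsub⟩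

lemma exists_abv_iterate_sub_lt (v : AbsoluteValue K ℝ)
    (hv : ∀ x y : K, v (x + y) ≤ max (v x) (v y)) {f : K[X]} (hf : ∀ k, v (f.coeff k) ≤ 1)
    (hf' : ∀ k, v ((derivative f).coeff k) ≤ 1) (hf1 : ∃ k, v ((derivative f).coeff k) = 1)
    {a : K} (ha : v a ≤ 1)
    (hinf : {s | v ((derivative f).eval (f.eval^[s] a)) < 1}.Infinite) :
    ∃ r ≥ 1, ∀ ε > 0, ∃ t, v (f.eval^[t + r] a - f.eval^[t] a) < ε := by
  set y : ℕ → K := fun s => f.eval^[s] a with hy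
  have hyi : ∀ s, v (y s) ≤ 1 := fun s => iterate_eval_mem_subring (absInt v hv) hf ha s
  obtain ⟨s, hs, t, -, hst, hlt⟩ := exists_lt_abv_sub_lt_one v hv hf' hf1 y hyi hinf fun s hs => hs
  obtain ⟨r, rfl⟩ := Nat.exists_eq_add_of_lt hst
  rw [add_assoc] at hlt
  refine ⟨r + 1, by omega, ?_⟩
  generalize r + 1 = r' at hlt
  have hsucc : ∀ t, y (t + 1) = f.eval (y t) := fun t => Function.iterate_succ_apply' _ _ _
  have hstep : ∀ t, v (y (t + 1 + r') - y (t + 1)) ≤ v (y (t + r') - y t) := fun t => by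
    rw [show t + 1 + r' = t + r' + 1 by ring, hsucc, hsucc]
    exact (absInt_eval_sub_le v hv hf (hyi _) (hyi _)).1
  have hmono : ∀ t k, v (y (t + k + r') - y (t + k)) ≤ v (y (t + r') - y t) := fun t k => by
    induction k with
    | zero => exact le_rfl
    | succ k ih => exact (hstep (t + k)).trans ih
  set δ := v (y (s + r') - y s) with hδ
  have hclose : ∀ k, v (y (s + k * r') - y s) ≤ δ := fun k => by
    induction k with
    | zero => simp [hδ, v.nonneg]
    | succ k ih =>
      rw [show y (s + (k + 1) * r') - y s =
        (y (s + k * r' + r') - y (s + k * r')) + (y (s + k * r') - y s) by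
          rw [show s + (k + 1) * r' = s + k * r' + r' by ring]; ring]
      exact (hv _ _).trans (max_le (hmono _ _) ih)
  set ρ := max (v ((derivative f).eval (y s))) δ with hρ
  have hρ1 : ρ < 1 := max_lt hs hlt
  have hρ0 : 0 ≤ ρ := (v.nonneg _).trans (le_max_right _ _)
  have hder : ∀ k, v ((derivative f).eval (y (s + k * r'))) ≤ ρ := fun k => by
    have h1 := (absInt_eval_sub_le v hv hf' (hyi (s + k * r')) (hyi s)).1.trans (hclose k)
    have h2 := hv ((derivative f).eval (y (s + k * r')) - (derivative f).eval (y s))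
      ((derivative f).eval (y s))
    rw [sub_add_cancel] at h2
    exact h2.trans (max_le (h1.trans (le_max_right _ _)) (le_max_left _ _))
  have hper : 1 ≤ r' → ∀ k, v (y (s + k * r' + r') - y (s + k * r')) ≤ ρ ^ k := fun hr k => by
    induction k with
    | zero =>
      have : δ < 1 := hlt
      simpa [hδ] using this.le
    | succ k ih =>
      obtain ⟨m, rfl⟩ := Nat.exists_eq_add_of_le' hr
      have h1 := hmono (s + k * (m + 1) + 1) m
      rw [show s + (k + 1) * (m + 1) = s + k * (m + 1) + 1 + m by ring]
      refine h1.trans ?_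
      rw [show s + k * (m + 1) + 1 + (m + 1) = s + k * (m + 1) + (m + 1) + 1 by ring, hsucc,
        hsucc (s + k * (m + 1))]
      refine (absInt_eval_sub_le v hv hf (hyi _) (hyi _)).2.trans ?_
      rw [pow_succ]
      refine mul_le_mul ih (max_le (hder k) ?_) (by positivity) (by positivity)
      exact (hmono _ _).trans (le_max_right _ _)
  intro ε hε
  by_cases hr : 1 ≤ r'
  · obtain ⟨k, hk⟩ := exists_pow_lt_of_lt_one hε hρ1
    exact ⟨s + k * r', (hper hr k).trans_lt hk⟩
  · obtain rfl : r' = 0 := by omega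
    exact ⟨0, by simpa using hε⟩

lemma abv_eval_eq_one_of_bezout (v : AbsoluteValue K ℝ)
    (hv : ∀ x y : K, v (x + y) ≤ max (v x) (v y)) {g p u w : K[X]} (h : u * g + w * p = 1)
    (hu : ∀ k, v (u.coeff k) ≤ 1) (hw : ∀ k, v (w.coeff k) ≤ 1) (hp : ∀ k, v (p.coeff k) ≤ 1)
    {y : K} (hy : v y ≤ 1) (hg : v (g.eval y) < 1) : v (p.eval y) = 1 := by
  have h1 : v (p.eval y) ≤ 1 := eval_mem_subring (absInt v hv) hp hy
  have h2 : v (w.eval y) ≤ 1 := eval_mem_subring (absInt v hv) hw hy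
  have h3 : v (u.eval y) ≤ 1 := eval_mem_subring (absInt v hv) hu hy
  have h4 := congrArg (eval y) h
  simp only [eval_add, eval_mul, eval_one] at h4
  have h5 := hv (u.eval y * g.eval y) (w.eval y * p.eval y)
  rw [h4, map_one, map_mul, map_mul] at h5
  have h6 : v (u.eval y) * v (g.eval y) < 1 := by
    nlinarith [v.nonneg (u.eval y), v.nonneg (g.eval y)]
  rcases le_max_iff.1 h5 with h7 | h7
  · linarith
  · nlinarith [v.nonneg (w.eval y), v.nonneg (p.eval y)]

end Residue

namespace ProductFormula
variable {K : Type} [Field K] (F : ProductFormula K)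

lemma finite_coeff_ne_one {p : K[X]} (hp : p ≠ 0) : {i | ¬ ∃ k, F.fin i (p.coeff k) = 1}.Finite := by
  refine (F.finite p.leadingCoeff (leadingCoeff_ne_zero.2 hp)).subset fun i hi h => hi ⟨_, h⟩

/-- The set of places `T` is adapted to the sequence `y` and to the polynomial `f`: the derivative
of `f` is eventually a unit along `y`, and every nonzero polynomial is bounded below along `y`
at almost all places of `T`. -/
structure IsAdapted (T : Set F.ι) (f : K[X]) (y : ℕ → K) : Prop where
  infinite : T.Infinite
  derivative_eq : ∀ i ∈ T, ∃ s₀, ∀ s ≥ s₀, F.fin i ((derivative f).eval (y s)) = 1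
  lower_bound : ∀ b : K[X], b ≠ 0 →
    {i ∈ T | ¬ ∃ c > 0, ∃ s₀, ∀ s ≥ s₀, c ≤ F.fin i (b.eval (y s))}.Finite

variable {F} in
lemma eventually_eval_ne_zero {y : ℕ → K} (hy : Function.Injective y) {b : K[X]} (hb : b ≠ 0) :
    ∃ s₀, ∀ s ≥ s₀, b.eval (y s) ≠ 0 := by
  have hfin : {s | b.eval (y s) = 0}.Finite := by
    refine Set.Finite.of_finite_image (f := y) (Set.Finite.subset (b.rootSet_finite K) ?_)
      hy.injOn
    rintro _ ⟨s, hs, rfl⟩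
    rw [mem_rootSet]
    exact ⟨hb, hs⟩
  obtain ⟨N, hN⟩ := hfin.bddAbove
  exact ⟨N + 1, fun s hs h => by have := hN (show s ∈ {s | b.eval (y s) = 0} from h); omega⟩

lemma exists_isAdapted [CharZero K] (f : K[X]) (hd : 2 ≤ f.natDegree) (a : K)
    (hinj : Function.Injective fun s => f.eval^[s] a) :
    ∃ T, F.IsAdapted T f fun s => f.eval^[s] a := by
  classical
  set y : ℕ → K := fun s => f.eval^[s] a with hy
  have hsucc : ∀ t, y (t + 1) = f.eval (y t) := fun t => Function.iterate_succ_apply' _ _ _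
  have hyint : ∀ i, F.fin i a ≤ 1 → (∀ k, F.fin i (f.coeff k) ≤ 1) → ∀ s, F.fin i (y s) ≤ 1 :=
    fun i ha hf s => iterate_eval_mem_subring (absInt (F.fin i) (F.nonarch i)) hf ha s
  set G₀ : Set F.ι := {i | 1 < F.fin i a} ∪ {i | ¬ ∀ k, F.fin i (f.coeff k) ≤ 1} with hG₀
  have hG₀f : G₀.Finite := (F.finite_gt_one a).union (F.finite_coeff_gt_one f)
  have hG₀i : ∀ i ∉ G₀, F.fin i a ≤ 1 ∧ ∀ k, F.fin i (f.coeff k) ≤ 1 := fun i hi => by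
    simp only [hG₀, Set.mem_union, not_or, Set.mem_ofPred_eq, not_not, not_lt] at hi
    exact hi
  have hevalb : ∀ (v : AbsoluteValue K ℝ) (b : K[X]), (∃ R, ∀ s, v (y s) ≤ R) →
      ∃ R, ∀ s, v (b.eval (y s)) ≤ R := fun v b ⟨R, hR⟩ => by
    obtain ⟨C, hC1, hC⟩ := abv_eval_le v b
    refine ⟨C * max 1 R ^ b.natDegree, fun s => (hC _).trans ?_⟩
    have := hR s
    gcongr
  by_cases hbd : (∀ i, ∃ R, ∀ s, F.fin i (y s) ≤ R) ∧ ∀ j, ∃ R, ∀ s, F.inf j (y s) ≤ R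
  · have hf'0 : derivative f ≠ 0 := fun h => by
      have := derivative_eq_zero.1 h; omega
    set G : Set F.ι := G₀ ∪ ({i | ¬ ∀ k, F.fin i ((derivative f).coeff k) ≤ 1} ∪
      {i | ¬ ∃ k, F.fin i ((derivative f).coeff k) = 1}) with hG
    have hGf : G.Finite :=
      hG₀f.union ((F.finite_coeff_gt_one _).union (F.finite_coeff_ne_one hf'0))
    refine ⟨Gᶜ, hGf.infinite_compl, fun i hi => ?_, fun b hb => ?_⟩
    · simp only [hG, Set.mem_compl_iff, Set.mem_union, not_or, Set.mem_ofPred_eq, not_not] at hi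
      obtain ⟨hi0, hi1, hi2⟩ := hi
      obtain ⟨hia, hif⟩ := hG₀i i hi0
      by_contra hcon
      have hinf : {s | F.fin i ((derivative f).eval (y s)) < 1}.Infinite := by
        rw [Set.infinite_iff_exists_gt]
        intro s₀
        push Not at hcon
        obtain ⟨s, hs, hne⟩ := hcon (s₀ + 1)
        refine ⟨s, lt_of_le_of_ne ?_ hne, hs⟩
        exact eval_mem_subring (absInt (F.fin i) (F.nonarch i)) hi1 (hyint i hia hif s)
      obtain ⟨r, hr, hlt⟩ := exists_abv_iterate_sub_lt (F.fin i) (F.nonarch i) hif hi1 hi2 hia hinf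
      have hsub : ∀ v : AbsoluteValue K ℝ, (∃ R, ∀ s, v (y s) ≤ R) →
          ∃ C, ∀ x ∈ Set.range fun t => y (t + r) - y t, v x ≤ C := by
        rintro v ⟨R, hR⟩
        refine ⟨R + R, ?_⟩
        rintro _ ⟨t, rfl⟩
        have h1 := v.add_le (y (t + r)) (-y t)
        rw [← sub_eq_add_neg, v.map_neg] at h1
        linarith [hR t, hR (t + r)]
      obtain ⟨c, hc, hcl⟩ := F.exists_lower_bound (Set.range fun t => y (t + r) - y t) (by
          rintro _ ⟨t, rfl⟩
          rw [sub_ne_zero]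
          intro h
          have := hinj h
          omega) G₀ hG₀f (by
          rintro _ ⟨t, rfl⟩ k hk
          obtain ⟨hka, hkf⟩ := hG₀i k hk
          exact (absInt (F.fin k) (F.nonarch k)).sub_mem (hyint k hka hkf _) (hyint k hka hkf _))
        (fun k _ => hsub _ (hbd.1 k)) (fun j => hsub _ (hbd.2 j)) i
      obtain ⟨t, ht⟩ := hlt c hc
      exact absurd (hcl _ ⟨t, rfl⟩) (not_le.2 ht)
    · convert! Set.finite_empty
      rw [Set.eq_empty_iff_forall_notMem]
      rintro i ⟨-, hi⟩
      apply hi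
      obtain ⟨s₀, hs₀⟩ := eventually_eval_ne_zero hinj hb
      have hb' : ∀ v : AbsoluteValue K ℝ, (∃ R, ∀ s, v (y s) ≤ R) →
          ∃ C, ∀ x ∈ (fun s => b.eval (y s)) '' Set.Ici s₀, v x ≤ C := by
        intro v hv
        obtain ⟨R, hR⟩ := hevalb v b hv
        exact ⟨R, by rintro _ ⟨s, -, rfl⟩; exact hR s⟩
      obtain ⟨c, hc, hcl⟩ := F.exists_lower_bound ((fun s => b.eval (y s)) '' Set.Ici s₀) (by
          rintro _ ⟨t, ht, rfl⟩
          exact hs₀ t ht) (G₀ ∪ {i | ¬ ∀ k, F.fin i (b.coeff k) ≤ 1})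
        (hG₀f.union (F.finite_coeff_gt_one b)) (by
          rintro _ ⟨t, -, rfl⟩ k hk
          simp only [Set.mem_union, not_or, Set.mem_ofPred_eq, not_not] at hk
          obtain ⟨hka, hkf⟩ := hG₀i k hk.1
          exact eval_mem_subring (absInt (F.fin k) (F.nonarch k)) hk.2 (hyint k hka hkf _))
        (fun k _ => hb' _ (hbd.1 k)) (fun j => hb' _ (hbd.2 j)) i
      exact ⟨c, hc, s₀, fun s hs => hcl _ ⟨s, hs, rfl⟩⟩
  · obtain ⟨g, h, hgi, hgd, ⟨u, w, huw⟩, hgh, hcop⟩ := exists_irreducible_dvd_sub_X f hd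
    have hcop' := hcop
    obtain ⟨α, β, hαβ⟩ := hcop
    let ok : K[X] → Set F.ι := fun p => {i | ¬ ∀ k, F.fin i (p.coeff k) ≤ 1}
    have hok : ∀ p, (ok p).Finite := F.finite_coeff_gt_one
    set G : Set F.ι := G₀ ∪ (ok (derivative f) ∪ (ok g ∪ (ok h ∪ (ok u ∪ (ok w ∪ (ok α ∪ ok β))))))
      with hG
    have hGf : G.Finite := hG₀f.union ((hok _).union ((hok _).union ((hok _).union ((hok _).union
      ((hok _).union ((hok _).union (hok _)))))))
    have hGi : ∀ i ∉ G, (F.fin i a ≤ 1 ∧ ∀ k, F.fin i (f.coeff k) ≤ 1) ∧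
        (∀ k, F.fin i ((derivative f).coeff k) ≤ 1) ∧ (∀ k, F.fin i (g.coeff k) ≤ 1) ∧
        (∀ k, F.fin i (h.coeff k) ≤ 1) ∧ (∀ k, F.fin i (u.coeff k) ≤ 1) ∧
        (∀ k, F.fin i (w.coeff k) ≤ 1) ∧ (∀ k, F.fin i (α.coeff k) ≤ 1) ∧
        (∀ k, F.fin i (β.coeff k) ≤ 1) := fun i hi => by
      simp only [hG, Set.mem_union, not_or, Set.mem_ofPred_eq, not_not, ok] at hi
      exact ⟨hG₀i i hi.1, hi.2⟩
    have hg0 : ∀ s, g.eval (y s) ≠ 0 := fun s hs => by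
      obtain ⟨q, hq⟩ := hgd
      have h1 := congrArg (eval (y s)) hq
      rw [eval_mul, hs, zero_mul, eval_sub, eval_X, sub_eq_zero, ← hsucc] at h1
      have := hinj h1
      omega
    have hgs : ∀ s, g.eval (y (s + 1)) = g.eval (y s) * h.eval (y s) := fun s => by
      rw [hsucc, ← eval_comp, hgh, eval_mul]
    set T : Set F.ι := {i | i ∉ G ∧ ∃ s, F.fin i (g.eval (y s)) < 1} with hT
    have hTs : ∀ i ∈ T, ∃ s₀, F.fin i (g.eval (y s₀)) < 1 ∧
        ∀ s ≥ s₀, F.fin i (g.eval (y s)) = F.fin i (g.eval (y s₀)) := by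
      rintro i ⟨hi, s₀, hs₀⟩
      obtain ⟨⟨hia, hif⟩, -, hig, hih, -, -, hiα, hiβ⟩ := hGi i hi
      refine ⟨s₀, hs₀, fun s hs => ?_⟩
      induction s, hs using Nat.le_induction with
      | base => rfl
      | succ s hs ih =>
        rw [hgs, map_mul, ih, abv_eval_eq_one_of_bezout (F.fin i) (F.nonarch i) hαβ hiα hiβ hih
          (hyint i hia hif s) (ih ▸ hs₀), mul_one]
    refine ⟨T, fun hTf => ?_, fun i hi => ?_, fun b hb => ?_⟩
    · set B : Finset F.ι := (hGf.union hTf).toFinset with hB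
      have hB1 : ∀ i ∉ B, ∀ s, F.fin i (g.eval (y s)) = 1 := fun i hi s => by
        simp only [hB, Set.Finite.mem_toFinset, Set.mem_union, not_or] at hi
        obtain ⟨hiG, hiT⟩ := hi
        obtain ⟨⟨hia, hif⟩, -, hig, -⟩ := hGi i hiG
        refine le_antisymm (eval_mem_subring (absInt (F.fin i) (F.nonarch i)) hig
          (hyint i hia hif s)) ?_
        by_contra hlt
        exact hiT ⟨hiG, s, not_le.1 hlt⟩
      have hsum : ∀ s, ∑ x : B ⊕ F.J, ((Sum.elim (fun _ => 1) F.wt x : ℕ) : ℝ) *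
          Real.log ((Sum.elim (fun i : B => F.fin i) F.inf x) (g.eval (f.eval^[s] a))) = 0 := by
        intro s
        rw [Fintype.sum_sum_type]
        have := F.sum_log _ (hg0 s) B fun i hi => hB1 i hi s
        rw [← Finset.sum_coe_sort] at this
        simpa using this
      have hwt : ∀ x : B ⊕ F.J, 1 ≤ (Sum.elim (fun _ => 1) F.wt x : ℕ) := by
        rintro (x | x)
        · exact le_rfl
        · exact F.wt_pos x
      have key := fun w₀ => false_of_sum_log_eq_zero (Sum.elim (fun i : B => F.fin i) F.inf)
        (Sum.elim (fun _ => 1) F.wt) hwt f g h hd hgi.natDegree_pos hgh hcop' a hg0 hsum w₀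
      apply hbd
      constructor
      · intro i
        by_cases hi : i ∈ B
        · by_contra! hcon
          exact key (Sum.inl ⟨i, hi⟩) fun R => (hcon R).imp fun s hs => hs.le
        · simp only [hB, Set.Finite.mem_toFinset, Set.mem_union, not_or] at hi
          obtain ⟨⟨hia, hif⟩, -⟩ := hGi i hi.1
          exact ⟨1, hyint i hia hif⟩
      · intro j
        by_contra! hcon
        exact key (Sum.inr j) fun R => (hcon R).imp fun s hs => hs.le
    · obtain ⟨s₀, hs₀, hs⟩ := hTs i hi
      obtain ⟨⟨hia, hif⟩, hif', hig, hih, hiu, hiw, -⟩ := hGi i hi.1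
      exact ⟨s₀, fun s h => abv_eval_eq_one_of_bezout (F.fin i) (F.nonarch i) huw hiu hiw hif'
        (hyint i hia hif s) (hs s h ▸ hs₀)⟩
    · obtain ⟨μ, b', hb', rfl⟩ := WfDvdMonoid.max_power_factor hb hgi
      obtain ⟨U, W, hUW⟩ := (hgi.coprime_iff_not_dvd.2 hb')
      refine ((hok b').union ((hok U).union (hok W))).subset ?_
      rintro i ⟨hi, hn⟩
      by_contra hcon
      simp only [Set.mem_union, not_or, Set.mem_ofPred_eq, not_not, ok] at hcon
      obtain ⟨hib, hiU, hiW⟩ := hcon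
      apply hn
      obtain ⟨s₀, hs₀, hs⟩ := hTs i hi
      obtain ⟨⟨hia, hif⟩, -⟩ := hGi i hi.1
      refine ⟨F.fin i (g.eval (y s₀)) ^ μ, pow_pos ((F.fin i).pos (hg0 _)) _, s₀, fun s h => ?_⟩
      rw [eval_mul, eval_pow, map_mul, map_pow, hs s h, abv_eval_eq_one_of_bezout (F.fin i)
        (F.nonarch i) hUW hiU hiW hib (hyint i hia hif s) (hs s h ▸ hs₀), mul_one]

end ProductFormula

section GaussNormLeading

lemma Polynomial.abv_coeff_le_of_mul {R : Type} [CommRing R] [IsDomain R]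
    (v : AbsoluteValue R ℝ) (hv : IsNonarchimedean v) {c : ℝ} (hc : 0 < c) {p q : R[X]}
    (hpq : p * q ≠ 0)
    (h : ∀ i, v ((p * q).coeff i) * c ^ i ≤ v (p * q).leadingCoeff * c ^ (p * q).natDegree) (i : ℕ) :
    v (p.coeff i) * c ^ i ≤ v p.leadingCoeff * c ^ p.natDegree := by
  obtain ⟨hp, hq⟩ := ne_zero_and_ne_zero_of_mul hpq
  rw [leadingCoeff_mul, natDegree_mul hp hq, map_mul, pow_add] at h
  obtain ⟨k, hk⟩ := (p * q).exists_eq_gaussNorm v c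
  have h1 := h k
  rw [← hk, gaussNorm_mul hv hc] at h1
  have h2 := p.le_gaussNorm v hc.le i
  have h3 := q.le_gaussNorm v hc.le q.natDegree
  have h4 : 0 < v (q.coeff q.natDegree) * c ^ q.natDegree :=
    mul_pos (v.pos (leadingCoeff_ne_zero.2 hq)) (pow_pos hc _)
  have h5 : 0 ≤ p.gaussNorm v c := p.gaussNorm_nonneg v hc.le
  refine h2.trans ?_
  have h6 : p.gaussNorm v c * (v (q.coeff q.natDegree) * c ^ q.natDegree) ≤
      v p.leadingCoeff * c ^ p.natDegree * (v (q.coeff q.natDegree) * c ^ q.natDegree) := by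
    refine (mul_le_mul_of_nonneg_left h3 h5).trans (h1.trans (le_of_eq ?_))
    rw [leadingCoeff, leadingCoeff]; ring
  exact le_of_mul_le_mul_right h6 h4

variable {R : Type} [CommRing R] [IsDomain R] [WfDvdMonoid R]

/-- The absolute value `x ↦ (1/2)^(N * ord_r x)` attached to a prime element `r`. -/
noncomputable def Prime.powAbv {r : R} (hr : Prime r) (N : ℕ) (_hN : 1 ≤ N) :
    AbsoluteValue R ℝ where
  toFun x := open Classical in if x = 0 then 0 else (1 / 2) ^ (N * multiplicity r x)
  map_mul' x y := by
    by_cases hx : x = 0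
    · simp [hx]
    by_cases hy : y = 0
    · simp [hy]
    simp only [hx, hy, mul_eq_zero, or_self, if_false]
    rw [multiplicity_mul hr (FiniteMultiplicity.of_prime_left hr (mul_ne_zero hx hy)), mul_add,
      pow_add]
  nonneg' x := by split_ifs <;> positivity
  eq_zero' x := by
    split_ifs with h
    · simp [h]
    · simp only [h, iff_false]; positivity
  add_le' x y := by
    by_cases hx : x = 0
    · subst hx; rw [zero_add, if_pos rfl, zero_add]
    by_cases hy : y = 0
    · subst hy; rw [add_zero, if_pos (rfl : (0 : R) = 0), add_zero]
    simp only [hx, hy, if_false]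
    split_ifs with hxy
    · positivity
    have hm : min (multiplicity r x) (multiplicity r y) ≤ multiplicity r (x + y) :=
      (FiniteMultiplicity.of_prime_left hr hxy).le_multiplicity_of_pow_dvd (dvd_add
        ((pow_dvd_pow _ (min_le_left _ _)).trans (pow_multiplicity_dvd _ _))
        ((pow_dvd_pow _ (min_le_right _ _)).trans (pow_multiplicity_dvd _ _)))
    have h2 : ∀ a b : ℕ, a ≤ b → ((1 : ℝ) / 2) ^ (N * b) ≤ (1 / 2) ^ (N * a) := fun a b h =>
      pow_le_pow_of_le_one (by norm_num) (by norm_num) (Nat.mul_le_mul_left _ h)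
    have hx0 : 0 ≤ ((1 : ℝ) / 2) ^ (N * multiplicity r x) := by positivity
    have hy0 : 0 ≤ ((1 : ℝ) / 2) ^ (N * multiplicity r y) := by positivity
    rcases min_le_iff.1 hm with h | h
    · linarith [h2 _ _ h]
    · linarith [h2 _ _ h]

lemma Prime.powAbv_apply {r : R} (hr : Prime r) (N : ℕ) (hN : 1 ≤ N) {x : R} (hx : x ≠ 0) :
    hr.powAbv N hN x = (1 / 2) ^ (N * multiplicity r x) := if_neg hx

lemma Prime.powAbv_le_one {r : R} (hr : Prime r) (N : ℕ) (hN : 1 ≤ N) (x : R) :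
    hr.powAbv N hN x ≤ 1 := by
  by_cases hx : x = 0
  · simp [hx]
  · rw [hr.powAbv_apply N hN hx]
    exact pow_le_one₀ (by norm_num) (by norm_num)

lemma Prime.isNonarchimedean_powAbv {r : R} (hr : Prime r) (N : ℕ) (hN : 1 ≤ N) :
    IsNonarchimedean (hr.powAbv N hN) := by
  intro x y
  by_cases hx : x = 0
  · simp [hx]
  by_cases hy : y = 0
  · simp [hy]
  by_cases hxy : x + y = 0
  · simp [hxy]
  rw [hr.powAbv_apply N hN hx, hr.powAbv_apply N hN hy, hr.powAbv_apply N hN hxy]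
  have hm : min (multiplicity r x) (multiplicity r y) ≤ multiplicity r (x + y) :=
    (FiniteMultiplicity.of_prime_left hr hxy).le_multiplicity_of_pow_dvd (dvd_add
      ((pow_dvd_pow _ (min_le_left _ _)).trans (pow_multiplicity_dvd _ _))
      ((pow_dvd_pow _ (min_le_right _ _)).trans (pow_multiplicity_dvd _ _)))
  have h2 : ∀ a b : ℕ, a ≤ b → ((1 : ℝ) / 2) ^ (N * b) ≤ (1 / 2) ^ (N * a) := fun a b h =>
    pow_le_pow_of_le_one (by norm_num) (by norm_num) (Nat.mul_le_mul_left _ h)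
  rcases min_le_iff.1 hm with h | h
  · exact le_max_of_le_left (h2 _ _ h)
  · exact le_max_of_le_right (h2 _ _ h)

lemma Prime.dvd_of_powAbv_lt_one {r : R} (hr : Prime r) (N : ℕ) (hN : 1 ≤ N) {x : R}
    (h : hr.powAbv N hN x < 1) : r ∣ x := by
  by_cases hx : x = 0
  · simp [hx]
  rw [hr.powAbv_apply N hN hx] at h
  by_contra hcon
  rw [multiplicity_eq_zero.2 hcon] at h
  norm_num at h

lemma Prime.dvd_coeff_of_dvd_map_comp {r : R} (hr : Prime r) (σ : R →+* R)
    {g : R[X]} (hg : IsUnit g.leadingCoeff) (hN : 1 ≤ g.natDegree) {E : R[X]}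
    (h0 : σ E.leadingCoeff ≠ 0) (hrl : r ∣ E.leadingCoeff)
    (he : multiplicity r (σ E.leadingCoeff) * E.natDegree < g.natDegree)
    (hdvd : E ∣ (E.map σ).comp g) (i : ℕ) : r ∣ E.coeff i := by
  set N := g.natDegree with hNdef
  set D := E.natDegree with hD
  set ℓ := E.leadingCoeff with hℓ
  set e := multiplicity r (σ ℓ) with he'
  set Z := (E.map σ).comp g with hZ
  set v := hr.powAbv N hN with hv
  have hdegm : (E.map σ).natDegree = D := natDegree_map_of_leadingCoeff_ne_zero _ h0
  have hlcm : (E.map σ).leadingCoeff = σ ℓ := leadingCoeff_map_of_leadingCoeff_ne_zero _ h0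
  have hZd : Z.natDegree = D * N := by rw [hZ, natDegree_comp, hdegm]
  have hZl : Z.leadingCoeff = σ ℓ * g.leadingCoeff ^ D := by
    rw [hZ, leadingCoeff_comp (by omega), hlcm, hdegm]
  have hZ0 : Z ≠ 0 := by
    rw [← leadingCoeff_ne_zero, hZl]
    exact mul_ne_zero h0 (pow_ne_zero _ hg.ne_zero)
  have hvu : ∀ u, IsUnit u → v u = 1 := by
    rintro _ ⟨u, rfl⟩
    have h1 := hr.powAbv_le_one N hN (u : R)
    have h2 := hr.powAbv_le_one N hN ((u⁻¹ : Rˣ) : R)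
    have h3 : v (u : R) * v ((u⁻¹ : Rˣ) : R) = 1 := by rw [← map_mul]; simp
    nlinarith [v.nonneg (u : R), v.nonneg ((u⁻¹ : Rˣ) : R)]
  have hvσ : v (σ ℓ) = (1 / 2) ^ (N * e) := hr.powAbv_apply N hN h0
  have hvZ : v Z.leadingCoeff = (1 / 2) ^ (N * e) := by
    rw [hZl, map_mul, map_pow, hvu _ hg, one_pow, mul_one, hvσ]
  obtain ⟨H, hH⟩ := hdvd
  have hhalf : ∀ k : ℕ, ((1 : ℝ) / 2) ^ k * 2 ^ k = 1 := fun k => by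
    rw [← mul_pow]; norm_num
  have hl0 : ℓ ≠ 0 := fun h => h0 (by rw [h, map_zero])
  have key : ∀ i, v (Z.coeff i) * ((2 : ℝ) ^ e) ^ i ≤
      v Z.leadingCoeff * ((2 : ℝ) ^ e) ^ Z.natDegree := by
    intro i
    rw [hvZ, hZd]
    rcases lt_or_ge (D * N) i with hi | hi
    · rw [coeff_eq_zero_of_natDegree_lt (hZd ▸ hi), map_zero, zero_mul]; positivity
    by_cases hi2 : i + N ≤ D * N
    · have h1 : v (Z.coeff i) ≤ 1 := hr.powAbv_le_one N hN _
      obtain ⟨k, hk⟩ := Nat.exists_eq_add_of_le hi2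
      rw [hk]
      have : ((1 : ℝ) / 2) ^ (N * e) * ((2 : ℝ) ^ e) ^ (i + N + k) =
          ((2 : ℝ) ^ e) ^ i * ((2 : ℝ) ^ e) ^ k := by
        rw [pow_add, pow_add, ← pow_mul _ e N, mul_comm e N]
        linear_combination ((2 : ℝ) ^ e) ^ i * ((2 : ℝ) ^ e) ^ k * hhalf (N * e)
      rw [this, mul_comm]
      have h2 : (1 : ℝ) ≤ ((2 : ℝ) ^ e) ^ k := one_le_pow₀ (one_le_pow₀ (by norm_num))
      have h3 : (0 : ℝ) < ((2 : ℝ) ^ e) ^ i := by positivity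
      nlinarith
    · have hdv : ∃ x, Z.coeff i = σ ℓ * x := by
        refine ⟨(g ^ D).coeff i, ?_⟩
        rw [hZ, comp, eval₂_eq_sum_range, hdegm, Finset.sum_range_succ, coeff_add, finsetSum_coeff,
          Finset.sum_eq_zero, zero_add, coeff_C_mul]
        · rw [← hlcm, leadingCoeff, hdegm]
        · intro j hj
          rw [coeff_C_mul, coeff_eq_zero_of_natDegree_lt (p := g ^ j), mul_zero]
          refine natDegree_pow_le.trans_lt ?_
          rw [← hNdef]
          have : j + 1 ≤ D := by simpa using hj
          have := Nat.mul_le_mul_right N this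
          rw [add_mul, one_mul] at this
          omega
      obtain ⟨x, hx⟩ := hdv
      rw [hx, map_mul, hvσ]
      have h1 : v x ≤ 1 := hr.powAbv_le_one N hN _
      have h2 : ((2 : ℝ) ^ e) ^ i ≤ ((2 : ℝ) ^ e) ^ (D * N) :=
        pow_le_pow_right₀ (one_le_pow₀ (by norm_num)) hi
      refine mul_le_mul (mul_le_of_le_one_right (by positivity) h1) h2 (by positivity) (by positivity)
  rw [hH] at key hZ0
  have hres := abv_coeff_le_of_mul v (hr.isNonarchimedean_powAbv N hN) (by positivity) hZ0 key i
  apply hr.dvd_of_powAbv_lt_one N hN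
  have hvl : v ℓ ≤ (1 / 2) ^ N := by
    rw [hv, hr.powAbv_apply N hN hl0]
    refine pow_le_pow_of_le_one (by norm_num) (by norm_num) ?_
    have : 1 ≤ multiplicity r ℓ :=
      (FiniteMultiplicity.of_prime_left hr hl0).le_multiplicity_of_pow_dvd (by simpa using hrl)
    nlinarith
  have h1 : (1 : ℝ) ≤ ((2 : ℝ) ^ e) ^ i := one_le_pow₀ (one_le_pow₀ (by norm_num))
  have h2 : v (E.coeff i) ≤ v (E.coeff i) * ((2 : ℝ) ^ e) ^ i :=
    le_mul_of_one_le_right (v.nonneg _) h1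
  refine (h2.trans hres).trans_lt ?_
  have h3 : v ℓ * ((2 : ℝ) ^ e) ^ D ≤ (1 / 2) ^ N * ((2 : ℝ) ^ e) ^ D := by gcongr
  refine h3.trans_lt ?_
  rw [← pow_mul]
  have h4 : (2 : ℝ) ^ (e * D) < 2 ^ N := pow_lt_pow_right₀ (by norm_num) he
  have h5 : (0 : ℝ) < (1 / 2) ^ N := by positivity
  nlinarith [hhalf N]

end GaussNormLeading

section Ramification
variable {L : Type} [Field L]

lemma Polynomial.rootMultiplicity_comp_le {p g : L[X]} (hp : p ≠ 0) (hg : g.natDegree ≠ 0) (c : L) :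
    (p.comp g).rootMultiplicity c ≤
      p.rootMultiplicity (g.eval c) * (g - C (g.eval c)).rootMultiplicity c := by
  obtain ⟨q, hq, hnd⟩ := exists_eq_pow_rootMultiplicity_mul_and_not_dvd p hp (g.eval c)
  set k := p.rootMultiplicity (g.eval c)
  have hg' : g - C (g.eval c) ≠ 0 := by
    intro h
    rw [sub_eq_zero] at h
    rw [h, natDegree_C] at hg
    exact hg rfl
  have hqc : ¬ (q.comp g).IsRoot c := by
    rw [IsRoot, eval_comp]
    rwa [dvd_iff_isRoot] at hnd
  have hq0 : q.comp g ≠ 0 := by rintro h; rw [h] at hqc; simp at hqc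
  have h1 : p.comp g = (g - C (g.eval c)) ^ k * q.comp g := by
    conv_lhs => rw [hq]
    simp [mul_comp]
  rw [h1, rootMultiplicity_mul (mul_ne_zero (pow_ne_zero _ hg') hq0),
    rootMultiplicity_eq_zero hqc, add_zero]
  classical
  rw [← count_roots, ← count_roots, roots_pow, Multiset.count_nsmul]

lemma exists_eq_of_natDegree_le_rootMultiplicity {f : L[X]} {y z : L}
    (h : f.natDegree ≤ (f - C z).rootMultiplicity y) (hd : f.natDegree ≠ 0) :
    ∃ a, f = C a * (X - C y) ^ f.natDegree + C z := by
  have hdeg : (f - C z).natDegree = f.natDegree := natDegree_sub_C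
  have h0 : f - C z ≠ 0 := by intro h; rw [h, natDegree_zero] at hdeg; exact hd hdeg.symm
  obtain ⟨q, hq⟩ := (pow_dvd_pow (X - C y) h).trans (pow_rootMultiplicity_dvd (f - C z) y)
  have hq0 : q ≠ 0 := by rintro rfl; exact h0 (by rw [hq, mul_zero])
  have h1 := congrArg natDegree hq
  rw [hdeg, natDegree_mul (pow_ne_zero _ (X_sub_C_ne_zero y)) hq0, natDegree_pow, natDegree_X_sub_C,
    mul_one] at h1
  obtain ⟨a, rfl⟩ := natDegree_eq_zero.1 (by omega : q.natDegree = 0)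
  exact ⟨a, by rw [mul_comm, ← hq]; ring⟩

lemma not_exists_eq_of_not_isSpecialPolyAux [IsAlgClosed L] {f : L[X]} (hd : 2 ≤ f.natDegree)
    (hf : ¬ IsSpecialPolyAux f) : ¬ ∃ a c, f = C a * (X - C c) ^ f.natDegree + C c := by
  rintro ⟨a, c, h⟩
  have ha : a ≠ 0 := by
    rintro rfl
    rw [C_0, zero_mul, zero_add] at h
    rw [h, natDegree_C] at hd
    omega
  obtain ⟨z, hz⟩ := IsAlgClosed.exists_pow_nat_eq (a⁻¹) (show 0 < f.natDegree - 1 by omega)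
  have hz0 : z ≠ 0 := by
    rintro rfl
    rw [zero_pow (by omega)] at hz
    exact inv_ne_zero ha hz.symm
  refine hf ⟨z, c, hz0, X ^ f.natDegree, Or.inl rfl, ?_⟩
  have h1 : z ^ f.natDegree = z * a⁻¹ := by
    rw [← hz, ← pow_succ']; congr 1; omega
  conv_rhs => rw [h]
  simp only [pow_comp, X_comp, add_comp, mul_comp, C_comp, sub_comp, add_sub_cancel_right]
  have h2 : (C z * X : L[X]) ^ f.natDegree = C (z * a⁻¹) * X ^ f.natDegree := by
    rw [mul_pow, ← C_pow, h1]
  rw [h2, ← mul_assoc, ← C_mul, mul_comm z, ← mul_assoc, mul_inv_cancel₀ ha, one_mul]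

variable [CharZero L]

lemma rootMultiplicity_mul_rootMultiplicity_le {f : L[X]} (hd : 2 ≤ f.natDegree)
    (hf : ¬ ∃ a c, f = C a * (X - C c) ^ f.natDegree + C c) (y : L) :
    (f - C (f.eval y)).rootMultiplicity y *
      (f - C (f.eval (f.eval y))).rootMultiplicity (f.eval y) ≤
    f.natDegree * (f.natDegree - 1) := by
  have hle : ∀ y z, (f - C z).rootMultiplicity y ≤ f.natDegree := fun y z => by
    have h0 : f - C z ≠ 0 := by
      intro h
      have := congrArg natDegree h
      rw [natDegree_sub_C, natDegree_zero] at this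
      omega
    have := Polynomial.natDegree_le_of_dvd (pow_rootMultiplicity_dvd (f - C z) y) h0
    rwa [natDegree_sub_C, natDegree_pow, natDegree_X_sub_C, mul_one] at this
  rcases (hle y (f.eval y)).lt_or_eq with h | h
  · rw [mul_comm f.natDegree]
    exact Nat.mul_le_mul (by omega) (hle _ _)
  · refine Nat.mul_le_mul (hle _ _) ?_
    by_contra hcon
    obtain ⟨a, ha⟩ := exists_eq_of_natDegree_le_rootMultiplicity h.ge (by omega)
    obtain ⟨b, hb⟩ := exists_eq_of_natDegree_le_rootMultiplicity
      (show f.natDegree ≤ (f - C (f.eval (f.eval y))).rootMultiplicity (f.eval y) by omega)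
      (by omega)
    have hb0 : b ≠ 0 := by
      rintro rfl
      rw [C_0, zero_mul, zero_add] at hb
      rw [hb, natDegree_C] at hd
      omega
    obtain ⟨m, hm⟩ := Nat.exists_eq_add_of_le hd
    have hder : ∀ a y z x : L, (derivative (C a * (X - C y) ^ f.natDegree + C z)).eval x =
        a * (f.natDegree * (x - y) ^ (f.natDegree - 1)) := by
      intro a y z x
      simp [derivative_pow]
    have h1 := hder a y (f.eval y) y
    have h1' := hder b (f.eval y) (f.eval (f.eval y)) y
    rw [← hb] at h1'
    rw [← ha, h1', sub_self, zero_pow (by omega), mul_zero, mul_zero] at h1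
    have hd0 : (f.natDegree : L) ≠ 0 := by norm_cast; omega
    have h2 : y = f.eval y := by
      have h3 := (mul_eq_zero.1 ((mul_eq_zero.1 h1).resolve_left hb0)).resolve_left hd0
      exact sub_eq_zero.1 (pow_eq_zero_iff (by omega) |>.1 h3)
    rw [← h2] at ha
    exact hf ⟨a, y, ha⟩

lemma rootMultiplicity_iterate_sub_le {f : L[X]} (hd : 2 ≤ f.natDegree)
    (hf : ¬ ∃ a c, f = C a * (X - C c) ^ f.natDegree + C c) (k : ℕ) (c : L) :
    ((f.comp^[2 * k] X) - C ((f.comp^[2 * k] X).eval c)).rootMultiplicity c ≤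
      (f.natDegree * (f.natDegree - 1)) ^ k := by
  have hdeg : ∀ t, (f.comp^[t] X).natDegree = f.natDegree ^ t := fun t => by
    rw [natDegree_iterate_comp, natDegree_X, mul_one]
  have hdeg0 : ∀ t, (f.comp^[t] X).natDegree ≠ 0 := fun t => by
    rw [hdeg]; exact pow_ne_zero _ (by omega)
  have hstep : ∀ t, ((f.comp^[t + 1] X) - C ((f.comp^[t + 1] X).eval c)).rootMultiplicity c ≤
      (f - C (f.eval ((f.comp^[t] X).eval c))).rootMultiplicity ((f.comp^[t] X).eval c) *
      ((f.comp^[t] X) - C ((f.comp^[t] X).eval c)).rootMultiplicity c := fun t => by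
    have h0 : f - C (f.eval ((f.comp^[t] X).eval c)) ≠ 0 := by
      intro h
      have := congrArg natDegree h
      rw [natDegree_sub_C, natDegree_zero] at this
      omega
    have := rootMultiplicity_comp_le h0 (hdeg0 t) c
    rw [sub_comp, C_comp] at this
    simpa only [Function.iterate_succ_apply', eval_comp] using this
  induction k with
  | zero => simpa using (rootMultiplicity_X_sub_C_self (x := c)).le
  | succ k ih =>
    have h1 := hstep (2 * k)
    have h2 := hstep (2 * k + 1)
    rw [show 2 * (k + 1) = 2 * k + 1 + 1 by ring, pow_succ]
    refine h2.trans ((Nat.mul_le_mul_left _ h1).trans ?_)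
    rw [← mul_assoc, mul_comm]
    refine Nat.mul_le_mul ih ?_
    rw [mul_comm, Function.iterate_succ_apply' f.comp, eval_comp]
    exact rootMultiplicity_mul_rootMultiplicity_le hd hf _

lemma exists_mul_rootMultiplicity_iterate_lt {f : L[X]} (hd : 2 ≤ f.natDegree)
    (hf : ¬ ∃ a c, f = C a * (X - C c) ^ f.natDegree + C c) (B : ℕ) :
    ∃ k₀, ∀ k ≥ k₀, ∀ c θ : L,
      B * ((f.comp^[2 * k] X) - C θ).rootMultiplicity c < f.natDegree ^ (2 * k) := by
  set d := f.natDegree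
  have hd0 : (0 : ℝ) < d := by have : 0 < d := by omega
                               exact_mod_cast this
  have hr : ((d : ℝ) - 1) / d < 1 := by rw [div_lt_one hd0]; linarith
  have hr0 : 0 ≤ ((d : ℝ) - 1) / d := by
    have : (2 : ℝ) ≤ d := by exact_mod_cast hd
    apply div_nonneg <;> linarith
  obtain ⟨k₀, hk₀⟩ := exists_pow_lt_of_lt_one (show (0 : ℝ) < 1 / (B + 1) by positivity) hr
  refine ⟨k₀, fun k hk c θ => ?_⟩
  by_cases hθ : θ = (f.comp^[2 * k] X).eval c
  · subst hθ
    refine (Nat.mul_le_mul_left B (rootMultiplicity_iterate_sub_le hd hf k c)).trans_lt ?_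
    have h1 : (((d : ℝ) - 1) / d) ^ k < 1 / (B + 1) :=
      (pow_le_pow_of_le_one hr0 hr.le hk).trans_lt hk₀
    have h2 : (B : ℝ) * (d * ((d : ℝ) - 1)) ^ k < d ^ (2 * k) := by
      rw [div_pow, div_lt_div_iff₀ (by positivity) (by positivity)] at h1
      have h3 : (0 : ℝ) ≤ ((d : ℝ) - 1) ^ k := by
        apply pow_nonneg
        have : (2 : ℝ) ≤ d := by exact_mod_cast hd
        linarith
      have h4 : (0 : ℝ) < (d : ℝ) ^ k := by positivity
      rw [mul_pow, two_mul, pow_add]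
      nlinarith
    rw [← Nat.cast_lt (α := ℝ)]
    push_cast [Nat.cast_sub (show 1 ≤ f.natDegree by omega)]
    exact h2
  · rw [rootMultiplicity_eq_zero, mul_zero]
    · positivity
    · rw [IsRoot, eval_sub, eval_C, sub_eq_zero]
      exact fun h => hθ h.symm

end Ramification

section DiagPull

variable {K : Type} [Field K] {ι : Type}

/-- Pullback of polynomial functions along the diagonal map `x ↦ (g (x i))ᵢ`. -/
noncomputable def diagPull (ι : Type) (g : K[X]) : MvPolynomial ι K →ₐ[K] MvPolynomial ι K :=
  MvPolynomial.aeval fun i => Polynomial.aeval (MvPolynomial.X i) g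

lemma aeval_diagPull {L : Type} [CommRing L] [Algebra K L] (x : ι → L) (g : K[X])
    (p : MvPolynomial ι K) :
    MvPolynomial.aeval x (diagPull ι g p) =
      MvPolynomial.aeval (fun i => Polynomial.aeval (x i) g) p := by
  rw [diagPull, ← AlgHom.comp_apply, MvPolynomial.comp_aeval]
  congr 2
  funext i
  rw [← Polynomial.aeval_algHom_apply, MvPolynomial.aeval_X]

lemma eval_diagPull (x : ι → K) (g : K[X]) (p : MvPolynomial ι K) :
    MvPolynomial.eval x (diagPull ι g p) = MvPolynomial.eval (fun i => g.eval (x i)) p := by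
  simpa [MvPolynomial.aeval_eq_eval] using aeval_diagPull x g p

lemma diagPull_comp (g h : K[X]) (p : MvPolynomial ι K) :
    diagPull ι (g.comp h) p = diagPull ι h (diagPull ι g p) := by
  rw [← AlgHom.comp_apply]
  congr 1
  ext i
  simp [diagPull, Polynomial.aeval_comp, ← Polynomial.aeval_algHom_apply]

lemma diagPull_X (p : MvPolynomial ι K) : diagPull ι (X : K[X]) p = p := by
  simp [diagPull]

lemma MvPolynomial.eq_zero_of_forall_aeval_eq_zero [Infinite K] {L : Type} [Field L] [Algebra K L]
    {p : MvPolynomial ι K} (h : ∀ x : ι → L, MvPolynomial.aeval x p = 0) : p = 0 := by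
  have : Infinite L := Infinite.of_injective _ (algebraMap K L).injective
  apply MvPolynomial.map_injective (algebraMap K L) (algebraMap K L).injective
  rw [map_zero]
  apply MvPolynomial.funext
  intro x
  rw [MvPolynomial.eval_map, map_zero]
  exact h x

lemma Polynomial.exists_aeval_eq {L : Type} [Field L] [IsAlgClosed L] [Algebra K L] {g : K[X]}
    (hg : 1 ≤ g.natDegree) (y : L) : ∃ x : L, Polynomial.aeval x g = y := by
  have hd : (g.map (algebraMap K L) - C y).natDegree = g.natDegree := by
    rw [natDegree_sub_C, natDegree_map]
  obtain ⟨x, hx⟩ := IsAlgClosed.exists_root (g.map (algebraMap K L) - C y) (by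
    intro h
    have := natDegree_eq_of_degree_eq_some (n := 0) h
    omega)
  refine ⟨x, ?_⟩
  rw [IsRoot, eval_sub, eval_C, sub_eq_zero, eval_map_algebraMap] at hx
  exact hx

lemma diagPull_injective [Infinite K] {g : K[X]} (hg : 1 ≤ g.natDegree) :
    Function.Injective (diagPull ι g) := by
  rw [injective_iff_map_eq_zero]
  intro p hp
  apply MvPolynomial.eq_zero_of_forall_aeval_eq_zero (L := AlgebraicClosure K)
  intro y
  choose x hx using fun i => Polynomial.exists_aeval_eq hg (y i)
  have := aeval_diagPull x g p
  rw [hp, map_zero, funext hx] at this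
  exact this.symm

lemma MvPolynomial.exists_eval_ne_zero [Infinite K] {p : MvPolynomial ι K} (hp : p ≠ 0) :
    ∃ b, MvPolynomial.eval b p ≠ 0 := by
  by_contra! h
  exact hp (MvPolynomial.funext fun x => by rw [h, map_zero])

variable [DecidableEq ι]

/-- Restriction of a polynomial to the line through `b` parallel to the `i`-th axis. -/
noncomputable def slice (i : ι) (b : ι → K) : MvPolynomial ι K →ₐ[K] K[X] :=
  MvPolynomial.aeval (Function.update (fun j => C (b j)) i X)

lemma eval_slice (i : ι) (b : ι → K) (y : K) (p : MvPolynomial ι K) :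
    (slice i b p).eval y = MvPolynomial.eval (Function.update b i y) p := by
  rw [slice, ← Polynomial.coe_evalRingHom, MvPolynomial.aeval_def, MvPolynomial.hom_eval₂,
    MvPolynomial.eval, MvPolynomial.coe_eval₂Hom]
  congr 1
  · ext; simp
  · funext j
    rcases eq_or_ne j i with rfl | hj <;> simp [*]

lemma slice_diagPull (i : ι) (b : ι → K) (g : K[X]) (p : MvPolynomial ι K) :
    slice i b (diagPull ι g p) = (slice i (fun j => g.eval (b j)) p).comp g := by
  have : (slice i b).comp (diagPull ι g) =
      (Polynomial.aeval (R := K) g).comp (slice i fun j => g.eval (b j)) := by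
    ext j
    rcases eq_or_ne j i with rfl | hj
    · simp [slice, diagPull, ← Polynomial.aeval_algHom_apply]
    · simp [slice, diagPull, ← Polynomial.aeval_algHom_apply, hj]
      rw [← Polynomial.algebraMap_eq, Polynomial.aeval_algebraMap_apply]
      simp
  exact DFunLike.congr_fun this p

lemma natDegree_slice_le (i : ι) (b : ι → K) (p : MvPolynomial ι K) :
    (slice i b p).natDegree ≤ p.totalDegree := by
  have := MvPolynomial.aeval_natDegree_le p (n := 1) (le_refl p.totalDegree)
    (Function.update (fun j => C (b j)) i X) (fun j => by
      rcases eq_or_ne j i with rfl | hj <;> simp [*])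
  simpa [slice] using this

lemma derivative_slice (i : ι) (b : ι → K) (p : MvPolynomial ι K) :
    derivative (slice i b p) = slice i b (MvPolynomial.pderiv i p) := by
  induction p using MvPolynomial.induction_on with
  | C a => simp [slice]
  | add p q hp hq => simp [hp, hq]
  | mul_X p j hp =>
    rcases eq_or_ne j i with rfl | hj
    · simp [hp]
      simp [slice]
      ring
    · simp [hp, MvPolynomial.pderiv_X_of_ne hj]
      simp [slice, hj, mul_comm]

lemma slice_ne_zero {i : ι} {b : ι → K} {p : MvPolynomial ι K} (h : MvPolynomial.eval b p ≠ 0) :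
    slice i b p ≠ 0 := by
  intro h0
  have := eval_slice i b (b i) p
  rw [h0, Function.update_eq_self, eval_zero] at this
  exact h this.symm

lemma le_of_pow_dvd_diagPull [CharZero K] {L : Type} [Field L] [IsAlgClosed L] [Algebra K L]
    {ℓ r : MvPolynomial ι K} (hℓ : ℓ ≠ 0) (i : ι) (hr : MvPolynomial.pderiv i r ≠ 0) {g : K[X]}
    (hg : 1 ≤ g.natDegree) {B : ℕ}
    (hB : ∀ c θ : L, (g.map (algebraMap K L) - C θ).rootMultiplicity c ≤ B) {e : ℕ}
    (hdvd : r ^ e ∣ diagPull ι g ℓ) : e ≤ ℓ.totalDegree * B := by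
  have h0 : diagPull ι g ℓ ≠ 0 := by
    rwa [Ne, map_eq_zero_iff _ (diagPull_injective hg)]
  obtain ⟨b, hb⟩ := MvPolynomial.exists_eval_ne_zero (mul_ne_zero h0 hr)
  rw [map_mul] at hb
  have hb1 := slice_ne_zero (i := i) (left_ne_zero_of_mul hb)
  have hb2 := slice_ne_zero (i := i) (right_ne_zero_of_mul hb)
  rw [← derivative_slice] at hb2
  rw [slice_diagPull] at hb1
  have hdvd' := map_dvd (slice i b) hdvd
  rw [slice_diagPull, map_pow] at hdvd'
  set p := slice i (fun j => g.eval (b j)) ℓ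
  have hnd : (slice i b r).natDegree ≠ 0 := fun h => hb2 (derivative_of_natDegree_zero h)
  obtain ⟨c, hc⟩ := IsAlgClosed.exists_root ((slice i b r).map (algebraMap K L)) (by
    rw [degree_map]
    intro h
    exact hnd (natDegree_eq_of_degree_eq_some h))
  have hp0 : p ≠ 0 := fun h => hb1 (by rw [h, zero_comp])
  have hinj := Polynomial.map_injective (algebraMap K L) (algebraMap K L).injective
  have hpL : p.map (algebraMap K L) ≠ 0 := (Polynomial.map_ne_zero_iff (algebraMap K L).injective).2 hp0
  have h1 : e ≤ ((p.map (algebraMap K L)).comp (g.map (algebraMap K L))).rootMultiplicity c := by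
    rw [← Polynomial.map_comp, le_rootMultiplicity_iff
      ((Polynomial.map_ne_zero_iff (algebraMap K L).injective).2 hb1)]
    have := Polynomial.map_dvd (algebraMap K L) hdvd'
    rw [Polynomial.map_pow] at this
    exact (pow_dvd_pow_of_dvd (dvd_iff_isRoot.2 hc) e).trans this
  have h2 := rootMultiplicity_comp_le hpL (g := g.map (algebraMap K L)) (by
    rw [natDegree_map]; omega) c
  refine h1.trans (h2.trans (Nat.mul_le_mul ?_ (hB _ _)))
  classical
  rw [← count_roots]
  refine (Multiset.count_le_card _ _).trans ((card_roots' _).trans ?_)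
  rw [natDegree_map]
  exact natDegree_slice_le _ _ _

end DiagPull

section Iterate

variable {K : Type} [Field K] {ι : Type}

lemma iterate_comp_X_add (f : K[X]) (a b : ℕ) :
    f.comp^[a + b] X = (f.comp^[a] X).comp (f.comp^[b] X) := by
  induction a with
  | zero => simp
  | succ a ih =>
    rw [show a + 1 + b = (a + b) + 1 by ring, Function.iterate_succ_apply', ih,
      Function.iterate_succ_apply', comp_assoc]

lemma diagPull_iterate_add (f : K[X]) (a b : ℕ) (p : MvPolynomial ι K) :
    diagPull ι (f.comp^[a + b] X) p =
      diagPull ι (f.comp^[b] X) (diagPull ι (f.comp^[a] X) p) := by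
  rw [iterate_comp_X_add, diagPull_comp]

lemma dvd_diagPull_iterate_mul {f : K[X]} {m : ℕ} {E : MvPolynomial ι K}
    (h : E ∣ diagPull ι (f.comp^[m] X) E) (t : ℕ) :
    E ∣ diagPull ι (f.comp^[m * t] X) E := by
  induction t with
  | zero => simp [diagPull_X]
  | succ t ih =>
    rw [mul_add, mul_one, diagPull_iterate_add]
    exact h.trans (map_dvd _ ih)

lemma natDegree_iterate_comp_X {f : K[X]} (k : ℕ) :
    (f.comp^[k] X).natDegree = f.natDegree ^ k := by
  rw [natDegree_iterate_comp, natDegree_X, mul_one]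

lemma map_iterate_comp_X {R L : Type} [CommRing R] [CommRing L] (φ : R →+* L) (f : R[X]) (k : ℕ) :
    (f.comp^[k] X).map φ = (f.map φ).comp^[k] X := by
  induction k with
  | zero => simp
  | succ k ih =>
    rw [Function.iterate_succ_apply', Function.iterate_succ_apply', Polynomial.map_comp, ih]

end Iterate

section MonicIn

variable {K : Type} [Field K] {ι : Type} [DecidableEq ι]

/-- View a multivariate polynomial as a univariate polynomial in the variable `j`. -/
noncomputable def mainPoly (K : Type) [Field K] {ι : Type} [DecidableEq ι] (j : ι) :
    MvPolynomial ι K ≃ₐ[K] (MvPolynomial {i // i ≠ j} K)[X] :=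
  (MvPolynomial.renameEquiv K (Equiv.optionSubtypeNe j).symm).trans
    (MvPolynomial.optionEquivLeft K _)

lemma mainPoly_X_self (j : ι) : mainPoly K j (MvPolynomial.X j) = X := by
  simp [mainPoly]

lemma mainPoly_X_of_ne {i j : ι} (h : i ≠ j) :
    mainPoly K j (MvPolynomial.X i) = C (MvPolynomial.X ⟨i, h⟩) := by
  simp [mainPoly, Equiv.optionSubtypeNe_symm_of_ne h]

lemma mainPoly_C (j : ι) (a : K) : mainPoly K j (MvPolynomial.C a) = C (MvPolynomial.C a) := by
  simp [mainPoly]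

lemma natDegree_mainPoly (j : ι) (p : MvPolynomial ι K) :
    (mainPoly K j p).natDegree = p.degreeOf j := by
  rw [MvPolynomial.degreeOf_eq_natDegree]
  rfl

attribute [irreducible] mainPoly

lemma mainPoly_diagPull (j : ι) (g : K[X]) (p : MvPolynomial ι K) :
    mainPoly K j (diagPull ι g p) =
      ((mainPoly K j p).map (diagPull {i // i ≠ j} g : _ →+* _)).comp
        (g.map MvPolynomial.C) := by
  have haev : ∀ {R : Type} [CommRing R] [Algebra K R] (y : R[X]),
      Polynomial.aeval y g = (g.map (algebraMap K R)).comp y := by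
    intro R _ _ y
    rw [comp, eval₂_map, aeval_def]
    rfl
  induction p using MvPolynomial.induction_on with
  | C a =>
    simp only [diagPull, MvPolynomial.algHom_C, mainPoly_C, Polynomial.map_C,
      Polynomial.C_comp, MvPolynomial.algebraMap_eq, RingHom.coe_coe]
  | add p q hp hq => simp only [map_add, hp, hq, Polynomial.map_add, add_comp]
  | mul_X p i hp =>
    simp only [map_mul, hp, Polynomial.map_mul, mul_comp]
    congr 1
    have h1 : diagPull ι g (MvPolynomial.X i) = Polynomial.aeval (MvPolynomial.X i) g := by
      simp [diagPull]
    rw [h1, ← Polynomial.aeval_algHom_apply]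
    rcases eq_or_ne i j with rfl | hij
    · simp [mainPoly_X_self, haev]
    · simp [mainPoly_X_of_ne hij, diagPull]
      rw [← Polynomial.algebraMap_eq, Polynomial.aeval_algebraMap_apply]

/-- The leading coefficient of `p` as a polynomial in the variable `j` is a nonzero constant. -/
def MonicIn (j : ι) (p : MvPolynomial ι K) : Prop :=
  IsUnit (mainPoly K j p).leadingCoeff

lemma MonicIn.of_dvd {j : ι} {p q : MvPolynomial ι K} (hq : MonicIn j q) (h : p ∣ q) :
    MonicIn j p := by
  obtain ⟨r, rfl⟩ := h
  rw [MonicIn, map_mul, leadingCoeff_mul] at hq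
  exact isUnit_of_mul_isUnit_left hq

lemma MonicIn.diagPull {j : ι} {p : MvPolynomial ι K} (hp : MonicIn j p) {g : K[X]}
    (hg : 1 ≤ g.natDegree) : MonicIn j (diagPull ι g p) := by
  have hp' : IsUnit (_root_.diagPull {i // i ≠ j} g (mainPoly K j p).leadingCoeff) :=
    IsUnit.map _ hp
  have hinj : Function.Injective (MvPolynomial.C : K →+* MvPolynomial {i // i ≠ j} K) :=
    MvPolynomial.C_injective _ _
  rw [MonicIn, mainPoly_diagPull, leadingCoeff_comp, leadingCoeff_map_of_leadingCoeff_ne_zero,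
    leadingCoeff_map_of_injective hinj]
  · exact hp'.mul ((IsUnit.map _ (isUnit_iff_ne_zero.2 (leadingCoeff_ne_zero.2 (by
      rintro rfl; simp at hg)))).pow _)
  · exact hp'.ne_zero
  · rw [natDegree_map_eq_of_injective hinj]
    omega

lemma slice_eq_map_mainPoly (i : ι) (b : ι → K) (p : MvPolynomial ι K) :
    slice i b p = (mainPoly K i p).map (MvPolynomial.eval fun k : {k // k ≠ i} => b k) := by
  induction p using MvPolynomial.induction_on with
  | C a => simp [slice, mainPoly_C]
  | add p q hp hq => simp [hp, hq]
  | mul_X p j hp =>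
    rcases eq_or_ne j i with rfl | hj
    · simp [hp, mainPoly_X_self]; simp [slice]
    · simp [hp, mainPoly_X_of_ne hj]; simp [slice, hj]

lemma MonicIn.exists_coeff_slice {j : ι} {p : MvPolynomial ι K} (hp : MonicIn j p) :
    ∃ c : K, c ≠ 0 ∧ ∀ b, (slice j b p).coeff (p.degreeOf j) = c := by
  obtain ⟨c, hc, hc'⟩ := MvPolynomial.isUnit_iff_eq_C_of_isReduced.1 hp
  refine ⟨c, hc.ne_zero, fun b => ?_⟩
  rw [slice_eq_map_mainPoly, coeff_map, ← natDegree_mainPoly, coeff_natDegree, hc',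
    MvPolynomial.eval_C]

lemma natDegree_slice_le_degreeOf (j : ι) (b : ι → K) (p : MvPolynomial ι K) :
    (slice j b p).natDegree ≤ p.degreeOf j := by
  rw [slice_eq_map_mainPoly, ← natDegree_mainPoly]
  exact natDegree_map_le

lemma MvPolynomial.exists_pderiv_ne_zero [CharZero K] {p : MvPolynomial ι K} (h0 : p ≠ 0)
    (hu : ¬ IsUnit p) : ∃ i, MvPolynomial.pderiv i p ≠ 0 := by
  have : ∃ m ∈ p.support, m ≠ 0 := by
    by_contra! h
    have hC : p = MvPolynomial.C (p.coeff 0) := by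
      ext m
      rw [MvPolynomial.coeff_C]
      split_ifs with hm
      · rw [hm]
      · by_contra hne
        exact hm (h m (MvPolynomial.mem_support_iff.2 hne)).symm
    apply hu
    rw [hC]
    refine IsUnit.map (MvPolynomial.C (σ := ι)) (isUnit_iff_ne_zero.2 fun h => h0 ?_)
    rw [hC, h, map_zero]
  obtain ⟨m, hm, hm0⟩ := this
  obtain ⟨i, hi⟩ := Finsupp.ne_iff.1 hm0
  rw [Finsupp.zero_apply] at hi
  refine ⟨i, fun h => ?_⟩
  have h1 := MvPolynomial.coeff_pderiv (i := i) p (m - Finsupp.single i 1)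
  have h2 : m - Finsupp.single i 1 + Finsupp.single i 1 = m := by
    ext k
    rcases eq_or_ne k i with rfl | hk
    · simp; omega
    · simp [hk.symm]
  rw [h, MvPolynomial.coeff_zero, h2] at h1
  refine mul_ne_zero (MvPolynomial.mem_support_iff.1 hm) ?_ h1.symm
  exact Nat.cast_add_one_ne_zero _

theorem monicIn_of_dvd_diagPull [CharZero K] {L : Type} [Field L] [IsAlgClosed L] [Algebra K L]
    {f : K[X]} (hd : 2 ≤ f.natDegree)
    (hf : ¬ ∃ a c, f.map (algebraMap K L) = C a * (X - C c) ^ f.natDegree + C c)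
    {E : MvPolynomial ι K} (hE : Irreducible E) {j : ι} (hj : 0 < E.degreeOf j) {m : ℕ}
    (hm : 1 ≤ m) (hdvd : E ∣ diagPull ι (f.comp^[m] X) E) : MonicIn j E := by
  by_contra hmon
  have hE0 : mainPoly K j E ≠ 0 := by
    rw [Ne, map_eq_zero_iff _ (mainPoly K j).injective]
    exact hE.ne_zero
  set ℓ := (mainPoly K j E).leadingCoeff with hℓ
  have hℓ0 : ℓ ≠ 0 := leadingCoeff_ne_zero.2 hE0
  obtain ⟨r, hrirr, hrℓ⟩ := WfDvdMonoid.exists_irreducible_factor hmon hℓ0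
  have hr : Prime r := hrirr.prime
  obtain ⟨i, hi⟩ := MvPolynomial.exists_pderiv_ne_zero hr.ne_zero hr.not_isUnit
  have hdL : 2 ≤ (f.map (algebraMap K L)).natDegree := by rwa [natDegree_map]
  have : CharZero L := charZero_of_injective_algebraMap (algebraMap K L).injective
  obtain ⟨A, hA⟩ : ∃ A, A = ℓ.totalDegree * E.degreeOf j + 1 := ⟨_, rfl⟩
  obtain ⟨k₀, hk₀⟩ := exists_mul_rootMultiplicity_iterate_lt hdL
    (by rw [natDegree_map]; exact hf) A
  rw [natDegree_map] at hk₀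
  set t := 2 * k₀
  have hmt : m * t = 2 * (m * k₀) := by simp only [t]; ring
  set g := f.comp^[m * t] X with hg
  have hgd : g.natDegree = f.natDegree ^ (2 * (m * k₀)) := by
    rw [hg, natDegree_iterate_comp_X, hmt]
  have hN1 : 1 ≤ f.natDegree ^ (2 * (m * k₀)) := Nat.one_le_pow _ _ (by omega)
  obtain ⟨N, hN⟩ : ∃ N, N = f.natDegree ^ (2 * (m * k₀)) := ⟨_, rfl⟩
  rw [← hN] at hgd hN1
  have hcoef : Function.Injective (MvPolynomial.C : K →+* MvPolynomial {i // i ≠ j} K) :=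
    MvPolynomial.C_injective _ _
  have hgN : (g.map (MvPolynomial.C : K →+* MvPolynomial {i // i ≠ j} K)).natDegree = N := by
    rw [natDegree_map_eq_of_injective hcoef, hgd]
  have hσ : diagPull {i // i ≠ j} g ℓ ≠ 0 := by
    rwa [Ne, map_eq_zero_iff _ (diagPull_injective (by omega))]
  have hmult : multiplicity r (diagPull {i // i ≠ j} g ℓ) ≤ ℓ.totalDegree * ((N - 1) / A) := by
    refine le_of_pow_dvd_diagPull (L := L) hℓ0 i hi (g := g) (by omega) (fun c θ => ?_)
      (pow_multiplicity_dvd r _)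
    rw [Nat.le_div_iff_mul_le (by omega), hg, map_iterate_comp_X, hmt]
    have := hk₀ (m * k₀) (Nat.le_mul_of_pos_left _ hm) c θ
    rw [mul_comm]
    omega
  have hlc : IsUnit (g.map (MvPolynomial.C : K →+* MvPolynomial {i // i ≠ j} K)).leadingCoeff := by
    rw [leadingCoeff_map_of_injective hcoef]
    exact IsUnit.map _ (isUnit_iff_ne_zero.2 (leadingCoeff_ne_zero.2 (by
      intro h; rw [h, natDegree_zero] at hgd; omega)))
  have hmul : multiplicity r ((diagPull {i // i ≠ j} g : _ →+* _) ℓ) *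
      (mainPoly K j E).natDegree < N := by
    rw [natDegree_mainPoly]
    have h1 : A * ((N - 1) / A) ≤ N - 1 := Nat.mul_div_le _ _
    calc _ ≤ ℓ.totalDegree * ((N - 1) / A) * E.degreeOf j := Nat.mul_le_mul_right _ hmult
      _ = (ℓ.totalDegree * E.degreeOf j) * ((N - 1) / A) := by ring
      _ ≤ A * ((N - 1) / A) := Nat.mul_le_mul_right _ (by omega)
      _ < N := by omega
  have hdvd' : mainPoly K j E ∣ ((mainPoly K j E).map (diagPull {i // i ≠ j} g : _ →+* _)).comp
      (g.map MvPolynomial.C) := by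
    rw [← mainPoly_diagPull]
    obtain ⟨q, hq⟩ := dvd_diagPull_iterate_mul hdvd t
    rw [← hg] at hq
    exact ⟨mainPoly K j q, by rw [hq]; exact map_mul (mainPoly K j) E q⟩
  have hcoeffs := hr.dvd_coeff_of_dvd_map_comp (diagPull {i // i ≠ j} g : _ →+* _)
    hlc (hN1.trans_eq hgN.symm) hσ hrℓ (hmul.trans_eq hgN.symm) hdvd'
  have hCr : C r ∣ mainPoly K j E := C_dvd_iff_dvd_coeff _ _ |>.2 hcoeffs
  obtain ⟨q, hq⟩ := hCr
  have hirr : Irreducible (mainPoly K j E) := (MulEquiv.irreducible_iff (mainPoly K j)).2 hE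
  rcases hirr.isUnit_or_isUnit hq with h | h
  · exact hr.not_isUnit (isUnit_C.1 h)
  · have := natDegree_eq_zero_of_isUnit h
    have hdeg := natDegree_mainPoly j E
    rw [hq, natDegree_C_mul hr.ne_zero, this] at hdeg
    omega

end MonicIn

section EventualUnit

lemma Polynomial.rootMultiplicity_comp_iterate_le {k : Type} [Field k] {f : k[X]}
    (hf : f.natDegree ≠ 0) (m : ℕ) {p : k[X]} (hp : p ≠ 0) (c : k)
    (hder : ∀ i < m, (derivative f).eval (f.eval^[i] c) ≠ 0) :
    (p.comp (f.comp^[m] X)).rootMultiplicity c ≤ p.rootMultiplicity (f.eval^[m] c) := by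
  induction m generalizing p with
  | zero => simp
  | succ m ih =>
    have hpf : p.comp f ≠ 0 := by
      intro h
      rcases comp_eq_zero_iff.1 h with h | h
      · exact hp h
      · apply hf
        rw [h.2, natDegree_C]
    have h1 : (f - C (f.eval (f.eval^[m] c))) ≠ 0 := by
      intro h
      rw [sub_eq_zero] at h
      apply hf
      rw [h, natDegree_C]
    have h2 : (f - C (f.eval (f.eval^[m] c))).rootMultiplicity (f.eval^[m] c) ≤ 1 := by
      by_contra! h3
      rw [one_lt_rootMultiplicity_iff_isRoot h1] at h3
      refine hder m m.lt_succ_self ?_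
      simpa using h3.2
    rw [Function.iterate_succ_apply', ← comp_assoc, Function.iterate_succ_apply']
    refine (ih hpf fun i hi => hder i (hi.trans m.lt_succ_self)).trans
      ((rootMultiplicity_comp_le hp hf _).trans ?_)
    exact (Nat.mul_le_mul_left _ h2).trans_eq (mul_one _)

lemma Nat.exists_forall_eq_of_le_add {o : ℕ → ℕ} {D m s₀ : ℕ} (hD : ∀ s ≥ s₀, o s ≤ D)
    (ho : ∀ s ≥ s₀, o s ≤ o (s + m)) : ∃ s₁, ∀ s ≥ s₁, o (s + m) = o s := by
  let S : ℕ → ℕ := fun s => ∑ i ∈ Finset.range m, o (s₀ + s + i)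
  have hS : ∀ s, S (s + 1) + o (s₀ + s) = S s + o (s₀ + s + m) := by
    intro s
    have h1 := Finset.sum_range_succ (fun i => o (s₀ + s + i)) m
    have h2 := Finset.sum_range_succ' (fun i => o (s₀ + s + i)) m
    have h3 : S (s + 1) = ∑ i ∈ Finset.range m, o (s₀ + s + (i + 1)) :=
      Finset.sum_congr rfl fun i _ => by congr 1; ring
    have h4 : S s = ∑ i ∈ Finset.range m, o (s₀ + s + i) := rfl
    rw [h3, h4]
    simp only [add_zero] at h2
    omega
  have hmono : Monotone S := monotone_nat_of_le_succ fun s => by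
    have := hS s
    have := ho (s₀ + s) (by omega)
    omega
  have hbdd : BddAbove (Set.range S) := ⟨m * D, by
    rintro _ ⟨s, rfl⟩
    calc S s ≤ ∑ i ∈ Finset.range m, D := Finset.sum_le_sum fun i _ => hD _ (by omega)
      _ = m * D := by simp⟩
  obtain ⟨s₁, hs₁⟩ : ∃ s₁, S s₁ = sSup (Set.range S) := Nat.sSup_mem (Set.range_nonempty S) hbdd
  refine ⟨s₀ + s₁, fun s hs => ?_⟩
  obtain ⟨t, rfl⟩ := Nat.exists_eq_add_of_le (show s₀ ≤ s by omega)
  have h1 : S t = S (t + 1) := by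
    refine le_antisymm (hmono t.le_succ) ?_
    calc S (t + 1) ≤ S s₁ := hs₁ ▸ le_csSup hbdd ⟨_, rfl⟩
      _ ≤ S t := hmono (by omega)
  have := hS t
  omega

variable {K : Type} [Field K] {ι : Type} [DecidableEq ι]

lemma slice_coeff_mem (R : Subring K) (i : ι) {b : ι → K} (hb : ∀ j, b j ∈ R)
    {p : MvPolynomial ι K} (hp : ∀ m, p.coeff m ∈ R) (k : ℕ) : (slice i b p).coeff k ∈ R := by
  have key : slice i b p ∈ (Polynomial.mapRingHom R.subtype).range := by
    have hC : ∀ x ∈ R, (C x : K[X]) ∈ (Polynomial.mapRingHom R.subtype).range := fun x hx =>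
      ⟨C ⟨x, hx⟩, by simp⟩
    rw [slice, MvPolynomial.aeval_def, MvPolynomial.eval₂_eq]
    refine sum_mem fun m _ => mul_mem (hC _ (hp m)) (prod_mem fun j _ => pow_mem ?_ _)
    rcases eq_or_ne j i with rfl | hj
    · exact ⟨X, by simp⟩
    · rw [Function.update_of_ne hj]
      exact hC _ (hb j)
  obtain ⟨q, hq⟩ := key
  rw [← hq]
  simp

lemma MvPolynomial.eval_mem_subring {ι : Type} (R : Subring K) {b : ι → K} (hb : ∀ j, b j ∈ R)
    {p : MvPolynomial ι K} (hp : ∀ m, p.coeff m ∈ R) : MvPolynomial.eval b p ∈ R := by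
  rw [MvPolynomial.eval_eq]
  exact sum_mem fun m _ => mul_mem (hp m) (prod_mem fun j _ => pow_mem (hb j) _)

theorem eventually_abv_eval_eq_one {v : AbsoluteValue K ℝ}
    (hv : ∀ x y : K, v (x + y) ≤ max (v x) (v y)) {f : K[X]}
    (hf : ∀ i, v (f.coeff i) ≤ 1) {E H : MvPolynomial ι K}
    (hE : ∀ m, v (E.coeff m) ≤ 1) (hH : ∀ m, v (H.coeff m) ≤ 1) {m : ℕ}
    (hEH : diagPull ι (f.comp^[m] X) E = E * H) {j : ι} {c : K} (hc : v c = 1)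
    (hcE : ∀ b, (slice j b E).coeff (E.degreeOf j) = c) {a : ι → K} (ha : ∀ i, v (a i) ≤ 1)
    {s₀ : ℕ} (hder : ∀ s ≥ s₀, v ((derivative f).eval (f.eval^[s] (a j))) = 1) :
    ∃ s₁, ∀ s ≥ s₁, v (MvPolynomial.eval (fun i => f.eval^[s] (a i)) H) = 1 := by
  classical
  let R := absInt v hv
  let k := IsLocalRing.ResidueField R
  let π : R →+* k := IsLocalRing.residue R
  have hπ : ∀ x : R, π x = 0 ↔ v x < 1 := fun x => absInt_residue_eq_zero_iff
  have hqR : ∀ s i, f.eval^[s] (a i) ∈ R := fun s i =>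
    Polynomial.iterate_eval_mem_subring R hf (ha i) s
  obtain ⟨f', hf'⟩ := Polynomial.exists_map_subtype_eq R hf
  have hex : ∀ (p : MvPolynomial ι K), (∀ m, v (p.coeff m) ≤ 1) → ∀ s,
      ∃ g : R[X], g.map R.subtype = slice j (fun i => f.eval^[s] (a i)) p := fun p hp s =>
    Polynomial.exists_map_subtype_eq R fun _ => slice_coeff_mem R j (hqR s) hp _
  choose g hg using hex E hE
  choose h hh using hex H hH
  have hsub : Function.Injective R.subtype := Subtype.val_injective
  have hfunc : ∀ s, (g (s + m)).comp (f'.comp^[m] X) = g s * h s := by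
    intro s
    apply Polynomial.map_injective _ hsub
    have hit : (f'.comp^[m] X).map R.subtype = f.comp^[m] X := by
      rw [map_iterate_comp_X, hf']
    rw [Polynomial.map_mul, hg, hh, Polynomial.map_comp, hg, hit, ← map_mul, ← hEH,
      slice_diagPull]
    congr 1
    refine congrArg (fun b => slice j b E) (funext fun i => ?_)
    rw [Polynomial.iterate_comp_eval, eval_X, add_comm, Function.iterate_add_apply]
  let y : ℕ → R := fun s => ⟨f.eval^[s] (a j), hqR s j⟩
  let fk := f'.map π
  have hevR : ∀ (p : R[X]) (x : R), ((p.eval x : R) : K) = (p.map R.subtype).eval (x : K) := by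
    intro p x
    rw [show (x : K) = R.subtype x from rfl, eval_map_apply]
    rfl
  have hy : ∀ s i, fk.eval^[i] (π (y s)) = π (y (s + i)) := by
    intro s i
    induction i with
    | zero => rfl
    | succ i ih =>
      rw [Function.iterate_succ_apply', ih, eval_map_apply]
      congr 1
      ext
      rw [hevR, hf']
      simp only [y]
      rw [← add_assoc, Function.iterate_succ_apply']
  have hderk : ∀ s ≥ s₀, (derivative fk).eval (π (y s)) ≠ 0 := by
    intro s hs
    rw [derivative_map, eval_map_apply, Ne, hπ, hevR, ← derivative_map, hf', hder s hs]
    exact lt_irrefl _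
  have hfk : fk.natDegree ≠ 0 := by
    intro h
    apply hderk s₀ le_rfl
    rw [derivative_of_natDegree_zero h, eval_zero]
  have hgk : ∀ s, (g s).map π ≠ 0 := by
    intro s h0
    have h1 := congrArg (fun p => p.coeff (E.degreeOf j)) h0
    simp only [coeff_map, coeff_zero, hπ] at h1
    have h2 : ((g s).coeff (E.degreeOf j) : K) = c := by
      rw [← hcE (fun i => f.eval^[s] (a i)), ← hg, coeff_map]
      rfl
    rw [h2, hc] at h1
    exact lt_irrefl _ h1
  let o : ℕ → ℕ := fun s => ((g s).map π).rootMultiplicity (π (y s))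
  have hoD : ∀ s ≥ s₀, o s ≤ E.degreeOf j := by
    intro s _
    simp only [o]
    rw [← count_roots]
    refine (Multiset.count_le_card _ _).trans ((card_roots' _).trans (natDegree_map_le.trans ?_))
    rw [← natDegree_map_eq_of_injective hsub, hg]
    exact natDegree_slice_le_degreeOf _ _ _
  have hprod : ∀ s, (g s).map π * (h s).map π ≠ 0 := by
    intro s
    have h1 := congrArg (Polynomial.map π) (hfunc s)
    rw [Polynomial.map_mul, Polynomial.map_comp, map_iterate_comp_X] at h1
    rw [← h1]
    intro h0
    rcases comp_eq_zero_iff.1 h0 with h | h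
    · exact hgk _ h
    · have := congrArg natDegree h.2
      rw [natDegree_iterate_comp, natDegree_X, mul_one, natDegree_C] at this
      exact pow_ne_zero _ hfk this
  have hstep : ∀ s ≥ s₀, o s + ((h s).map π).rootMultiplicity (π (y s)) ≤ o (s + m) := by
    intro s hs
    have h1 := congrArg (Polynomial.map π) (hfunc s)
    rw [Polynomial.map_mul, Polynomial.map_comp, map_iterate_comp_X] at h1
    have h2 := rootMultiplicity_comp_iterate_le hfk m (hgk (s + m)) (π (y s)) fun i _ => by
      rw [hy]
      exact hderk _ (by omega)
    rw [h1, rootMultiplicity_mul (hprod s), hy] at h2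
    exact h2
  obtain ⟨s₁, hs₁⟩ := Nat.exists_forall_eq_of_le_add hoD fun s hs =>
    (Nat.le_add_right _ _).trans (hstep s hs)
  refine ⟨max s₀ s₁, fun s hs => ?_⟩
  have h1 := hstep s ((le_max_left _ _).trans hs)
  rw [hs₁ s ((le_max_right _ _).trans hs)] at h1
  have hval : (((h s).eval (y s) : R) : K) = MvPolynomial.eval (fun i => f.eval^[s] (a i)) H := by
    rw [hevR, hh, eval_slice]
    congr 2
    exact Function.update_eq_self _ _
  have hle : v (MvPolynomial.eval (fun i => f.eval^[s] (a i)) H) ≤ 1 :=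
    MvPolynomial.eval_mem_subring R (hqR s) hH
  refine le_antisymm hle (not_lt.1 fun hlt => ?_)
  rw [← hval, ← hπ, ← eval_map_apply] at hlt
  have := (rootMultiplicity_pos (right_ne_zero_of_mul (hprod s))).2 hlt
  omega

end EventualUnit

theorem Polynomial.exists_C_eq_of_not_dvd {R : Type*} [CommRing R] [IsDomain R]
    [UniqueFactorizationMonoid R] {p q : R[X]} (hp : Irreducible p) (hdeg : p.natDegree ≠ 0)
    (hpq : ¬ p ∣ q) : ∃ r : R, r ≠ 0 ∧ ∃ a b : R[X], C r = a * p + b * q := by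
  classical
  obtain ⟨_⟩ : Nonempty (NormalizedGCDMonoid R) := inferInstance
  have hprim := hp.isPrimitive hdeg
  have hirr := (hprim.irreducible_iff_irreducible_map_fraction_map (K := FractionRing R)).1 hp
  have hnd : ¬ p.map (algebraMap R (FractionRing R)) ∣ q.map (algebraMap R (FractionRing R)) := by
    intro h
    exact hpq (hprim.dvd_of_fraction_map_dvd_fraction_map (K := FractionRing R) h)
  obtain ⟨a, b, hab⟩ := (hirr.coprime_iff_not_dvd).2 hnd
  obtain ⟨c, hc, hc'⟩ := IsLocalization.integerNormalization_spec (nonZeroDivisors R) a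
  obtain ⟨e, he, he'⟩ := IsLocalization.integerNormalization_spec (nonZeroDivisors R) b
  refine ⟨c * e, mul_ne_zero (nonZeroDivisors.ne_zero hc) (nonZeroDivisors.ne_zero he),
    C e * IsLocalization.integerNormalization (nonZeroDivisors R) a,
    C c * IsLocalization.integerNormalization (nonZeroDivisors R) b, ?_⟩
  apply Polynomial.map_injective _ (IsFractionRing.injective R (FractionRing R))
  simp only [Polynomial.map_mul, Polynomial.map_add, Polynomial.map_C, hc', he',
    Algebra.smul_def, Polynomial.algebraMap_apply, map_mul]
  linear_combination (-(C (algebraMap R (FractionRing R) c) * C (algebraMap R (FractionRing R) e))) * hab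

variable {K : Type} [Field K] {ι : Type} [DecidableEq ι]

theorem MvPolynomial.exists_elimination {E G : MvPolynomial ι K} (hE : Irreducible E)
    (hEG : ¬ E ∣ G) (w : ι) :
    ∃ R : MvPolynomial ι K, R ≠ 0 ∧ R.degreeOf w = 0 ∧ ∃ A B, R = A * E + B * G := by
  by_cases h0 : E.degreeOf w = 0
  · exact ⟨E, hE.ne_zero, h0, 1, 0, by ring⟩
  have hirr : Irreducible (mainPoly K w E) := (MulEquiv.irreducible_iff (mainPoly K w)).2 hE
  have hnd : ¬ mainPoly K w E ∣ mainPoly K w G := fun h => hEG ((map_dvd_iff (mainPoly K w)).1 h)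
  obtain ⟨r, hr, a, b, hab⟩ := Polynomial.exists_C_eq_of_not_dvd hirr
    (by rwa [natDegree_mainPoly]) hnd
  refine ⟨(mainPoly K w).symm (Polynomial.C r), by simpa using hr, ?_, (mainPoly K w).symm a,
    (mainPoly K w).symm b, ?_⟩
  · rw [← natDegree_mainPoly, AlgEquiv.apply_symm_apply, natDegree_C]
  · apply (mainPoly K w).injective
    simp only [map_add, map_mul, AlgEquiv.apply_symm_apply, hab]

lemma exists_le_of_forall_residue {m : ℕ} (hm : 1 ≤ m) {Q : ℝ → ℕ → Prop}
    (hQ : ∀ c c' s, c' ≤ c → Q c s → Q c' s)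
    (h : ∀ r < m, ∃ c > 0, ∃ s₀, ∀ s ≥ s₀, s % m = r → Q c s) :
    ∃ c > 0, ∃ s₀, ∀ s ≥ s₀, Q c s := by
  have key : ∀ t ≤ m, ∃ c > 0, ∃ s₀, ∀ s ≥ s₀, s % m < t → Q c s := by
    intro t
    induction t with
    | zero => exact fun _ => ⟨1, one_pos, 0, fun s _ hs => by omega⟩
    | succ t ih =>
      intro ht
      obtain ⟨c, hc, s₀, hs₀⟩ := ih (by omega)
      obtain ⟨c', hc', s₁, hs₁⟩ := h t ht
      refine ⟨min c c', lt_min hc hc', max s₀ s₁, fun s hs hst => ?_⟩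
      rcases Nat.lt_succ_iff_lt_or_eq.1 hst with h1 | h1
      · exact hQ _ _ _ (min_le_left _ _) (hs₀ s (by omega) h1)
      · exact hQ _ _ _ (min_le_right _ _) (hs₁ s (by omega) h1)
  obtain ⟨c, hc, s₀, hs₀⟩ := key m le_rfl
  exact ⟨c, hc, s₀, fun s hs => hs₀ s hs (Nat.mod_lt _ hm)⟩

section Recurrence

variable {K : Type} [Field K] {g h : ℕ → K} {m : ℕ}

lemma eq_mul_add_of_mod_eq {s t m : ℕ} (hst : t ≤ s) (h : s % m = t % m) :
    ∃ k, s = t + m * k := by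
  obtain ⟨k, hk⟩ := (Nat.modEq_iff_dvd' hst).1 (h.symm : t % m = s % m)
  exact ⟨k, by omega⟩

lemma exists_le_abv_of_recurrence {v : AbsoluteValue K ℝ} (hg : ∀ s, g (s + m) = g s * h s)
    {s₁ : ℕ} (hh : ∀ s ≥ s₁, v (h s) = 1) {r : ℕ} (hr : r < m)
    (hne : ∀ s, s % m = r → g s ≠ 0) :
    ∃ c > 0, ∃ s₀, ∀ s ≥ s₀, s % m = r → c ≤ v (g s) := by
  obtain ⟨t, ht, htr⟩ : ∃ t ≥ s₁, t % m = r := ⟨r + m * s₁, by nlinarith, by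
    rw [Nat.add_mul_mod_self_left, Nat.mod_eq_of_lt hr]⟩
  refine ⟨v (g t), v.pos (hne t htr), t, fun s hs hsr => ?_⟩
  obtain ⟨k, rfl⟩ := eq_mul_add_of_mod_eq hs (hsr.trans htr.symm)
  clear hs hsr
  have : ∀ k, v (g (t + m * k)) = v (g t) := by
    intro k
    induction k with
    | zero => rfl
    | succ k ih => rw [mul_add, mul_one, ← add_assoc, hg, map_mul, ih, hh _ (by omega), mul_one]
  exact (this k).ge

lemma eq_zero_of_recurrence (hg : ∀ s, g (s + m) = g s * h s) {s t : ℕ} (hts : t ≤ s)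
    (hst : s % m = t % m) (ht : g t = 0) : g s = 0 := by
  obtain ⟨k, rfl⟩ := eq_mul_add_of_mod_eq hts hst
  clear hst hts
  induction k with
  | zero => simpa
  | succ k ih => rw [mul_add, mul_one, ← add_assoc, hg, ih, zero_mul]

end Recurrence

namespace ProductFormula

open Filter

variable {K : Type} [Field K] (F : ProductFormula K) {ι : Type}

lemma eventually_abv_eq_one {x : K} (hx : x ≠ 0) : ∀ᶠ i in cofinite, F.fin i x = 1 :=
  eventually_cofinite.2 (F.finite x hx)

lemma eventually_abv_le_one (x : K) : ∀ᶠ i in cofinite, F.fin i x ≤ 1 :=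
  eventually_cofinite.2 ((F.finite_gt_one x).subset fun _ hi => not_le.1 hi)

lemma eventually_coeff_le_one (p : K[X]) : ∀ᶠ i in cofinite, ∀ k, F.fin i (p.coeff k) ≤ 1 :=
  eventually_cofinite.2 (F.finite_coeff_gt_one p)

lemma eventually_mvCoeff_le_one (p : MvPolynomial ι K) :
    ∀ᶠ i in cofinite, ∀ m, F.fin i (p.coeff m) ≤ 1 := by
  have h : ∀ᶠ i in cofinite, ∀ m ∈ p.support, F.fin i (p.coeff m) ≤ 1 :=
    (Finset.eventually_all p.support).2 fun m _ => F.eventually_abv_le_one _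
  filter_upwards [h] with i hi m
  by_cases hm : m ∈ p.support
  · exact hi m hm
  · simp [MvPolynomial.notMem_support_iff.1 hm]

variable {F}

lemma IsAdapted.eventually_lower_bound {T : Set F.ι} {f : K[X]} {y : ℕ → K}
    (hT : F.IsAdapted T f y) {b : K[X]} (hb : b ≠ 0) :
    ∀ᶠ i in cofinite, i ∈ T → ∃ c > 0, ∃ s₀, ∀ s ≥ s₀, c ≤ F.fin i (b.eval (y s)) :=
  eventually_cofinite.2 ((hT.lower_bound b hb).subset fun _ hi => Classical.not_imp.1 hi)

variable [DecidableEq ι] [Finite ι]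

lemma IsAdapted.eventually_eval_eq_one {T : Set F.ι} {f : K[X]} {a : ι → K} {j : ι}
    (hT : F.IsAdapted T f fun s => f.eval^[s] (a j)) {E H : MvPolynomial ι K}
    (hE : MonicIn j E) {m : ℕ} (hEH : diagPull ι (f.comp^[m] X) E = E * H) :
    ∀ᶠ i in cofinite, i ∈ T →
      ∃ s₁, ∀ s ≥ s₁, F.fin i (MvPolynomial.eval (fun l => f.eval^[s] (a l)) H) = 1 := by
  obtain ⟨c, hc, hcE⟩ := hE.exists_coeff_slice
  filter_upwards [F.eventually_coeff_le_one f, F.eventually_mvCoeff_le_one E,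
    F.eventually_mvCoeff_le_one H, F.eventually_abv_eq_one hc,
    eventually_all.2 fun l => F.eventually_abv_le_one (a l)] with i hf hE hH hc ha hi
  obtain ⟨s₀, hs₀⟩ := hT.derivative_eq i hi
  exact eventually_abv_eval_eq_one (F.nonarch i) hf hE hH hEH hc hcE ha hs₀

end ProductFormula

section

variable {K : Type} [Field K] {ι : Type}

lemma eval_diagPull_iterate (f : K[X]) (k s : ℕ) (a : ι → K) (p : MvPolynomial ι K) :
    MvPolynomial.eval (fun i => f.eval^[s] (a i)) (diagPull ι (f.comp^[k] X) p) =
      MvPolynomial.eval (fun i => f.eval^[s + k] (a i)) p := by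
  rw [eval_diagPull]
  congr 2
  funext i
  rw [iterate_comp_eval, eval_X, add_comm, Function.iterate_add_apply]

lemma eval_recurrence {f : K[X]} {E H : MvPolynomial ι K} {m : ℕ}
    (h : diagPull ι (f.comp^[m] X) E = E * H) (a : ι → K) (s : ℕ) :
    MvPolynomial.eval (fun i => f.eval^[s + m] (a i)) E =
      MvPolynomial.eval (fun i => f.eval^[s] (a i)) E *
        MvPolynomial.eval (fun i => f.eval^[s] (a i)) H := by
  rw [← map_mul, ← h, eval_diagPull_iterate]

lemma dvd_or_dvd_of_dvd_diagPull_iterate {f : K[X]} {E H G : MvPolynomial ι K} {m : ℕ}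
    (h : diagPull ι (f.comp^[m] X) E = E * H) (hG : Irreducible G) (k : ℕ)
    (hGE : G ∣ diagPull ι (f.comp^[m * k] X) E) :
    G ∣ E ∨ ∃ t, G ∣ diagPull ι (f.comp^[t] X) H := by
  induction k with
  | zero => left; simpa [diagPull_X] using hGE
  | succ k ih =>
    rw [mul_add, mul_one, add_comm, diagPull_iterate_add, h, map_mul] at hGE
    rcases hG.prime.dvd_or_dvd hGE with h1 | h1
    · exact ih h1
    · exact Or.inr ⟨_, h1⟩

lemma finite_range_iterate_of_not_injective {X : Type*} {g : X → X} {x : X}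
    (h : ¬ Function.Injective fun s => g^[s] x) : (Set.range fun s => g^[s] x).Finite := by
  have : ∃ s t, s < t ∧ g^[s] x = g^[t] x := by
    simp only [Function.Injective, not_forall] at h
    obtain ⟨s, t, hst, hne⟩ := h
    rcases Nat.lt_or_gt_of_ne hne with h | h
    · exact ⟨s, t, h, hst⟩
    · exact ⟨t, s, h, hst.symm⟩
  obtain ⟨s, t, hlt, hst⟩ := this
  refine ((Set.finite_Iio t).image fun s => g^[s] x).subset ?_
  rintro _ ⟨u, rfl⟩
  induction u using Nat.strong_induction_on with
  | _ u ih =>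
    by_cases hu : u < t
    · exact ⟨u, hu, rfl⟩
    · have := ih (u - t + s) (by omega)
      convert! this using 1
      show g^[u] x = g^[u - t + s] x
      rw [Function.iterate_add_apply, hst, ← Function.iterate_add_apply]
      congr 2
      omega

lemma finite_range_eval_iterate [Finite ι] {f : K[X]} {a : ι → K} {G : MvPolynomial ι K}
    (h : ∀ j ∈ G.vars, ¬ Function.Injective fun s => f.eval^[s] (a j)) :
    (Set.range fun s => MvPolynomial.eval (fun i => f.eval^[s] (a i)) G).Finite := by
  classical
  let S : ι → Set K := fun i => if i ∈ G.vars then Set.range fun s => f.eval^[s] (a i) else {0}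
  have hS : (Set.univ.pi S).Finite := Set.Finite.pi fun i => by
    by_cases hi : i ∈ G.vars
    · simpa [S, hi] using finite_range_iterate_of_not_injective (h i hi)
    · simp [S, hi]
  refine (hS.image fun q => MvPolynomial.eval q G).subset ?_
  rintro _ ⟨s, rfl⟩
  refine ⟨fun i => if i ∈ G.vars then f.eval^[s] (a i) else 0, fun i _ => ?_, ?_⟩
  · by_cases hi : i ∈ G.vars <;> simp [S, hi]
  · exact MvPolynomial.hom_congr_vars (by ext; simp) (fun i hi _ => by simp [hi]) rfl

lemma exists_le_abv_of_finite {g : ℕ → K} (hg : (Set.range g).Finite) {Q : ℕ → Prop}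
    (hne : ∀ s, Q s → g s ≠ 0) (v : AbsoluteValue K ℝ) : ∃ c > 0, ∀ s, Q s → c ≤ v (g s) := by
  have hfin : (v '' (Set.range g \ {0})).Finite := (hg.subset Set.sdiff_subset).image _
  rcases (v '' (Set.range g \ {0})).eq_empty_or_nonempty with h | h
  · exact ⟨1, one_pos, fun s hs => absurd (h ▸ Set.mem_image_of_mem v ⟨⟨s, rfl⟩, hne s hs⟩ :
      v (g s) ∈ (∅ : Set ℝ)) (Set.notMem_empty _)⟩
  · obtain ⟨c, ⟨x, hx, rfl⟩, hmin⟩ := Set.exists_min_image _ id hfin h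
    exact ⟨v x, v.pos hx.2, fun s hs => hmin _ (Set.mem_image_of_mem v ⟨⟨s, rfl⟩, hne s hs⟩)⟩

variable [DecidableEq ι]

lemma degreeOf_ne_zero_of_dvd_diagPull [CharZero K] {g : K[X]} (hg : 1 ≤ g.natDegree)
    {E G : MvPolynomial ι K} (hE : E ≠ 0) (hGE : G ∣ diagPull ι g E) {j : ι}
    (hj : G.degreeOf j ≠ 0) : E.degreeOf j ≠ 0 := by
  intro h0
  rw [← natDegree_mainPoly, natDegree_eq_zero] at h0
  obtain ⟨c, hc⟩ := h0
  have h1 := map_dvd (mainPoly K j) hGE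
  rw [mainPoly_diagPull, ← hc, Polynomial.map_C, C_comp] at h1
  apply hj
  rw [← natDegree_mainPoly]
  have h2 := natDegree_le_of_dvd h1 (by
    rw [C_ne_zero]
    intro hc0
    apply hE
    apply (mainPoly K j).injective
    rw [← hc, map_zero, (map_eq_zero_iff (diagPull {i // i ≠ j} g)
      (diagPull_injective hg)).1 hc0, C_0])
  simpa using h2

end

namespace ProductFormula

open Filter

variable {K : Type} [Field K] (F : ProductFormula K) {ι : Type} [DecidableEq ι] [Finite ι]

theorem exists_lower_bound_of_dvd_diagPull [CharZero K] {f : K[X]} (hd : 2 ≤ f.natDegree)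
    {E G : MvPolynomial ι K} (hE : Irreducible E) (hG : Irreducible G) {m k : ℕ} (hm : 1 ≤ m)
    (hEE : E ∣ diagPull ι (f.comp^[m] X) E) (hGE : G ∣ diagPull ι (f.comp^[m * k] X) E)
    (hmon : ∀ j, E.degreeOf j ≠ 0 → MonicIn j E) {a : ι → K}
    (hne : ∀ s, MvPolynomial.eval (fun i => f.eval^[s] (a i)) G ≠ 0) :
    ∃ T : Set F.ι, T.Infinite ∧ ∀ᶠ i in cofinite, i ∈ T → ∃ c > 0, ∃ s₀, ∀ s ≥ s₀,
      c ≤ F.fin i (MvPolynomial.eval (fun i => f.eval^[s] (a i)) G) := by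
  by_cases hpre : ∀ j ∈ G.vars, ¬ Function.Injective fun s => f.eval^[s] (a j)
  · refine ⟨Set.univ, Set.infinite_univ, Eventually.of_forall fun i _ => ?_⟩
    obtain ⟨c, hc, h⟩ := exists_le_abv_of_finite (finite_range_eval_iterate hpre)
      (Q := fun _ => True) (fun s _ => hne s) (F.fin i)
    exact ⟨c, hc, 0, fun s _ => h s trivial⟩
  push Not at hpre
  obtain ⟨j, hj, hinj⟩ := hpre
  obtain ⟨T, hT⟩ := F.exists_isAdapted f hd (a j) hinj
  refine ⟨T, hT.infinite, ?_⟩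
  have hjE : E.degreeOf j ≠ 0 := degreeOf_ne_zero_of_dvd_diagPull
    (by rw [natDegree_iterate_comp_X]; exact Nat.one_le_pow _ _ (by omega)) hE.ne_zero hGE
    (MvPolynomial.mem_vars_iff_degreeOf_ne_zero.1 hj)
  obtain ⟨H, hH⟩ := hEE
  have key := hT.eventually_eval_eq_one (hmon j hjE) hH
  have h_int : ∀ W : MvPolynomial ι K, ∀ᶠ i in cofinite, ∀ s,
      F.fin i (MvPolynomial.eval (fun i => f.eval^[s] (a i)) W) ≤ 1 := by
    intro W
    filter_upwards [F.eventually_coeff_le_one f, F.eventually_mvCoeff_le_one W,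
      eventually_all.2 fun l => F.eventually_abv_le_one (a l)] with i hf hW ha s
    exact MvPolynomial.eval_mem_subring (absInt (F.fin i) (F.nonarch i))
      (fun l => Polynomial.iterate_eval_mem_subring _ hf (ha l) s) hW
  rcases dvd_or_dvd_of_dvd_diagPull_iterate hH hG k hGE with ⟨W, hW⟩ | ⟨t, W, hW⟩
  · have hWu : IsUnit W := (hE.isUnit_or_isUnit hW).resolve_left hG.not_isUnit
    have hEz : ∀ s, MvPolynomial.eval (fun i => f.eval^[s] (a i)) E ≠ 0 := fun s => by
      rw [hW, map_mul]
      exact mul_ne_zero (hne s) (hWu.map _).ne_zero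
    filter_upwards [key, h_int W] with i hi hWi hiT
    obtain ⟨s₁, hs₁⟩ := hi hiT
    obtain ⟨c, hc, s₀, hs₀⟩ := exists_le_of_forall_residue hm
      (Q := fun c s => c ≤ F.fin i (MvPolynomial.eval (fun i => f.eval^[s] (a i)) E))
      (fun c c' s h1 h2 => h1.trans h2) fun r hr =>
        exists_le_abv_of_recurrence (eval_recurrence hH a) hs₁ hr fun s _ => hEz s
    refine ⟨c, hc, s₀, fun s hs => (hs₀ s hs).trans ?_⟩
    rw [hW, map_mul, map_mul]
    exact mul_le_of_le_one_right ((F.fin i).nonneg _) (hWi s)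
  · filter_upwards [key, h_int W] with i hi hWi hiT
    obtain ⟨s₁, hs₁⟩ := hi hiT
    refine ⟨1, one_pos, s₁, fun s hs => ?_⟩
    rw [← hs₁ (s + t) (by omega), ← eval_diagPull_iterate, hW, map_mul, map_mul]
    exact mul_le_of_le_one_right ((F.fin i).nonneg _) (hWi s)

end ProductFormula

namespace ProductFormula

open Filter

variable {K : Type} [Field K] (F : ProductFormula K)

/-- The nonarchimedean absolute values of the family are nontrivial, pairwise inequivalent, and
trivial on `κ` unless `K` is a number field. -/
structure IsOver (κ : Subfield K) : Prop where
  nontrivial : ∀ i, ∃ x : K, x ≠ 0 ∧ F.fin i x ≠ 1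
  not_equiv : ∀ i i', i ≠ i' → ∃ x : K, F.fin i x < 1 ∧ ¬ F.fin i' x < 1
  isPlaceOver : NumberField K ∨ ∀ i, ∀ c ∈ κ, c ≠ 0 → F.fin i c = 1

variable {F}

theorem IsOver.infinitelyManyPlaces {κ : Subfield K} (hF : F.IsOver κ) {n : ℕ} (f : K[X])
    (V : ClosedSubvar K (Fin n)) (M : Set (Fin n)) (a : Fin n → K)
    (hP : V.pts (RingHom.id K) ∩ fwdOrbit (splitMap f) (chartPt M a) = ∅)
    (𝒜 : Finset (MvPolynomial (Fin n) K))
    (hA : ∀ A ∈ 𝒜, ∀ x : Fin n → AlgebraicClosure K,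
      chartPt M x ∈ V.pts (algebraMap K (AlgebraicClosure K)) → MvPolynomial.aeval x A = 0)
    {T : Set F.ι} (hT : T.Infinite)
    (hlow : ∀ᶠ i in cofinite, i ∈ T → ∃ c > 0, ∃ s₀, ∀ s ≥ s₀, ∃ A ∈ 𝒜,
      c ≤ F.fin i (MvPolynomial.eval (fun i => (f.eval)^[s] (a i)) A)) :
    InfinitelyManyPlaces K κ fun w => OrbitClosureAvoids w f (chartPt M a) V := by
  have hgood := hlow.and ((F.eventually_coeff_le_one f).and
    (eventually_all.2 fun l => F.eventually_abv_le_one (a l)))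
  let T' : Set F.ι := T \ {i | ¬ ((i ∈ T → ∃ c > 0, ∃ s₀, ∀ s ≥ s₀, ∃ A ∈ 𝒜,
      c ≤ F.fin i (MvPolynomial.eval (fun i => (f.eval)^[s] (a i)) A)) ∧
      (∀ k, F.fin i (f.coeff k) ≤ 1) ∧ ∀ l, F.fin i (a l) ≤ 1)}
  have hT' : T'.Infinite := hT.sdiff (eventually_cofinite.1 hgood)
  let pl : F.ι → PlaceK K := fun i => ⟨F.fin i, hF.nontrivial i⟩
  have hne : ∀ i i', i ≠ i' → ¬ PlaceK.Equiv (pl i) (pl i') := fun i i' h he => by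
    obtain ⟨x, h1, h2⟩ := hF.not_equiv i i' h
    exact h2 ((he x).1 h1)
  have hinj : Function.Injective pl := fun i i' h => by
    by_contra hii
    exact hne i i' hii (h ▸ fun _ => Iff.rfl)
  refine ⟨pl '' T', hT'.image hinj.injOn, ?_, ?_⟩
  · rintro _ ⟨i, -, rfl⟩ _ ⟨i', -, rfl⟩ h
    exact hne i i' fun h' => h (h' ▸ rfl)
  · rintro _ ⟨i, ⟨hi, hi'⟩, rfl⟩
    obtain ⟨h1, h2, h3⟩ := not_not.1 hi'
    obtain ⟨c, hc, s₀, hs₀⟩ := h1 hi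
    exact ⟨F.nonarch i, hF.isPlaceOver.imp id fun h => h i,
      orbitClosureAvoids_of_lower_bound (pl i) (F.nonarch i) f h2 V M a h3 hP 𝒜 hA c hc s₀ hs₀⟩

end ProductFormula

section OpenChart

variable {L : Type} [Field L] {ι : Type}

/-- Multihomogeneous coordinates on the chart of `(P^1)^ι` where the coordinates `(i, ε i)`
do not vanish. -/
def openCoords (ε : ι → Fin 2) (x : ι → L) : ι × Fin 2 → L :=
  fun jk => if jk.2 = ε jk.1 then 1 else x jk.1

/-- The point of `(P^1)^ι` with coordinates `x` in the chart given by `ε`. -/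
noncomputable def openPt (ε : ι → Fin 2) (x : ι → L) : ι → OnePoint L :=
  open Classical in fun i =>
    if ε i = 1 then (x i : OnePoint L) else if x i = 0 then ∞ else ((x i)⁻¹ : L)

lemma openPt_one (x : ι → L) : openPt (fun _ => 1) x = chartPt ∅ x := by
  funext i
  simp [openPt, chartPt]

@[simp] lemma homCoords_coe (y : L) : homCoords (y : OnePoint L) = ![y, 1] := rfl

@[simp] lemma homCoords_infty : homCoords (∞ : OnePoint L) = ![1, 0] := rfl

lemma exists_eq_openPt {ε : ι → Fin 2} {t : ι → OnePoint L}
    (h : ∀ i, homCoords (t i) (ε i) ≠ 0) : ∃ x, t = openPt ε x := by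
  have : ∀ i, ∃ y : L, ∀ x : ι → L, x i = y → t i = openPt ε x i := by
    intro i
    have hi := h i
    rcases (by lia : ε i = 0 ∨ ε i = 1) with he | he <;> rw [he] at hi <;>
      rcases eq_or_ne (t i) ∞ with ht | ht
    · exact ⟨0, fun x hx => by simp [openPt, he, hx, ht]⟩
    · obtain ⟨y, hy⟩ := OnePoint.ne_infty_iff_exists.1 ht
      rw [← hy] at hi ⊢
      have hy0 : y ≠ 0 := by simpa using hi
      exact ⟨y⁻¹, fun x hx => by simp [openPt, he, hx, hy0]⟩
    · simp [ht] at hi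
    · obtain ⟨y, hy⟩ := OnePoint.ne_infty_iff_exists.1 ht
      exact ⟨y, fun x hx => by simp [openPt, he, hx, hy]⟩
  choose y hy using this
  exact ⟨y, funext fun i => hy i y rfl⟩

lemma exists_openCoords_eq (ε : ι → Fin 2) (x : ι → L) :
    ∃ c : ι → L, (∀ i, c i ≠ 0) ∧
      openCoords ε x = fun jk => c jk.1 * homCoords (openPt ε x jk.1) jk.2 := by
  classical
  refine ⟨fun i => if ε i = 1 then 1 else if x i = 0 then 1 else x i, fun i => ?_, ?_⟩
  · dsimp only
    split_ifs <;> simp_all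
  · funext ⟨i, k⟩
    rcases (by lia : ε i = 0 ∨ ε i = 1) with he | he <;>
      rcases (by lia : k = 0 ∨ k = 1) with rfl | rfl <;> by_cases hx : x i = 0 <;>
      simp [openCoords, openPt, he, hx]

end OpenChart

section MultiHomogeneous

variable {L : Type} [Field L] {ι : Type} [DecidableEq ι]

/-- `p` is multihomogeneous of multidegree `d`. -/
def IsMultiHomogOf (d : ι → ℕ) (p : MvPolynomial (ι × Fin 2) L) : Prop :=
  ∀ i, p.IsWeightedHomogeneous (fun jk => if jk.1 = i then (1 : ℕ) else 0) (d i)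

lemma MultiHomog.exists_isMultiHomogOf {p : MvPolynomial (ι × Fin 2) L} (hp : MultiHomog p) :
    ∃ d, IsMultiHomogOf d p := by
  choose d hd using hp
  exact ⟨d, hd⟩

lemma IsMultiHomogOf.multiHomog {d : ι → ℕ} {p : MvPolynomial (ι × Fin 2) L}
    (hp : IsMultiHomogOf d p) : MultiHomog p := fun i => ⟨d i, hp i⟩

lemma IsMultiHomogOf.mul {d e : ι → ℕ} {p q : MvPolynomial (ι × Fin 2) L}
    (hp : IsMultiHomogOf d p) (hq : IsMultiHomogOf e q) : IsMultiHomogOf (d + e) (p * q) :=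
  fun i => (hp i).mul (hq i)

lemma MultiHomog.mul {p q : MvPolynomial (ι × Fin 2) L} (hp : MultiHomog p) (hq : MultiHomog q) :
    MultiHomog (p * q) := by
  obtain ⟨d, hd⟩ := hp.exists_isMultiHomogOf
  obtain ⟨e, he⟩ := hq.exists_isMultiHomogOf
  exact (hd.mul he).multiHomog

lemma isMultiHomogOf_X (i : ι) (k : Fin 2) :
    IsMultiHomogOf (Pi.single i 1) (MvPolynomial.X (i, k) : MvPolynomial (ι × Fin 2) L) := by
  intro l
  convert MvPolynomial.isWeightedHomogeneous_X L
    (fun jk : ι × Fin 2 => if jk.1 = l then (1 : ℕ) else 0) (i, k) using 1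
  simp [Pi.single_apply, eq_comm]

lemma isMultiHomogOf_C (c : L) :
    IsMultiHomogOf 0 (MvPolynomial.C c : MvPolynomial (ι × Fin 2) L) := fun l =>
  MvPolynomial.isWeightedHomogeneous_C (fun jk : ι × Fin 2 => if jk.1 = l then (1 : ℕ) else 0) c

lemma IsMultiHomogOf.pow {d : ι → ℕ} {p : MvPolynomial (ι × Fin 2) L}
    (hp : IsMultiHomogOf d p) (n : ℕ) : IsMultiHomogOf (n • d) (p ^ n) :=
  fun i => (hp i).pow n

lemma IsMultiHomogOf.prod {α : Type*} (s : Finset α) {d : α → ι → ℕ}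
    {p : α → MvPolynomial (ι × Fin 2) L} (hp : ∀ a ∈ s, IsMultiHomogOf (d a) (p a)) :
    IsMultiHomogOf (∑ a ∈ s, d a) (∏ a ∈ s, p a) := fun i => by
  rw [Finset.sum_apply]
  exact MvPolynomial.IsWeightedHomogeneous.prod s p (fun a => d a i) fun a ha => hp a ha i

lemma IsMultiHomogOf.sum {α : Type*} (s : Finset α) {d : ι → ℕ}
    {p : α → MvPolynomial (ι × Fin 2) L} (hp : ∀ a ∈ s, IsMultiHomogOf d (p a)) :
    IsMultiHomogOf d (∑ a ∈ s, p a) := fun i =>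
  MvPolynomial.IsWeightedHomogeneous.sum s p (d i) fun a ha => hp a ha i

lemma IsMultiHomogOf.map {L' : Type} [Field L'] (φ : L →+* L') {d : ι → ℕ}
    {p : MvPolynomial (ι × Fin 2) L} (hp : IsMultiHomogOf d p) :
    IsMultiHomogOf d (MvPolynomial.map φ p) := fun i => by
  intro m hm
  apply hp i
  rw [MvPolynomial.coeff_map] at hm
  exact fun h => hm (by rw [h, map_zero])

variable [Fintype ι]

lemma IsMultiHomogOf.sum_eq {d : ι → ℕ} {p : MvPolynomial (ι × Fin 2) L}
    (hp : IsMultiHomogOf d p) {m : ι × Fin 2 →₀ ℕ} (hm : m ∈ p.support) (i : ι) :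
    ∑ k, m (i, k) = d i := by
  have h := hp i (MvPolynomial.mem_support_iff.1 hm)
  rw [Finsupp.weight_apply, Finsupp.sum_fintype _ _ (by simp), Fintype.sum_prod_type,
    Finset.sum_eq_single i (fun j _ hj => by simp [hj]) (by simp)] at h
  simpa using h

lemma IsMultiHomogOf.eval_mul {d : ι → ℕ} {p : MvPolynomial (ι × Fin 2) L}
    (hp : IsMultiHomogOf d p) (c : ι → L) (u : ι × Fin 2 → L) :
    MvPolynomial.eval (fun jk => c jk.1 * u jk) p = (∏ i, c i ^ d i) * MvPolynomial.eval u p := by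
  rw [MvPolynomial.eval_eq', MvPolynomial.eval_eq', Finset.mul_sum]
  refine Finset.sum_congr rfl fun m hm => ?_
  simp only [mul_pow, Finset.prod_mul_distrib]
  have : ∏ jk : ι × Fin 2, c jk.1 ^ m jk = ∏ i, c i ^ d i := by
    rw [Fintype.prod_prod_type]
    refine Finset.prod_congr rfl fun i _ => ?_
    rw [← hp.sum_eq hm i]
    exact Finset.prod_pow_eq_pow_sum Finset.univ (fun k => m (i, k)) (c i)
  rw [this]
  ring

end MultiHomogeneous

section Homogenize

variable {L : Type} [Field L] {ι : Type}

/-- Homogenization of a polynomial on the chart given by `ε`. -/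
noncomputable def homog [Fintype ι] [DecidableEq ι] (ε : ι → Fin 2) (g : MvPolynomial ι L) :
    MvPolynomial (ι × Fin 2) L :=
  ∑ m ∈ g.support, MvPolynomial.C (g.coeff m) *
    ∏ i, (MvPolynomial.X (i, 1 - ε i) ^ m i * MvPolynomial.X (i, ε i) ^ (g.degreeOf i - m i))

/-- Dehomogenization of a polynomial on the chart given by `ε`. -/
noncomputable def dehomog (L : Type) [Field L] {ι : Type} (ε : ι → Fin 2) :
    MvPolynomial (ι × Fin 2) L →ₐ[L] MvPolynomial ι L :=
  MvPolynomial.aeval fun jk => if jk.2 = ε jk.1 then 1 else MvPolynomial.X jk.1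

lemma eval_dehomog (ε : ι → Fin 2) (p : MvPolynomial (ι × Fin 2) L) (x : ι → L) :
    MvPolynomial.eval x (dehomog L ε p) = MvPolynomial.eval (openCoords ε x) p := by
  have h : (MvPolynomial.eval x).comp (dehomog L ε : _ →+* _) =
      MvPolynomial.eval (openCoords ε x) := by
    apply MvPolynomial.ringHom_ext
    · intro r
      simp [dehomog]
    · rintro ⟨i, k⟩
      by_cases hk : k = ε i <;> simp [dehomog, openCoords, hk]
  exact DFunLike.congr_fun h p

variable [DecidableEq ι]

lemma vanishesAt_X_iff (i : ι) (k : Fin 2) (t : ι → OnePoint L) :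
    vanishesAt (RingHom.id L) (MvPolynomial.X (i, k)) t ↔ homCoords (t i) k = 0 := by
  simp [vanishesAt]

lemma vanishesAt_mul (p q : MvPolynomial (ι × Fin 2) L) (t : ι → OnePoint L) :
    vanishesAt (RingHom.id L) (p * q) t ↔
      vanishesAt (RingHom.id L) p t ∨ vanishesAt (RingHom.id L) q t := by
  simp [vanishesAt]

variable [Fintype ι]

lemma isMultiHomogOf_homog (ε : ι → Fin 2) (g : MvPolynomial ι L) :
    IsMultiHomogOf (fun i => g.degreeOf i) (homog ε g) := by
  refine IsMultiHomogOf.sum _ fun m hm => ?_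
  convert (isMultiHomogOf_C (g.coeff m)).mul (IsMultiHomogOf.prod Finset.univ fun i _ =>
    ((isMultiHomogOf_X (L := L) i (1 - ε i)).pow (m i)).mul
      ((isMultiHomogOf_X i (ε i)).pow (g.degreeOf i - m i))) using 1
  funext l
  have hle : m l ≤ g.degreeOf l := MvPolynomial.monomial_le_degreeOf l hm
  simp [Finset.sum_apply, Pi.single_apply, Finset.sum_add_distrib]
  omega

lemma multiHomog_homog (ε : ι → Fin 2) (g : MvPolynomial ι L) : MultiHomog (homog ε g) :=
  (isMultiHomogOf_homog ε g).multiHomog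

lemma eval_homog (ε : ι → Fin 2) (g : MvPolynomial ι L) {u : ι × Fin 2 → L}
    (hu : ∀ i, g.degreeOf i ≠ 0 → u (i, ε i) = 1) :
    MvPolynomial.eval u (homog ε g) = MvPolynomial.eval (fun i => u (i, 1 - ε i)) g := by
  rw [homog, map_sum, MvPolynomial.eval_eq']
  refine Finset.sum_congr rfl fun m hm => ?_
  rw [map_mul, MvPolynomial.eval_C, map_prod]
  congr 1
  refine Finset.prod_congr rfl fun i _ => ?_
  have hle : m i ≤ g.degreeOf i := MvPolynomial.monomial_le_degreeOf i hm
  rw [map_mul, map_pow, map_pow, MvPolynomial.eval_X, MvPolynomial.eval_X]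
  by_cases h : g.degreeOf i = 0
  · rw [h, Nat.zero_sub, pow_zero, mul_one]
  · rw [hu i h, one_pow, mul_one]

lemma eval_openCoords_homog (ε : ι → Fin 2) (g : MvPolynomial ι L) (x : ι → L) :
    MvPolynomial.eval (openCoords ε x) (homog ε g) = MvPolynomial.eval x g := by
  rw [eval_homog ε g fun i _ => by simp [openCoords]]
  congr 2
  funext i
  have : 1 - ε i ≠ ε i := by lia
  simp [openCoords, this]

lemma IsMultiHomogOf.vanishesAt_openPt {d : ι → ℕ} {p : MvPolynomial (ι × Fin 2) L}
    (hp : IsMultiHomogOf d p) (ε : ι → Fin 2) (x : ι → L) :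
    vanishesAt (RingHom.id L) p (openPt ε x) ↔ MvPolynomial.eval (openCoords ε x) p = 0 := by
  obtain ⟨c, hc, h⟩ := exists_openCoords_eq ε x
  rw [h, hp.eval_mul c, mul_eq_zero, vanishesAt, MvPolynomial.map_id,
    or_iff_right (Finset.prod_ne_zero_iff.2 fun i _ => pow_ne_zero _ (hc i))]

lemma IsMultiHomogOf.eval_eq_of_ne_zero {d : ι → ℕ} {p : MvPolynomial (ι × Fin 2) L}
    (hp : IsMultiHomogOf d p) {ε : ι → Fin 2} {u : ι × Fin 2 → L} (hu : ∀ i, u (i, ε i) ≠ 0) :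
    MvPolynomial.eval u p = (∏ i, u (i, ε i) ^ d i) *
      MvPolynomial.eval (openCoords ε fun i => u (i, 1 - ε i) / u (i, ε i)) p := by
  rw [← hp.eval_mul (fun i => u (i, ε i))]
  congr 2
  funext ⟨i, k⟩
  rcases (by lia : k = ε i ∨ k = 1 - ε i) with rfl | rfl
  · simp [openCoords]
  · have : 1 - ε i ≠ ε i := by lia
    simp only [openCoords, this, if_false]
    rw [mul_div_cancel₀ _ (hu i)]

/-- Two multihomogeneous polynomials of the same multidegree which agree on a chart are equal. -/
lemma IsMultiHomogOf.eq_of_openCoords [Infinite L] {d : ι → ℕ} {p q : MvPolynomial (ι × Fin 2) L}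
    (hp : IsMultiHomogOf d p) (hq : IsMultiHomogOf d q) (ε : ι → Fin 2)
    (h : ∀ x, MvPolynomial.eval (openCoords ε x) p = MvPolynomial.eval (openCoords ε x) q) :
    p = q := by
  have h0 : (∏ i, MvPolynomial.X (i, ε i) : MvPolynomial (ι × Fin 2) L) ≠ 0 :=
    Finset.prod_ne_zero_iff.2 fun i _ => MvPolynomial.X_ne_zero _
  refine mul_right_cancel₀ h0 (MvPolynomial.funext fun u => ?_)
  simp only [map_mul, map_prod, MvPolynomial.eval_X]
  by_cases hu : ∀ i, u (i, ε i) ≠ 0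
  · rw [hp.eval_eq_of_ne_zero hu, hq.eval_eq_of_ne_zero hu, h]
  · push Not at hu
    obtain ⟨i, hi⟩ := hu
    rw [Finset.prod_eq_zero (Finset.mem_univ i) hi, mul_zero, mul_zero]

lemma IsMultiHomogOf.eq_zero_of_openCoords [Infinite L] {d : ι → ℕ}
    {p : MvPolynomial (ι × Fin 2) L} (hp : IsMultiHomogOf d p) (ε : ι → Fin 2)
    (h : ∀ x, MvPolynomial.eval (openCoords ε x) p = 0) : p = 0 :=
  hp.eq_of_openCoords (fun i => MvPolynomial.isWeightedHomogeneous_zero _ _ _) ε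
    fun x => by rw [h, map_zero]

end Homogenize

section Irreducible

variable {L : Type} [Field L] {ι : Type} [DecidableEq ι]

lemma isZarClosed_vanishesAt {p : MvPolynomial (ι × Fin 2) L} (hp : MultiHomog p) :
    IsZarClosed {t | vanishesAt (RingHom.id L) p t} :=
  ⟨⟨{p}, by simpa using hp⟩, by ext; simp [ClosedSubvar.pts]⟩

lemma IrrSubvar.vanishesAt_or {T : Set (ι → OnePoint L)} (hT : IrrSubvar T)
    {p q : MvPolynomial (ι × Fin 2) L} (hp : MultiHomog p) (hq : MultiHomog q)
    (h : ∀ t ∈ T, vanishesAt (RingHom.id L) p t ∨ vanishesAt (RingHom.id L) q t) :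
    (∀ t ∈ T, vanishesAt (RingHom.id L) p t) ∨ ∀ t ∈ T, vanishesAt (RingHom.id L) q t :=
  hT.2.2 _ _ (isZarClosed_vanishesAt hp) (isZarClosed_vanishesAt hq) h

lemma IrrSubvar.exists_vanishesAt {T : Set (ι → OnePoint L)} (hT : IrrSubvar T) {α : Type*}
    (s : Finset α) {p : α → MvPolynomial (ι × Fin 2) L} (hp : ∀ a ∈ s, MultiHomog (p a))
    (h : ∀ t ∈ T, ∃ a ∈ s, vanishesAt (RingHom.id L) (p a) t) :
    ∃ a ∈ s, ∀ t ∈ T, vanishesAt (RingHom.id L) (p a) t := by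
  classical
  induction s using Finset.induction_on with
  | empty =>
    obtain ⟨t, ht⟩ := hT.1
    simpa using h t ht
  | insert a s ha ih =>
    rcases hT.2.2 {t | vanishesAt (RingHom.id L) (p a) t}
      {t | vanishesAt (RingHom.id L) (∏ b ∈ s, p b) t}
      (isZarClosed_vanishesAt (hp a (Finset.mem_insert_self a s))) (by
        choose! d hd using fun b hb => (hp b (Finset.mem_insert_of_mem hb)).exists_isMultiHomogOf
        exact isZarClosed_vanishesAt (IsMultiHomogOf.prod s hd).multiHomog)
      (fun t ht => by
        obtain ⟨b, hb, hbt⟩ := h t ht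
        rcases Finset.mem_insert.1 hb with rfl | hb
        · exact Or.inl hbt
        · right
          simp only [Set.mem_ofPred_eq, vanishesAt, map_prod]
          exact Finset.prod_eq_zero hb hbt) with h1 | h1
    · exact ⟨a, Finset.mem_insert_self _ _, h1⟩
    · obtain ⟨b, hb, hbT⟩ := ih (fun b hb => hp b (Finset.mem_insert_of_mem hb)) fun t ht => by
        have h2 := h1 ht
        simp only [Set.mem_ofPred_eq, vanishesAt, map_prod, Finset.prod_eq_zero_iff] at h2
        exact h2
      exact ⟨b, Finset.mem_insert_of_mem hb, hbT⟩

end Irreducible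

section ChartIdeal

variable {L : Type} [Field L] {ι : Type}

lemma mem_vanishingIdeal_self_iff {S : Set (ι → L)} {p : MvPolynomial ι L} :
    p ∈ MvPolynomial.vanishingIdeal L S ↔ ∀ x ∈ S, MvPolynomial.eval x p = 0 := Iff.rfl

variable [DecidableEq ι] [Fintype ι]

namespace IrrSubvar

variable {T : Set (ι → OnePoint L)} {ε : ι → Fin 2}

lemma vanishesAt_iff (hT : IrrSubvar T) (hε : ∃ t ∈ T, ∀ i, homCoords (t i) (ε i) ≠ 0)
    {p : MvPolynomial (ι × Fin 2) L} (hp : MultiHomog p) :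
    (∀ t ∈ T, vanishesAt (RingHom.id L) p t) ↔
      dehomog L ε p ∈ MvPolynomial.vanishingIdeal L {x | openPt ε x ∈ T} := by
  obtain ⟨d, hd⟩ := hp.exists_isMultiHomogOf
  rw [mem_vanishingIdeal_self_iff]
  constructor
  · intro h x hx
    rw [eval_dehomog, ← hd.vanishesAt_openPt]
    exact h _ hx
  · intro h
    refine (hT.vanishesAt_or hp
      (IsMultiHomogOf.prod Finset.univ fun i _ => isMultiHomogOf_X i (ε i)).multiHomog
      fun t ht => ?_).resolve_right ?_
    · by_cases hte : ∀ i, homCoords (t i) (ε i) ≠ 0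
      · left
        obtain ⟨x, rfl⟩ := exists_eq_openPt hte
        rw [hd.vanishesAt_openPt, ← eval_dehomog]
        exact h x ht
      · right
        push Not at hte
        obtain ⟨i, hi⟩ := hte
        simp only [vanishesAt, map_prod]
        exact Finset.prod_eq_zero (Finset.mem_univ i) (by simpa using hi)
    · obtain ⟨t, ht, hte⟩ := hε
      intro h
      have h1 := h t ht
      simp only [vanishesAt, map_prod, Finset.prod_eq_zero_iff] at h1
      obtain ⟨i, -, hi⟩ := h1
      exact hte i (by simpa using hi)

lemma mem_vanishingIdeal_iff_homog (hT : IrrSubvar T)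
    (hε : ∃ t ∈ T, ∀ i, homCoords (t i) (ε i) ≠ 0) (g : MvPolynomial ι L) :
    g ∈ MvPolynomial.vanishingIdeal L {x | openPt ε x ∈ T} ↔
      ∀ t ∈ T, vanishesAt (RingHom.id L) (homog ε g) t := by
  rw [hT.vanishesAt_iff hε (multiHomog_homog ε g), mem_vanishingIdeal_self_iff,
    mem_vanishingIdeal_self_iff]
  simp only [eval_dehomog, eval_openCoords_homog]

lemma isPrime_vanishingIdeal (hT : IrrSubvar T)
    (hε : ∃ t ∈ T, ∀ i, homCoords (t i) (ε i) ≠ 0) :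
    (MvPolynomial.vanishingIdeal L {x | openPt ε x ∈ T}).IsPrime := by
  refine ⟨fun h => ?_, fun {g h} hgh => ?_⟩
  · obtain ⟨t, ht, hte⟩ := hε
    obtain ⟨x, rfl⟩ := exists_eq_openPt hte
    have := (Ideal.eq_top_iff_one _).1 h
    rw [mem_vanishingIdeal_self_iff] at this
    simpa using this x ht
  · rw [hT.mem_vanishingIdeal_iff_homog hε, hT.mem_vanishingIdeal_iff_homog hε]
    have h1 := ((multiHomog_homog ε g).mul (multiHomog_homog ε h))
    refine hT.vanishesAt_or (multiHomog_homog ε g) (multiHomog_homog ε h) ?_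
    simp only [← vanishesAt_mul]
    rw [hT.vanishesAt_iff hε h1]
    rw [mem_vanishingIdeal_self_iff] at hgh ⊢
    intro x hx
    have := hgh x hx
    simp only [eval_dehomog, map_mul,
      eval_openCoords_homog] at this ⊢
    exact this

lemma vanishingIdeal_lt {T' : Set (ι → OnePoint L)} (hT : IrrSubvar T) (hT' : IrrSubvar T')
    (hε : ∃ t ∈ T, ∀ i, homCoords (t i) (ε i) ≠ 0) (hlt : T ⊂ T') :
    MvPolynomial.vanishingIdeal L {x | openPt ε x ∈ T'} <
      MvPolynomial.vanishingIdeal L {x | openPt ε x ∈ T} := by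
  refine lt_of_le_not_ge (fun g hg => ?_) fun hle => hlt.2 fun t ht => ?_
  · rw [mem_vanishingIdeal_self_iff] at hg ⊢
    exact fun x hx => hg x (hlt.1 hx)
  · have hε' : ∃ t ∈ T', ∀ i, homCoords (t i) (ε i) ≠ 0 := hε.imp fun t h => ⟨hlt.1 h.1, h.2⟩
    obtain ⟨V, hV⟩ := hT.2.1
    rw [hV]
    intro p hp
    refine (hT'.vanishesAt_iff hε' (V.homog p hp)).2 (hle ?_) t ht
    rw [← hT.vanishesAt_iff hε (V.homog p hp)]
    intro u hu
    rw [hV] at hu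
    exact hu p hp

end IrrSubvar

/-- On a chart, an irreducible proper subvariety of codimension one is contained in an irreducible
hypersurface whose equation divides all the equations of the subvariety. -/
theorem exists_irreducible_forall_dvd_dehomog [Nonempty ι] {S : Set (ι → OnePoint L)}
    (hdim : varDim S = ((Fintype.card ι - 1 : ℕ) : ℕ∞))
    {p₀ : MvPolynomial (ι × Fin 2) L} (hp₀ : MultiHomog p₀) (hp₀0 : ∀ ε, dehomog L ε p₀ ≠ 0)
    (hp₀S : ∀ t ∈ S, vanishesAt (RingHom.id L) p₀ t) :
    ∃ (ε : ι → Fin 2) (t : ι → OnePoint L) (F : MvPolynomial ι L), t ∈ S ∧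
      (∀ i, ε i = 0 ↔ t i = ∞) ∧ Irreducible F ∧
      ∀ p, MultiHomog p → (∀ t ∈ S, vanishesAt (RingHom.id L) p t) → F ∣ dehomog L ε p := by
  classical
  obtain ⟨l, hl⟩ := Order.le_krullDim_iff.1 hdim.ge
  obtain ⟨t, ht⟩ := l.head.2.1.1
  set ε : ι → Fin 2 := fun i => if t i = ∞ then 0 else 1 with hεd
  have hte : ∀ i, homCoords (t i) (ε i) ≠ 0 := by
    intro i
    by_cases h : t i = ∞
    · simp [hεd, h]
    · obtain ⟨y, hy⟩ := OnePoint.ne_infty_iff_exists.1 h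
      simp [hεd, ← hy]
  have hε : ∀ i, ∃ t ∈ (l i).1, ∀ i, homCoords (t i) (ε i) ≠ 0 := fun i =>
    ⟨t, l.head_le i ht, hte⟩
  have hstrict : StrictMono fun i : Fin (l.length + 1) =>
      (⟨MvPolynomial.vanishingIdeal L {x | openPt ε x ∈ (l i.rev).1},
        (l i.rev).2.1.isPrime_vanishingIdeal (hε _)⟩ : PrimeSpectrum (MvPolynomial ι L)) := by
    intro i j hij
    exact IrrSubvar.vanishingIdeal_lt (l j.rev).2.1 (l i.rev).2.1 (hε _)
      (l.strictMono (Fin.rev_lt_rev.2 hij))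
  set c : LTSeries (PrimeSpectrum (MvPolynomial ι L)) := LTSeries.mk l.length _ hstrict with hc
  have hcm : ∀ p, MultiHomog p → (∀ t ∈ S, vanishesAt (RingHom.id L) p t) →
      dehomog L ε p ∈ c.head.asIdeal := fun p hp hpS =>
    ((l (Fin.rev 0)).2.1.vanishesAt_iff (hε _) hp).1 fun t ht => hpS t ((l (Fin.rev 0)).2.2 ht)
  have hne : c.head.asIdeal ≠ ⊥ := fun h => hp₀0 ε (by
    have := hcm p₀ hp₀ hp₀S
    rwa [h, Ideal.mem_bot] at this)
  obtain ⟨F, hFm, hF⟩ := c.head.2.exists_mem_prime_of_ne_bot hne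
  have hFp : (Ideal.span {F}).IsPrime := (Ideal.span_singleton_prime hF.ne_zero).2 hF
  refine ⟨ε, t, F, l.head.2.2 ht, fun i => by by_cases h : t i = ∞ <;> simp [hεd, h],
    hF.irreducible, fun p hp hpS => ?_⟩
  by_contra hdvd
  have hlt : (⟨Ideal.span {F}, hFp⟩ : PrimeSpectrum (MvPolynomial ι L)) < c.head := by
    refine lt_of_le_not_ge ((Ideal.span_singleton_le_iff_mem _).2 hFm) fun h => hdvd ?_
    exact Ideal.mem_span_singleton.1 (h (hcm p hp hpS))
  have hbot : (⊥ : PrimeSpectrum (MvPolynomial ι L)) < (c.cons _ hlt).head := by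
    rw [RelSeries.head_cons]
    refine lt_of_le_not_ge bot_le fun h => hF.ne_zero ?_
    have : F ∈ (⊥ : Ideal (MvPolynomial ι L)) := h (Ideal.mem_span_singleton_self F)
    simpa using this
  have hlen := Order.LTSeries.length_le_krullDim ((c.cons _ hlt).cons _ hbot)
  have hn := MvPolynomial.ringKrullDim_of_isNoetherianRing (R := L) (ι := ι)
  rw [ringKrullDim_eq_zero_of_field, zero_add, Nat.card_eq_fintype_card] at hn
  rw [ringKrullDim] at hn
  rw [hn] at hlen
  have hpos := Fintype.card_pos (α := ι)
  simp only [RelSeries.cons_length] at hlen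
  norm_cast at hlen
  have : c.length = l.length := rfl
  have hl' : l.length = Fintype.card ι - 1 := by exact_mod_cast hl
  omega

end ChartIdeal

section Homogenize

variable {L : Type} [Field L] {ι : Type} [DecidableEq ι] [Fintype ι]

lemma homog_map {K : Type} [Field K] (φ : K →+* L) (ε : ι → Fin 2) (g : MvPolynomial ι K) :
    homog ε (MvPolynomial.map φ g) = MvPolynomial.map φ (homog ε g) := by
  have hs : (MvPolynomial.map φ g).support = g.support :=
    MvPolynomial.support_map_of_injective g φ.injective
  have hd : ∀ i, (MvPolynomial.map φ g).degreeOf i = g.degreeOf i := fun i => by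
    rw [MvPolynomial.degreeOf_eq_sup, MvPolynomial.degreeOf_eq_sup, hs]
  simp only [homog, hs, hd, map_sum, map_mul, map_prod, map_pow, MvPolynomial.map_X,
    MvPolynomial.map_C, MvPolynomial.coeff_map]

lemma IsMultiHomogOf.degreeOf_dehomog_le {d : ι → ℕ} {p : MvPolynomial (ι × Fin 2) L}
    (hp : IsMultiHomogOf d p) (ε : ι → Fin 2) (w : ι) :
    (dehomog L ε p).degreeOf w ≤ d w := by
  conv_lhs => rw [p.as_sum]
  rw [map_sum]
  refine (MvPolynomial.degreeOf_sum_le _ _ _).trans (Finset.sup_le fun m hm => ?_)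
  rw [dehomog, MvPolynomial.aeval_monomial, MvPolynomial.algebraMap_eq]
  refine (MvPolynomial.degreeOf_C_mul_le _ _ _).trans ?_
  rw [Finsupp.prod_fintype _ _ (by simp)]
  refine (MvPolynomial.degreeOf_prod_le _ _ _).trans ?_
  rw [← hp.sum_eq hm w, Fintype.sum_prod_type]
  rw [Finset.sum_eq_single w (fun i _ hi => Finset.sum_eq_zero fun k _ => ?_) (by simp)]
  · refine Finset.sum_le_sum fun k _ => (MvPolynomial.degreeOf_pow_le _ _ _).trans ?_
    split_ifs with h
    · simp
    · simp
  · refine Nat.le_zero.1 ((MvPolynomial.degreeOf_pow_le _ _ _).trans ?_)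
    split_ifs with h
    · simp
    · simp [MvPolynomial.degreeOf_X, hi.symm]

lemma IsMultiHomogOf.homog_dvd [Infinite L] {d : ι → ℕ} {p : MvPolynomial (ι × Fin 2) L}
    (hp : IsMultiHomogOf d p) {ε : ι → Fin 2} {g : MvPolynomial ι L} (h : g ∣ dehomog L ε p) :
    homog ε g ∣ p := by
  obtain ⟨r, hr⟩ := h
  by_cases h0 : dehomog L ε p = 0
  · rw [hp.eq_zero_of_openCoords ε fun x => by rw [← eval_dehomog, h0, map_zero]]
    exact dvd_zero _
  · have hg : g ≠ 0 := fun h => h0 (by rw [hr, h, zero_mul])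
    have hr0 : r ≠ 0 := fun h => h0 (by rw [hr, h, mul_zero])
    have hdeg : ∀ i, g.degreeOf i + r.degreeOf i ≤ d i := fun i => by
      rw [← MvPolynomial.degreeOf_mul_eq hg hr0, ← hr]
      exact hp.degreeOf_dehomog_le ε i
    refine ⟨homog ε r * ∏ i, MvPolynomial.X (i, ε i) ^ (d i - (g.degreeOf i + r.degreeOf i)), ?_⟩
    refine hp.eq_of_openCoords ?_ ε fun x => ?_
    · convert (isMultiHomogOf_homog ε g).mul ((isMultiHomogOf_homog ε r).mul
        (IsMultiHomogOf.prod Finset.univ fun i _ => (isMultiHomogOf_X i (ε i)).pow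
          (d i - (g.degreeOf i + r.degreeOf i)))) using 1
      funext l
      simp [Finset.sum_apply, Pi.single_apply]
      have := hdeg l
      omega
    · rw [← eval_dehomog, hr]
      simp [eval_openCoords_homog, map_mul, map_prod, map_pow, openCoords]

lemma MultiHomog.dehomog_ne_zero [Infinite L] {p : MvPolynomial (ι × Fin 2) L}
    (hp : MultiHomog p) (hp0 : p ≠ 0) (ε : ι → Fin 2) : dehomog L ε p ≠ 0 := fun h => by
  obtain ⟨d, hd⟩ := hp.exists_isMultiHomogOf
  exact hp0 (hd.eq_zero_of_openCoords ε fun x => by rw [← eval_dehomog, h, map_zero])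

lemma homog_ne_zero [Infinite L] (ε : ι → Fin 2) {g : MvPolynomial ι L} (hg : g ≠ 0) :
    homog ε g ≠ 0 := fun h => hg (MvPolynomial.funext fun x => by
  rw [← eval_openCoords_homog ε, h, map_zero, map_zero])

end Homogenize

section MonicHomog

variable {K : Type} [Field K] {ι : Type} [DecidableEq ι]

lemma coeff_coeff_mainPoly (j : ι) (p : MvPolynomial ι K) (m : ι →₀ ℕ) :
    ((mainPoly K j p).coeff (m j)).coeff (m.comapDomain Subtype.val Subtype.val_injective.injOn) =
      p.coeff m := by
  have hn : (m.mapDomain (Equiv.optionSubtypeNe j).symm) none = m j := by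
    rw [← Equiv.optionSubtypeNe_symm_self j,
      Finsupp.mapDomain_apply (Equiv.optionSubtypeNe j).symm.injective]
  have hs : (m.mapDomain (Equiv.optionSubtypeNe j).symm).some =
      m.comapDomain (Subtype.val : {i // i ≠ j} → ι) Subtype.val_injective.injOn := by
    ext ⟨i, hi⟩
    rw [Finsupp.some_apply, ← Equiv.optionSubtypeNe_symm_of_ne hi,
      Finsupp.mapDomain_apply (Equiv.optionSubtypeNe j).symm.injective]
    rfl
  rw [← hn, ← hs]
  unfold mainPoly
  refine (MvPolynomial.optionEquivLeft_coeff_some_coeff_none _ _ _ _).trans ?_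
  exact MvPolynomial.coeff_rename_mapDomain _ (Equiv.optionSubtypeNe j).symm.injective _ _

lemma MonicIn.exists_coeff {j : ι} {p : MvPolynomial ι K} (hp : MonicIn j p) :
    p.coeff (Finsupp.single j (p.degreeOf j)) ≠ 0 ∧
      ∀ m ∈ p.support, m j = p.degreeOf j → m = Finsupp.single j (p.degreeOf j) := by
  obtain ⟨c, hc, hc'⟩ := MvPolynomial.isUnit_iff_eq_C_of_isReduced.1 hp
  rw [leadingCoeff, natDegree_mainPoly] at hc'
  constructor
  · rw [← coeff_coeff_mainPoly j, Finsupp.single_eq_same, hc']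
    have : Finsupp.comapDomain (Subtype.val : {i // i ≠ j} → ι)
      (Finsupp.single j (p.degreeOf j)) Subtype.val_injective.injOn = 0 := by
      ext ⟨i, hi⟩
      simp
    rw [this, MvPolynomial.coeff_C, if_pos rfl]
    exact hc.ne_zero
  · intro m hm hmj
    rw [MvPolynomial.mem_support_iff, ← coeff_coeff_mainPoly j, hmj, hc',
      MvPolynomial.coeff_C] at hm
    have h0 : 0 = Finsupp.comapDomain (Subtype.val : {i // i ≠ j} → ι) m
      Subtype.val_injective.injOn := by
      by_contra h
      exact hm (if_neg h)
    ext i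
    rcases eq_or_ne i j with rfl | hi
    · simp [hmj]
    · have := DFunLike.congr_fun h0 ⟨i, hi⟩
      simpa [Finsupp.single_apply, hi.symm] using this.symm

/-- At points with `i`-th coordinate `∞`, only the leading coefficient in the variable `i`
contributes to a polynomial which is monic in that variable. -/
lemma MonicIn.eval₂_homog [Fintype ι] {L : Type} [Field L] (φ : K →+* L) {i : ι}
    {p : MvPolynomial ι K} (hp : MonicIn i p) {u : ι × Fin 2 → L}
    (h0 : u (i, 0) = 1) (h1 : u (i, 1) = 0) :
    MvPolynomial.eval₂ φ u (homog (fun _ => 1) p) =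
      φ (p.coeff (Finsupp.single i (p.degreeOf i))) *
        ∏ l ∈ Finset.univ.erase i, u (l, 1) ^ p.degreeOf l := by
  obtain ⟨hc, hp⟩ := hp.exists_coeff
  rw [homog, MvPolynomial.eval₂_sum, Finset.sum_eq_single (Finsupp.single i (p.degreeOf i))]
  · rw [MvPolynomial.eval₂_mul, MvPolynomial.eval₂_C, MvPolynomial.eval₂_prod,
      ← Finset.mul_prod_erase _ _ (Finset.mem_univ i)]
    simp [h0, MvPolynomial.eval₂_mul, MvPolynomial.eval₂_pow]
    left
    refine Finset.prod_congr rfl fun l hl => ?_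
    simp [(Finset.ne_of_mem_erase hl).symm]
  · intro m hm hne
    rw [MvPolynomial.eval₂_mul, MvPolynomial.eval₂_prod,
      Finset.prod_eq_zero (Finset.mem_univ i), mul_zero]
    have hlt : m i ≠ p.degreeOf i := fun h => hne (hp m hm h)
    have hle : m i ≤ p.degreeOf i := MvPolynomial.monomial_le_degreeOf i hm
    simp only [MvPolynomial.eval₂_mul, MvPolynomial.eval₂_pow, MvPolynomial.eval₂_X, h1]
    rw [zero_pow (by omega), mul_zero]
  · intro h
    exact absurd (MvPolynomial.notMem_support_iff.1 h) hc

end MonicHomog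

section Preperiodic

variable {L : Type} [Field L] {ι : Type}

lemma exists_eq_chartPt_of_splitMap {f : L[X]} {M : Set ι} {t : ι → OnePoint L} {s : ℕ}
    {z : ι → L} (h : (splitMap f)^[s] t = chartPt M z) :
    ∃ x, t = chartPt M x ∧ ∀ i ∉ M, (f.eval)^[s] (x i) = z i := by
  obtain ⟨x, -, hx⟩ := exists_eq_chartPt t
  set M' := {i | t i = ∞}
  rw [hx, splitMap_iterate_chartPt] at h
  have hM : M' = M := by
    ext i
    have := congr_fun h i
    by_cases h1 : i ∈ M' <;> by_cases h2 : i ∈ M <;> simp_all [chartPt]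
  rw [hM] at h hx
  refine ⟨x, hx, fun i hi => ?_⟩
  have := congr_fun h i
  simpa [chartPt, hi] using this

/-- For a preperiodic set, the images of a stratum under the iterates are eventually periodic. -/
lemma SubvarPreperiodic.exists_iterate_eq {f : L[X]} {S : Set (ι → OnePoint L)}
    (h : SubvarPreperiodic f S) : ∃ m k : ℕ, 1 ≤ m ∧ ∀ (M : Set ι) (x : ι → L),
      chartPt M x ∈ S → (∃ y, chartPt M y ∈ S ∧
        ∀ i ∉ M, (f.eval)^[m + m * k] (y i) = (f.eval)^[m * k] (x i)) ∧
      ∃ y, chartPt M y ∈ S ∧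
        ∀ i ∉ M, (f.eval)^[m * k] (y i) = (f.eval)^[m + m * k] (x i) := by
  obtain ⟨k, m, hm, hk⟩ := h
  have hle : k ≤ m * k := Nat.le_mul_of_pos_left k hm
  have key : (splitMap f)^[m + m * k] '' S = (splitMap f)^[m * k] '' S := by
    obtain ⟨e, he⟩ := Nat.exists_eq_add_of_le hle
    rw [he, show m + (k + e) = e + (m + k) by ring, add_comm k e]
    simp only [Function.iterate_add, Set.image_comp] at hk ⊢
    rw [hk]
  refine ⟨m, k, hm, fun M x hx => ⟨?_, ?_⟩⟩
  · have : (splitMap f)^[m * k] (chartPt M x) ∈ (splitMap f)^[m + m * k] '' S :=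
      key ▸ Set.mem_image_of_mem _ hx
    obtain ⟨t, ht, he⟩ := this
    rw [splitMap_iterate_chartPt] at he
    obtain ⟨y, rfl, hy⟩ := exists_eq_chartPt_of_splitMap he
    exact ⟨y, ht, hy⟩
  · have : (splitMap f)^[m + m * k] (chartPt M x) ∈ (splitMap f)^[m * k] '' S :=
      key ▸ Set.mem_image_of_mem _ hx
    obtain ⟨t, ht, he⟩ := this
    rw [splitMap_iterate_chartPt] at he
    obtain ⟨y, rfl, hy⟩ := exists_eq_chartPt_of_splitMap he
    exact ⟨y, ht, hy⟩

end Preperiodic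

section Hypersurface

variable {K : Type} [Field K] {ι : Type} [DecidableEq ι]

lemma vanishesAt_map {L : Type} [Field L] (φ : K →+* L) (p : MvPolynomial (ι × Fin 2) K)
    (t : ι → OnePoint L) :
    vanishesAt (RingHom.id L) (MvPolynomial.map φ p) t ↔ vanishesAt φ p t := by
  rw [vanishesAt, vanishesAt, MvPolynomial.map_id]

lemma MultiHomog.map {L : Type} [Field L] (φ : K →+* L) {p : MvPolynomial (ι × Fin 2) K}
    (hp : MultiHomog p) : MultiHomog (MvPolynomial.map φ p) := by
  obtain ⟨d, hd⟩ := hp.exists_isMultiHomogOf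
  exact (hd.map φ).multiHomog

lemma chartPt_mem_pts_iff {L : Type} [Field L] (φ : K →+* L) (V : ClosedSubvar K ι) (M : Set ι)
    (x : ι → K) : chartPt M (fun i => φ (x i)) ∈ V.pts φ ↔ chartPt M x ∈ V.pts (RingHom.id K) := by
  refine forall₂_congr fun p hp => ?_
  rw [vanishesAt_chartPt, vanishesAt_chartPt, MvPolynomial.eval₂_id, ← map_eq_zero φ,
    MvPolynomial.map_eval φ, MvPolynomial.eval_map]
  rfl

/-- A prime ideal is principal if it does not contain nonzero polynomials avoiding any given
variable. -/
lemma exists_irreducible_of_isPrime [Finite ι] {𝔮 : Ideal (MvPolynomial ι K)} (hq : 𝔮.IsPrime)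
    (h0 : 𝔮 ≠ ⊥) (hw : ¬ ∀ w, ∃ R ∈ 𝔮, R ≠ 0 ∧ R.degreeOf w = 0) :
    ∃ F, Irreducible F ∧ ∀ g, g ∈ 𝔮 ↔ F ∣ g := by
  obtain ⟨F, hF, hFp⟩ := hq.exists_mem_prime_of_ne_bot h0
  refine ⟨F, hFp.irreducible, fun g => ⟨fun hg => ?_, fun ⟨r, hr⟩ => hr ▸ 𝔮.mul_mem_right r hF⟩⟩
  by_contra hdvd
  refine hw fun w => ?_
  obtain ⟨R, hR0, hRw, A, B, hR⟩ := MvPolynomial.exists_elimination hFp.irreducible hdvd w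
  exact ⟨R, hR ▸ 𝔮.add_mem (𝔮.mul_mem_left A hF) (𝔮.mul_mem_left B hg), hR0, hRw⟩

variable [Fintype ι] [Infinite K]

/-- A proper hypersurface is not contained in the zero loci of a family of nonzero polynomials each
avoiding one of the variables. -/
lemma not_forall_exists_degreeOf_eq_zero {S : Set (ι → OnePoint K)} (hS : IrrSubvar S)
    (hfin : ∃ t ∈ S, ∀ i, homCoords (t i) 1 ≠ 0) {ε : ι → Fin 2} {F : MvPolynomial ι K}
    (hF : Irreducible F)
    (hdvd : ∀ p, MultiHomog p → (∀ t ∈ S, vanishesAt (RingHom.id K) p t) → F ∣ dehomog K ε p) :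
    ¬ ∀ w, ∃ R ∈ MvPolynomial.vanishingIdeal K {x | chartPt ∅ x ∈ S}, R ≠ 0 ∧
      R.degreeOf w = 0 := by
  intro h
  have hdeg : ∀ w, F.degreeOf w = 0 := by
    intro w
    obtain ⟨R, hR, hR0, hRw⟩ := h w
    simp only [← openPt_one] at hR
    rw [hS.mem_vanishingIdeal_iff_homog hfin] at hR
    obtain ⟨r, hr⟩ := hdvd _ (multiHomog_homog _ R) hR
    have h1 := (isMultiHomogOf_homog (fun _ => 1) R).degreeOf_dehomog_le ε w
    have h2 := (multiHomog_homog _ R).dehomog_ne_zero (homog_ne_zero (fun _ => 1) hR0) ε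
    rw [hr] at h1 h2
    rw [MvPolynomial.degreeOf_mul_eq (left_ne_zero_of_mul h2) (right_ne_zero_of_mul h2), hRw] at h1
    omega
  have hv : F.vars = ∅ := by
    rw [Finset.eq_empty_iff_forall_notMem]
    intro w hw
    exact MvPolynomial.mem_vars_iff_degreeOf_ne_zero.1 hw (hdeg w)
  have hc := MvPolynomial.vars_eq_empty_iff_eq_C.1 hv
  refine hF.not_isUnit (hc ▸ (isUnit_iff_ne_zero.2 fun h0 => hF.ne_zero ?_).map MvPolynomial.C)
  rw [hc, h0, map_zero]

end Hypersurface

section DiagPull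

variable {K : Type} [Field K] {ι : Type}

lemma isIntegralElem_diagPull {g : K[X]} (hg : 1 ≤ g.natDegree) (p : MvPolynomial ι K) :
    (diagPull ι g : MvPolynomial ι K →+* MvPolynomial ι K).IsIntegralElem p := by
  have hC : ∀ a : K, (diagPull ι g : MvPolynomial ι K →+* MvPolynomial ι K).IsIntegralElem
      (MvPolynomial.C a) := fun a => by
    have := (diagPull ι g : MvPolynomial ι K →+* MvPolynomial ι K).isIntegralElem_map
      (x := MvPolynomial.C a)
    rwa [RingHom.coe_coe, MvPolynomial.algHom_C, MvPolynomial.algebraMap_eq] at this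
  induction p using MvPolynomial.induction_on with
  | C a => exact hC a
  | add p q hp hq => exact hp.add _ hq
  | mul_X p i hp =>
    refine hp.mul _ ?_
    have hm : (g * C g.leadingCoeff⁻¹).Monic :=
      monic_mul_leadingCoeff_inv (fun h => by simp [h] at hg)
    have hdeg : (g * C g.leadingCoeff⁻¹).natDegree = g.natDegree := by
      rw [natDegree_mul_C]
      exact inv_ne_zero (leadingCoeff_ne_zero.2 fun h => by simp [h] at hg)
    refine ⟨(g * C g.leadingCoeff⁻¹).map MvPolynomial.C -
      C (MvPolynomial.X i * MvPolynomial.C g.leadingCoeff⁻¹), ?_, ?_⟩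
    · refine (hm.map _).sub_of_left (degree_C_le.trans_lt ?_)
      rw [degree_map, degree_eq_natDegree hm.ne_zero, hdeg]
      exact_mod_cast hg
    · have h1 : (diagPull ι g : MvPolynomial ι K →+* MvPolynomial ι K).comp MvPolynomial.C =
          algebraMap K (MvPolynomial ι K) := by
        ext a : 1
        simp
      rw [eval₂_sub, eval₂_map, eval₂_C, h1, ← Polynomial.aeval_def, map_mul, Polynomial.aeval_C,
        RingHom.coe_coe, map_mul, MvPolynomial.algHom_C, diagPull, MvPolynomial.aeval_X, sub_self]

lemma comap_diagPull_ne_bot {g : K[X]} (hg : 1 ≤ g.natDegree) {𝔞 : Ideal (MvPolynomial ι K)}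
    (h0 : 𝔞 ≠ ⊥) : 𝔞.comap (diagPull ι g : MvPolynomial ι K →+* MvPolynomial ι K) ≠ ⊥ := by
  obtain ⟨r, hr, hr0⟩ := Submodule.exists_mem_ne_zero_of_ne_bot h0
  obtain ⟨p, hp, hpr⟩ := isIntegralElem_diagPull hg r
  exact Ideal.comap_ne_bot_of_root_mem hr0 hr hp.ne_zero hpr

end DiagPull

section Principal

variable {K : Type} [Field K] [CharZero K] {ι : Type} [DecidableEq ι] [Fintype ι]

/-- A height one prime whose pullback under an iterate of the diagonal map is invariant is generated
by a polynomial which is monic in each of the variables it involves. -/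
lemma exists_irreducible_of_diagPull_invariant {L : Type} [Field L] [IsAlgClosed L] [Algebra K L]
    {f : K[X]} (hd : 2 ≤ f.natDegree)
    (hf : ¬ ∃ a c, f.map (algebraMap K L) = C a * (X - C c) ^ f.natDegree + C c)
    {𝔞 : Ideal (MvPolynomial ι K)} (h𝔞 : 𝔞.IsPrime) (h0 : 𝔞 ≠ ⊥)
    (hw : ¬ ∀ w, ∃ R ∈ 𝔞, R ≠ 0 ∧ R.degreeOf w = 0) {m k : ℕ} (hm : 1 ≤ m)
    (hinv : ∀ A, diagPull ι (f.comp^[m * k] X) A ∈ 𝔞 →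
      diagPull ι (f.comp^[m + m * k] X) A ∈ 𝔞) :
    ∃ F E : MvPolynomial ι K, Irreducible F ∧ (∀ g, g ∈ 𝔞 ↔ F ∣ g) ∧ Irreducible E ∧
      E ∣ diagPull ι (f.comp^[m] X) E ∧ F ∣ diagPull ι (f.comp^[m * k] X) E ∧
      (∀ j, E.degreeOf j ≠ 0 → MonicIn j E) ∧ ∀ j, F.degreeOf j ≠ 0 → MonicIn j F := by
  have hdeg : ∀ s, 1 ≤ (f.comp^[s] X).natDegree := fun s => by
    rw [natDegree_iterate_comp_X]
    exact Nat.one_le_pow _ _ (by omega)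
  obtain ⟨F, hF, hF𝔞⟩ := exists_irreducible_of_isPrime h𝔞 h0 hw
  obtain ⟨𝔟, h𝔟, h𝔟0, hmem⟩ : ∃ 𝔟 : Ideal (MvPolynomial ι K), 𝔟.IsPrime ∧ 𝔟 ≠ ⊥ ∧
      ∀ A, A ∈ 𝔟 ↔ diagPull ι (f.comp^[m * k] X) A ∈ 𝔞 :=
    ⟨_, h𝔞.comap _, comap_diagPull_ne_bot (hdeg _) h0, fun A => Ideal.mem_comap⟩
  obtain ⟨E, hE, hE𝔟⟩ := exists_irreducible_of_isPrime h𝔟 h𝔟0 fun h => hw fun w => by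
      obtain ⟨R, hR, hR0, hRw⟩ := h w
      refine ⟨_, (hmem R).1 hR, ?_, ?_⟩
      · exact (map_ne_zero_iff _ (diagPull_injective (hdeg _))).2 hR0
      · by_contra hw'
        exact degreeOf_ne_zero_of_dvd_diagPull (hdeg _) hR0 dvd_rfl hw' hRw
  have hEm : E ∣ diagPull ι (f.comp^[m] X) E := by
    rw [← hE𝔟, hmem, ← diagPull_iterate_add]
    exact hinv _ ((hmem E).1 ((hE𝔟 E).2 dvd_rfl))
  have hFE : F ∣ diagPull ι (f.comp^[m * k] X) E := (hF𝔞 _).1 ((hmem E).1 ((hE𝔟 E).2 dvd_rfl))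
  have hmon : ∀ j, E.degreeOf j ≠ 0 → MonicIn j E := fun j hj =>
    monicIn_of_dvd_diagPull hd hf hE (Nat.pos_of_ne_zero hj) hm hEm
  exact ⟨F, E, hF, hF𝔞, hE, hEm, hFE, hmon, fun j hj =>
    ((hmon j (degreeOf_ne_zero_of_dvd_diagPull (hdeg _) hE.ne_zero hFE hj)).diagPull
      (hdeg _)).of_dvd hFE⟩

end Principal

section Stratum

variable {K L : Type} [Field K] [Field L] {ι : Type}

lemma specZ_empty : specZ K (∅ : Set ι) = dehomog K fun _ => 1 := by
  apply MvPolynomial.algHom_ext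
  rintro ⟨i, k⟩
  rcases (by lia : k = 0 ∨ k = 1) with rfl | rfl <;> simp [specZ, dehomog]

lemma degreeOf_map (φ : K →+* L) (p : MvPolynomial ι K) (i : ι) :
    (MvPolynomial.map φ p).degreeOf i = p.degreeOf i := by
  rw [MvPolynomial.degreeOf_eq_sup, MvPolynomial.degreeOf_eq_sup,
    MvPolynomial.support_map_of_injective p φ.injective]

lemma eval₂_diagPull_iterate (φ : K →+* L) (f : K[X]) (k : ℕ) (x : ι → L) (p : MvPolynomial ι K) :
    MvPolynomial.eval₂ φ x (diagPull ι (f.comp^[k] X) p) =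
      MvPolynomial.eval₂ φ (fun i => (f.map φ).eval^[k] (x i)) p := by
  have h : (MvPolynomial.eval₂Hom φ x).comp (diagPull ι (f.comp^[k] X) : _ →+* _) =
      MvPolynomial.eval₂Hom φ fun i => (f.map φ).eval^[k] (x i) := by
    apply MvPolynomial.ringHom_ext
    · intro r
      simp
    · intro i
      have : (f.map φ).eval^[k] (x i) = ((f.comp^[k] X).map φ).eval (x i) := by
        rw [map_iterate_comp_X, Polynomial.iterate_comp_eval, eval_X]
      rw [MvPolynomial.eval₂Hom_X', this, RingHom.comp_apply, RingHom.coe_coe, diagPull,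
        MvPolynomial.aeval_X, Polynomial.aeval_def, Polynomial.hom_eval₂, MvPolynomial.eval₂Hom_X',
        eval_map]
      congr 1
      ext r
      simp
  exact congr($h p)

variable [DecidableEq ι]

lemma vanishesAt_of_dvd {p q : MvPolynomial (ι × Fin 2) L} (h : p ∣ q) {t : ι → OnePoint L}
    (hp : vanishesAt (RingHom.id L) p t) : vanishesAt (RingHom.id L) q t := by
  obtain ⟨r, rfl⟩ := h
  exact (vanishesAt_mul _ _ _).2 (Or.inl hp)

variable [Fintype ι]

lemma vanishesAt_homog_chartPt (φ : K →+* L) {M : Set ι} {g : MvPolynomial ι K}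
    (hM : ∀ i ∈ M, g.degreeOf i = 0) (x : ι → L) :
    vanishesAt φ (homog (fun _ => 1) g) (chartPt M x) ↔ MvPolynomial.eval₂ φ x g = 0 := by
  rw [vanishesAt, ← homog_map, eval_homog, ← MvPolynomial.eval_map]
  · refine Eq.congr_left (MvPolynomial.eval₂Hom_congr' rfl (fun i hi _ => ?_) rfl)
    rw [MvPolynomial.mem_vars_iff_degreeOf_ne_zero, degreeOf_map] at hi
    have : i ∉ M := fun h => hi (hM i h)
    simp [chartPt, this]
  · intro i hi
    rw [degreeOf_map] at hi
    have : i ∉ M := fun h => hi (hM i h)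
    simp [chartPt, this]

lemma vanishesAt_homog_chartPt_of_monicIn (φ : K →+* L) {M : Set ι} {g : MvPolynomial ι K} {i : ι}
    (hi : i ∈ M) (hg : MonicIn i g) (x : ι → L) :
    vanishesAt φ (homog (fun _ => 1) g) (chartPt M x) ↔ ∃ l ≠ i, l ∈ M ∧ g.degreeOf l ≠ 0 := by
  rw [vanishesAt, MvPolynomial.eval_map, hg.eval₂_homog φ (by simp [chartPt, hi])
    (by simp [chartPt, hi]), mul_eq_zero, map_eq_zero, or_iff_right hg.exists_coeff.1,
    Finset.prod_eq_zero_iff]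
  refine exists_congr fun l => ?_
  by_cases hl : l ∈ M <;> simp [chartPt, hl]

end Stratum

section Hypersurface

variable {K : Type} [Field K] {n : ℕ} (V : ClosedSubvar K (Fin n))

lemma ClosedSubvar.mem_pts_of_dvd {V : ClosedSubvar K (Fin n)} {ε : Fin n → Fin 2}
    {F₀ : MvPolynomial (Fin n) (AlgebraicClosure K)}
    (hF₀ : Irreducible F₀) (hdvd : ∀ p, MultiHomog p →
      (∀ t ∈ V.pts (algebraMap K (AlgebraicClosure K)), vanishesAt (RingHom.id _) p t) →
        F₀ ∣ dehomog (AlgebraicClosure K) ε p) {j : Fin n} (hεj : ε j = 0)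
    (hj : ∀ t ∈ V.pts (algebraMap K (AlgebraicClosure K)), homCoords (t j) 1 = 0)
    {M : Set (Fin n)} (hjM : j ∈ M) (a : Fin n → K) :
    chartPt M a ∈ V.pts (RingHom.id K) := by
  have h1 : F₀ ∣ MvPolynomial.X j := by
    have := hdvd (MvPolynomial.X (j, 1)) (isMultiHomogOf_X j 1).multiHomog
      fun t ht => (vanishesAt_X_iff j 1 t).2 (hj t ht)
    simpa [dehomog, hεj] using this
  have h2 : MvPolynomial.X j ∣ F₀ :=
    (hF₀.dvd_symm (MvPolynomial.X_prime (i := j)).irreducible h1)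
  rw [← chartPt_mem_pts_iff (algebraMap K (AlgebraicClosure K))]
  intro p hp
  rw [← vanishesAt_map]
  obtain ⟨d, hd⟩ := ((V.homog p hp).map (algebraMap K (AlgebraicClosure K))).exists_isMultiHomogOf
  refine vanishesAt_of_dvd (hd.homog_dvd (h2.trans (hdvd _ hd.multiHomog fun t ht =>
    (vanishesAt_map _ p t).2 (ht p hp)))) ?_
  rw [vanishesAt, MvPolynomial.map_id, eval_homog]
  · simp [hεj, chartPt, hjM]
  · intro i hi
    rw [MvPolynomial.degreeOf_X] at hi
    have : i = j := by
      by_contra h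
      simp [h] at hi
    simp [this, hεj, chartPt, hjM]

/-- The ideal over `K` of the finite part of a closed subvariety. -/
noncomputable def ClosedSubvar.finIdeal : Ideal (MvPolynomial (Fin n) K) :=
  MvPolynomial.vanishingIdeal K
    {x : Fin n → AlgebraicClosure K | chartPt ∅ x ∈ V.pts (algebraMap K (AlgebraicClosure K))}

lemma ClosedSubvar.mem_finIdeal {g : MvPolynomial (Fin n) K} : g ∈ V.finIdeal ↔
    ∀ x, chartPt ∅ x ∈ V.pts (algebraMap K (AlgebraicClosure K)) →
      MvPolynomial.eval₂ (algebraMap K (AlgebraicClosure K)) x g = 0 := Iff.rfl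

lemma ClosedSubvar.mem_finIdeal_iff_map {g : MvPolynomial (Fin n) K} : g ∈ V.finIdeal ↔
    MvPolynomial.map (algebraMap K (AlgebraicClosure K)) g ∈
      MvPolynomial.vanishingIdeal (AlgebraicClosure K) {x : Fin n → AlgebraicClosure K |
        chartPt ∅ x ∈ V.pts (algebraMap K (AlgebraicClosure K))} := by
  rw [mem_finIdeal, mem_vanishingIdeal_self_iff]
  simp only [MvPolynomial.eval_map]
  rfl

lemma ClosedSubvar.dehomog_mem_finIdeal {p : MvPolynomial (Fin n × Fin 2) K} (hp : p ∈ V.polys) :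
    dehomog K (fun _ => 1) p ∈ V.finIdeal := by
  rw [mem_finIdeal, ← specZ_empty]
  exact fun x hx => (vanishesAt_chartPt _ p ∅ x).1 (hx p hp)

variable {V}

lemma ClosedSubvar.isPrime_finIdeal
    (hVirr : IrrSubvar (V.pts (algebraMap K (AlgebraicClosure K))))
    (hfin : ∃ t ∈ V.pts (algebraMap K (AlgebraicClosure K)), ∀ i, homCoords (t i) 1 ≠ 0) :
    V.finIdeal.IsPrime := by
  have := hVirr.isPrime_vanishingIdeal hfin
  simp only [openPt_one] at this
  convert this.comap (MvPolynomial.map (algebraMap K (AlgebraicClosure K)))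
  ext g
  rw [Ideal.mem_comap, mem_finIdeal_iff_map]

lemma ClosedSubvar.vanishesAt_homog
    (hVirr : IrrSubvar (V.pts (algebraMap K (AlgebraicClosure K))))
    (hfin : ∃ t ∈ V.pts (algebraMap K (AlgebraicClosure K)), ∀ i, homCoords (t i) 1 ≠ 0)
    {g : MvPolynomial (Fin n) K} (hg : g ∈ V.finIdeal) :
    ∀ t ∈ V.pts (algebraMap K (AlgebraicClosure K)),
      vanishesAt (algebraMap K (AlgebraicClosure K)) (_root_.homog (fun _ => 1) g) t := by
  rw [mem_finIdeal_iff_map] at hg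
  simp only [← openPt_one] at hg
  rw [hVirr.mem_vanishingIdeal_iff_homog hfin, homog_map] at hg
  exact fun t ht => (vanishesAt_map _ _ t).1 (hg t ht)

lemma ClosedSubvar.mem_pts_of_vanishesAt_homog [Infinite K] {G : MvPolynomial (Fin n) K}
    (hG : ∀ g ∈ V.finIdeal, G ∣ g) {t : Fin n → OnePoint K}
    (ht : vanishesAt (RingHom.id K) (_root_.homog (fun _ => 1) G) t) : t ∈ V.pts (RingHom.id K) :=
  fun p hp => by
    obtain ⟨d, hd⟩ := (V.homog p hp).exists_isMultiHomogOf
    exact vanishesAt_of_dvd (hd.homog_dvd (hG _ (V.dehomog_mem_finIdeal hp))) ht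

lemma ClosedSubvar.diagPull_mem_finIdeal {f : K[X]} {a b : ℕ}
    (h : ∀ x, chartPt ∅ x ∈ V.pts (algebraMap K (AlgebraicClosure K)) →
      ∃ y, chartPt ∅ y ∈ V.pts (algebraMap K (AlgebraicClosure K)) ∧
        ∀ i, (f.map (algebraMap K (AlgebraicClosure K))).eval^[a] (y i) =
          (f.map (algebraMap K (AlgebraicClosure K))).eval^[b] (x i))
    {A : MvPolynomial (Fin n) K} (hA : diagPull (Fin n) (f.comp^[a] X) A ∈ V.finIdeal) :
    diagPull (Fin n) (f.comp^[b] X) A ∈ V.finIdeal := by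
  rw [mem_finIdeal] at hA ⊢
  intro x hx
  obtain ⟨y, hy, hxy⟩ := h x hx
  have := hA y hy
  rw [eval₂_diagPull_iterate] at this ⊢
  simpa only [hxy] using this

end Hypersurface

namespace ProductFormula

open Filter

variable {K : Type} [Field K] {F : ProductFormula K}

lemma IsOver.infinitelyManyPlaces_of_forall_notMem {κ : Subfield K} (hF : F.IsOver κ) {n : ℕ}
    (f : K[X]) (V : ClosedSubvar K (Fin n)) (M : Set (Fin n)) (a : Fin n → K)
    (hP : V.pts (RingHom.id K) ∩ fwdOrbit (splitMap f) (chartPt M a) = ∅)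
    (hM : ∀ x, chartPt M x ∉ V.pts (algebraMap K (AlgebraicClosure K))) :
    InfinitelyManyPlaces K κ fun w => OrbitClosureAvoids w f (chartPt M a) V := by
  have := F.infinite
  refine hF.infinitelyManyPlaces f V M a hP {1} (fun A _ x hx => absurd hx (hM x))
    Set.infinite_univ (Eventually.of_forall fun i _ => ⟨1, one_pos, 0, fun s _ => ?_⟩)
  exact ⟨1, Finset.mem_singleton_self _, by simp⟩

variable [CharZero K]

theorem IsOver.infinitelyManyPlaces_of_hypersurface {κ : Subfield K} (hF : F.IsOver κ) {n : ℕ}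
    (hn : 1 ≤ n) {f : K[X]} (hd : 2 ≤ f.natDegree)
    (hf : ¬ ∃ a c, f.map (algebraMap K (AlgebraicClosure K)) =
      C a * (X - C c) ^ f.natDegree + C c)
    (V : ClosedSubvar K (Fin n))
    (hVirr : IrrSubvar (V.pts (algebraMap K (AlgebraicClosure K))))
    (hVpre : SubvarPreperiodic (f.map (algebraMap K (AlgebraicClosure K)))
      (V.pts (algebraMap K (AlgebraicClosure K))))
    (hVdim : varDim (V.pts (algebraMap K (AlgebraicClosure K))) = ((n - 1 : ℕ) : ℕ∞))
    (M : Set (Fin n)) (a : Fin n → K)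
    (hP : V.pts (RingHom.id K) ∩ fwdOrbit (splitMap f) (chartPt M a) = ∅) :
    InfinitelyManyPlaces K κ fun w => OrbitClosureAvoids w f (chartPt M a) V := by
  have : Nonempty (Fin n) := ⟨⟨0, hn⟩⟩
  set φ := algebraMap K (AlgebraicClosure K) with hφ
  have horb : ∀ s, chartPt M (fun i => (f.eval)^[s] (a i)) ∉ V.pts (RingHom.id K) := fun s hs => by
    have : chartPt M (fun i => (f.eval)^[s] (a i)) ∈
        V.pts (RingHom.id K) ∩ fwdOrbit (splitMap f) (chartPt M a) :=
      ⟨hs, s, splitMap_iterate_chartPt f M a s⟩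
    rwa [hP] at this
  obtain ⟨p₀, hp₀V, hp₀⟩ : ∃ p₀ ∈ V.polys, p₀ ≠ 0 := by
    by_contra! h
    exact horb 0 fun p hp => by simp [h p hp, vanishesAt]
  have hp₀' : MvPolynomial.map φ p₀ ≠ 0 :=
    (map_ne_zero_iff _ (MvPolynomial.map_injective φ φ.injective)).2 hp₀
  obtain ⟨ε, t, F₀, ht, hε, hF₀, hdvd⟩ := exists_irreducible_forall_dvd_dehomog
    (S := V.pts φ) (p₀ := MvPolynomial.map φ p₀) (by rwa [Fintype.card_fin])
    ((V.homog p₀ hp₀V).map φ) (((V.homog p₀ hp₀V).map φ).dehomog_ne_zero hp₀')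
    (fun t ht => (vanishesAt_map φ p₀ t).2 (ht p₀ hp₀V))
  by_cases hinf : ∃ j, ∀ t ∈ V.pts φ, homCoords (t j) 1 = 0
  · obtain ⟨j, hj⟩ := hinf
    refine hF.infinitelyManyPlaces_of_forall_notMem f V M a hP fun x hx => ?_
    have hjM : j ∈ M := by
      by_contra hjM
      simpa [chartPt, hjM] using hj _ hx
    have hεj : ε j = 0 := by
      rw [hε]
      by_contra hne
      obtain ⟨y, hy⟩ := OnePoint.ne_infty_iff_exists.1 hne
      simpa [← hy] using hj t ht
    exact horb 0 (ClosedSubvar.mem_pts_of_dvd hF₀ hdvd hεj hj hjM a)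
  have hfin : ∃ t ∈ V.pts φ, ∀ i, homCoords (t i) 1 ≠ 0 := by
    by_contra! h
    obtain ⟨j, -, hj⟩ := hVirr.exists_vanishesAt Finset.univ
      (p := fun j => MvPolynomial.X (j, 1)) (fun j _ => (isMultiHomogOf_X j 1).multiHomog)
      fun t ht => by simpa [vanishesAt_X_iff] using h t ht
    exact hinf ⟨j, fun t ht => (vanishesAt_X_iff j 1 t).1 (hj t ht)⟩
  have h𝔞0 : V.finIdeal ≠ ⊥ := fun h => (V.homog p₀ hp₀V).dehomog_ne_zero hp₀ (fun _ => 1) (by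
    have := V.dehomog_mem_finIdeal hp₀V
    rwa [h] at this)
  have hw : ¬ ∀ w, ∃ R ∈ V.finIdeal, R ≠ 0 ∧ R.degreeOf w = 0 := fun h =>
    not_forall_exists_degreeOf_eq_zero hVirr hfin hF₀ hdvd fun w => by
      obtain ⟨R, hR, hR0, hRw⟩ := h w
      exact ⟨_, V.mem_finIdeal_iff_map.1 hR,
        (map_ne_zero_iff _ (MvPolynomial.map_injective φ φ.injective)).2 hR0,
        by rw [degreeOf_map, hRw]⟩
  obtain ⟨m, k, hm, hmk⟩ := hVpre.exists_iterate_eq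
  obtain ⟨G, E, hG, hG𝔞, hE, hEE, hGE, hmonE, hmonG⟩ :=
    exists_irreducible_of_diagPull_invariant hd hf (ClosedSubvar.isPrime_finIdeal hVirr hfin) h𝔞0
      hw hm fun A hA => ClosedSubvar.diagPull_mem_finIdeal (fun x hx => by
        obtain ⟨y, hy, hxy⟩ := (hmk ∅ x hx).2
        exact ⟨y, hy, fun i => hxy i (Set.notMem_empty i)⟩) hA
  have hGV := ClosedSubvar.vanishesAt_homog hVirr hfin ((hG𝔞 G).2 dvd_rfl)
  have hGP : ∀ t, vanishesAt (RingHom.id K) (homog (fun _ => 1) G) t → t ∈ V.pts (RingHom.id K) :=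
    fun t ht => ClosedSubvar.mem_pts_of_vanishesAt_homog (fun g => (hG𝔞 g).1) ht
  by_cases hMG : ∃ i ∈ M, G.degreeOf i ≠ 0
  · obtain ⟨i, hi, hiG⟩ := hMG
    refine hF.infinitelyManyPlaces_of_forall_notMem f V M a hP fun x hx => ?_
    have h1 := (vanishesAt_homog_chartPt_of_monicIn φ hi (hmonG i hiG) x).1 (hGV _ hx)
    exact horb 0 (hGP _
      ((vanishesAt_homog_chartPt_of_monicIn (RingHom.id K) hi (hmonG i hiG) _).2 h1))
  · push Not at hMG
    obtain ⟨T, hT, hlow⟩ := F.exists_lower_bound_of_dvd_diagPull hd hE hG hm hEE hGE hmonE (a := a)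
      fun s hs => horb s (hGP _ ((vanishesAt_homog_chartPt _ hMG _).2 hs))
    refine hF.infinitelyManyPlaces f V M a hP {G} (fun A hA x hx => ?_) hT
      (hlow.mono fun i h hi => ?_)
    · rw [Finset.mem_singleton.1 hA]
      exact (vanishesAt_homog_chartPt φ hMG x).1 (hGV _ hx)
    · obtain ⟨c, hc, s₀, hs⟩ := h hi
      exact ⟨c, hc, s₀, fun s h => ⟨G, Finset.mem_singleton_self _, hs s h⟩⟩

end ProductFormula

section CurveIdeal

variable {K : Type} [Field K] {σ : Type}

/-- Every prime ideal above `𝔞` modulo which some variable is transcendental over `K` is contained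
in `𝔞`. -/
def IsCurveIdeal (𝔞 : Ideal (MvPolynomial σ K)) : Prop :=
  ∀ 𝔯 : Ideal (MvPolynomial σ K), 𝔯.IsPrime → 𝔞 ≤ 𝔯 → ∀ j,
    (∀ b : K[X], aeval (MvPolynomial.X j) b ∈ 𝔯 → b = 0) → 𝔯 ≤ 𝔞

namespace IsCurveIdeal

variable {𝔞 : Ideal (MvPolynomial σ K)}

lemma exists_isPrime_le {𝔟 : Ideal (MvPolynomial σ K)} {o : σ}
    (h : ∀ b : K[X], aeval (MvPolynomial.X o) b ∈ 𝔟 → b = 0) :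
    ∃ 𝔯 : Ideal (MvPolynomial σ K), 𝔯.IsPrime ∧ 𝔟 ≤ 𝔯 ∧
      ∀ b : K[X], aeval (MvPolynomial.X o) b ∈ 𝔯 → b = 0 := by
  let S : Submonoid (MvPolynomial σ K) :=
    (nonZeroDivisors K[X]).map (aeval (R := K) (MvPolynomial.X (R := K) o))
  have hdis : Disjoint (𝔟 : Set (MvPolynomial σ K)) S := by
    rw [Set.disjoint_left]
    rintro _ hb ⟨b, hb0, rfl⟩
    exact nonZeroDivisors.ne_zero hb0 (h b hb)
  obtain ⟨𝔯, h𝔯, hle, hd⟩ := Ideal.exists_le_prime_disjoint 𝔟 S hdis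
  refine ⟨𝔯, h𝔯, hle, fun b hb => ?_⟩
  by_contra hb0
  exact Set.disjoint_left.1 hd hb ⟨b, mem_nonZeroDivisors_of_ne_zero hb0, rfl⟩

lemma exists_aeval_X_mem (hc : IsCurveIdeal 𝔞) {𝔟 : Ideal (MvPolynomial σ K)} (h : 𝔞 ≤ 𝔟)
    (hne : ¬ 𝔟 ≤ 𝔞) (o : σ) : ∃ b : K[X], b ≠ 0 ∧ aeval (MvPolynomial.X o) b ∈ 𝔟 := by
  by_contra! hb
  obtain ⟨𝔯, h𝔯, hle, hd⟩ := exists_isPrime_le (𝔟 := 𝔟) (o := o)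
    fun b hmem => by_contra fun h0 => hb b h0 hmem
  exact hne (hle.trans (hc 𝔯 h𝔯 (h.trans hle) o hd))

lemma isPrime (hc : IsCurveIdeal 𝔞) {o : σ}
    (ho : ∀ b : K[X], aeval (MvPolynomial.X o) b ∈ 𝔞 → b = 0) : 𝔞.IsPrime := by
  obtain ⟨𝔯, h𝔯, hle, hd⟩ := exists_isPrime_le ho
  rwa [le_antisymm hle (hc 𝔯 h𝔯 hle o hd)]

end IsCurveIdeal

lemma rename_equivMvPolynomial (o j : σ) (p : K[X][X]) :
    MvPolynomial.rename ![o, j] (Polynomial.Bivariate.equivMvPolynomial K p) =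
      p.eval₂ (aeval (R := K) (MvPolynomial.X (R := K) o) : K[X] →+* _) (MvPolynomial.X j) := by
  have : (MvPolynomial.rename ![o, j] : _ →ₐ[K] MvPolynomial σ K).toRingHom.comp
      (Polynomial.Bivariate.equivMvPolynomial K : _ →+* _) =
      Polynomial.eval₂RingHom (aeval (R := K) (MvPolynomial.X (R := K) o) : K[X] →+* _)
        (MvPolynomial.X j) := by
    ext : 1
    · ext : 1
      · ext a : 1
        simp
      · simp
    · simp
  exact congr($this p)

/-- If every nonzero element modulo the prime `𝔞` divides a nonzero polynomial in the variable `o`,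
then each variable is algebraic over the variable `o` modulo `𝔞`. -/
lemma exists_rename_mem_of_forall_dvd [Finite σ] {𝔞 : Ideal (MvPolynomial σ K)} (h𝔞 : 𝔞.IsPrime)
    {o : σ} (ho : ∀ b : K[X], aeval (MvPolynomial.X o) b ∈ 𝔞 → b = 0)
    (hdvd : ∀ u ∉ 𝔞, ∃ b : K[X], b ≠ 0 ∧ ∃ w, aeval (MvPolynomial.X o) b - u * w ∈ 𝔞) (j : σ) :
    ∃ p : MvPolynomial (Fin 2) K, p ≠ 0 ∧ MvPolynomial.rename ![o, j] p ∈ 𝔞 := by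
  let R := MvPolynomial σ K ⧸ 𝔞
  let Q := FractionRing R
  let π : MvPolynomial σ K →+* Q := (algebraMap R Q).comp (Ideal.Quotient.mk 𝔞)
  have hπ : ∀ g, π g = 0 ↔ g ∈ 𝔞 := fun g => by
    rw [← Ideal.Quotient.eq_zero_iff_mem, RingHom.comp_apply,
      map_eq_zero_iff _ (IsFractionRing.injective R Q)]
  let η : K[X] →+* Q := π.comp (aeval (R := K) (MvPolynomial.X (R := K) o) : K[X] →+* _)
  have hη : Function.Injective η := (injective_iff_map_eq_zero _).2 fun b hb =>
    ho b ((hπ _).1 hb)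
  let L₀ := FractionRing K[X]
  let η' : L₀ →+* Q := IsFractionRing.lift hη
  have hη' : ∀ b, η' (algebraMap K[X] L₀ b) = η b := fun b => IsFractionRing.lift_algebraMap hη b
  let _ : Algebra L₀ Q := η'.toAlgebra
  let _ : Algebra K[X] Q := η.toAlgebra
  have : IsScalarTower K[X] L₀ Q := IsScalarTower.of_algebraMap_eq fun b => (hη' b).symm
  have hft : Algebra.FiniteType L₀ Q := by
    refine ⟨⟨(Set.finite_range fun i => π (MvPolynomial.X i)).toFinset, ?_⟩⟩
    rw [Set.Finite.coe_toFinset, eq_top_iff]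
    have h1 : ∀ g, π g ∈ Algebra.adjoin L₀ (Set.range fun i => π (MvPolynomial.X i)) := by
      intro g
      induction g using MvPolynomial.induction_on with
      | C a =>
        have : π (MvPolynomial.C a) = algebraMap L₀ Q (algebraMap K[X] L₀ (C a)) := by
          rw [← IsScalarTower.algebraMap_apply]
          change _ = π (aeval _ (C a))
          rw [Polynomial.aeval_C, MvPolynomial.algebraMap_eq]
        rw [this]
        exact Subalgebra.algebraMap_mem _ _
      | add p q hp hq => rw [map_add]; exact add_mem hp hq
      | mul_X p i hp => rw [map_mul]; exact mul_mem hp (Algebra.subset_adjoin ⟨i, rfl⟩)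
    rintro q -
    obtain ⟨u, v, hv, rfl⟩ := IsFractionRing.div_surjective (A := R) q
    obtain ⟨u, rfl⟩ := Ideal.Quotient.mk_surjective u
    obtain ⟨v, rfl⟩ := Ideal.Quotient.mk_surjective v
    change π u / π v ∈ _
    have hv' : v ∉ 𝔞 := fun h => nonZeroDivisors.ne_zero hv (Ideal.Quotient.eq_zero_iff_mem.2 h)
    obtain ⟨b, hb, w, hw⟩ := hdvd v hv'
    have h2 : η b = π v * π w := by
      rw [← hπ, map_sub, map_mul, sub_eq_zero] at hw
      exact hw
    have h3 : η b ≠ 0 := (map_ne_zero_iff _ hη).2 hb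
    have h4 : π u / π v = π (u * w) * algebraMap L₀ Q (algebraMap K[X] L₀ b)⁻¹ := by
      rw [map_inv₀, ← IsScalarTower.algebraMap_apply]
      change _ = _ * (η b)⁻¹
      have : π v ≠ 0 := fun h => h3 (by rw [h2, h, zero_mul])
      rw [← div_eq_mul_inv, div_eq_div_iff this h3, h2, map_mul]
      ring
    rw [h4]
    exact mul_mem (h1 _) (Subalgebra.algebraMap_mem _ _)
  have hfin : Module.Finite L₀ Q := finite_of_finite_type_of_isJacobsonRing L₀ Q
  have h_int : IsAlgebraic L₀ (π (MvPolynomial.X j)) := Algebra.IsAlgebraic.isAlgebraic _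
  obtain ⟨p, hp0, hp⟩ := (IsFractionRing.isAlgebraic_iff K[X] L₀ Q).2 h_int
  refine ⟨Polynomial.Bivariate.equivMvPolynomial K p,
    (map_ne_zero_iff _ (Polynomial.Bivariate.equivMvPolynomial K).injective).2 hp0, ?_⟩
  rw [rename_equivMvPolynomial, ← hπ, Polynomial.hom_eval₂]
  exact hp

lemma IsCurveIdeal.exists_rename_mem [Finite σ] {𝔞 : Ideal (MvPolynomial σ K)}
    (hc : IsCurveIdeal 𝔞) {o : σ}
    (ho : ∀ b : K[X], aeval (MvPolynomial.X o) b ∈ 𝔞 → b = 0) (j : σ) :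
    ∃ p : MvPolynomial (Fin 2) K, p ≠ 0 ∧ MvPolynomial.rename ![o, j] p ∈ 𝔞 := by
  refine exists_rename_mem_of_forall_dvd (hc.isPrime ho) ho (fun u hu => ?_) j
  obtain ⟨b, hb, hmem⟩ := hc.exists_aeval_X_mem (𝔟 := 𝔞 ⊔ Ideal.span {u}) le_sup_left
    (fun h => hu (h (Ideal.mem_sup_right (Ideal.mem_span_singleton_self u)))) o
  obtain ⟨y, hy, z, hz, h⟩ := Submodule.mem_sup.1 hmem
  obtain ⟨w, rfl⟩ := Ideal.mem_span_singleton'.1 hz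
  exact ⟨b, hb, w, by rwa [← h, mul_comm u w, add_sub_cancel_right]⟩

end CurveIdeal

section CurveIdeal

variable {K : Type} [Field K] {σ : Type}

lemma diagPull_rename {τ : Type} (e : τ → σ) (g : K[X]) (A : MvPolynomial τ K) :
    diagPull σ g (MvPolynomial.rename e A) = MvPolynomial.rename e (diagPull τ g A) := by
  have : (diagPull σ g).comp (MvPolynomial.rename e) =
      (MvPolynomial.rename e).comp (diagPull τ g) := by
    apply MvPolynomial.algHom_ext
    intro i
    simp only [AlgHom.comp_apply, MvPolynomial.rename_X, diagPull, MvPolynomial.aeval_X]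
    rw [← Polynomial.aeval_algHom_apply, MvPolynomial.rename_X]
  exact congr($this A)

lemma diagPull_aeval_X (g b : K[X]) (i : σ) :
    diagPull σ g (aeval (MvPolynomial.X i) b) = aeval (MvPolynomial.X i) (b.comp g) := by
  rw [← Polynomial.aeval_algHom_apply, diagPull, MvPolynomial.aeval_X, Polynomial.aeval_comp]

lemma rename_aeval_X {τ : Type} (e : τ → σ) (b : K[X]) (i : τ) :
    MvPolynomial.rename e (aeval (MvPolynomial.X i) b : MvPolynomial τ K) =
      aeval (MvPolynomial.X (e i)) b := by
  rw [← Polynomial.aeval_algHom_apply, MvPolynomial.rename_X]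

lemma eval_aeval_X (q : σ → K) (b : K[X]) (i : σ) :
    MvPolynomial.eval q (aeval (MvPolynomial.X i) b) = b.eval (q i) := by
  have := (Polynomial.aeval_algHom_apply (MvPolynomial.aeval q : MvPolynomial σ K →ₐ[K] K)
    (MvPolynomial.X i) b).symm
  rwa [MvPolynomial.aeval_X, MvPolynomial.aeval_eq_eval, Polynomial.coe_aeval_eq_eval] at this

/-- A polynomial in two variables not involving `w` is a polynomial in the other variable. -/
lemma exists_eq_aeval_X {R : MvPolynomial (Fin 2) K} {v w : Fin 2} (hvw : v ≠ w)
    (h : R.degreeOf w = 0) : ∃ b : K[X], R = aeval (MvPolynomial.X v) b := by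
  refine ⟨MvPolynomial.aeval (fun _ => X) R, ?_⟩
  have h1 : (aeval (R := K) (MvPolynomial.X (R := K) v)) (MvPolynomial.aeval (fun _ => X) R) =
      MvPolynomial.aeval (fun _ => MvPolynomial.X v) R := by
    rw [← AlgHom.comp_apply, MvPolynomial.comp_aeval]
    simp
  rw [h1]
  nth_rw 1 [← MvPolynomial.aeval_X_left_apply R]
  refine MvPolynomial.eval₂Hom_congr' rfl (fun i hi _ => ?_) rfl
  rw [MvPolynomial.mem_vars_iff_degreeOf_ne_zero] at hi
  have : i ≠ w := fun h' => hi (h' ▸ h)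
  rw [show i = v by lia]

lemma exists_irreducible_rename_mem {f : K[X]} (hd : 2 ≤ f.natDegree)
    {𝔞 : Ideal (MvPolynomial σ K)} (h𝔞 : 𝔞.IsPrime) {o j : σ}
    (ho : ∀ b : K[X], aeval (MvPolynomial.X o) b ∈ 𝔞 → b = 0)
    (hp : ∃ p : MvPolynomial (Fin 2) K, p ≠ 0 ∧ MvPolynomial.rename ![o, j] p ∈ 𝔞) {m k : ℕ}
    (hinv : ∀ A, diagPull σ (f.comp^[m * k] X) A ∈ 𝔞 → diagPull σ (f.comp^[m + m * k] X) A ∈ 𝔞) :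
    ∃ E : MvPolynomial (Fin 2) K, Irreducible E ∧ E ∣ diagPull (Fin 2) (f.comp^[m] X) E ∧
      MvPolynomial.rename ![o, j] (diagPull (Fin 2) (f.comp^[m * k] X) E) ∈ 𝔞 := by
  have hdeg : ∀ s, 1 ≤ (f.comp^[s] X).natDegree := fun s => by
    rw [natDegree_iterate_comp_X]
    exact Nat.one_le_pow _ _ (by omega)
  obtain ⟨𝔭, h𝔭, hmem𝔭⟩ : ∃ 𝔭 : Ideal (MvPolynomial (Fin 2) K), 𝔭.IsPrime ∧
      ∀ A, A ∈ 𝔭 ↔ MvPolynomial.rename ![o, j] A ∈ 𝔞 :=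
    ⟨_, h𝔞.comap (MvPolynomial.rename ![o, j]), fun A => Ideal.mem_comap⟩
  have h𝔭0 : 𝔭 ≠ ⊥ := by
    obtain ⟨p, hp0, hp⟩ := hp
    rintro rfl
    exact hp0 ((hmem𝔭 p).2 hp)
  obtain ⟨𝔟, h𝔟, h𝔟0, hmem⟩ : ∃ 𝔟 : Ideal (MvPolynomial (Fin 2) K), 𝔟.IsPrime ∧ 𝔟 ≠ ⊥ ∧
      ∀ A, A ∈ 𝔟 ↔ MvPolynomial.rename ![o, j] (diagPull (Fin 2) (f.comp^[m * k] X) A) ∈ 𝔞 :=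
    ⟨_, h𝔭.comap _, comap_diagPull_ne_bot (hdeg _) h𝔭0, fun A => Ideal.mem_comap.trans (hmem𝔭 _)⟩
  obtain ⟨E, hE, hE𝔟⟩ := exists_irreducible_of_isPrime h𝔟 h𝔟0 fun h => by
    obtain ⟨R, hR, hR0, hRw⟩ := h 1
    obtain ⟨b, rfl⟩ := exists_eq_aeval_X (v := 0) (w := 1) (by decide) hRw
    rw [hmem, diagPull_aeval_X, rename_aeval_X] at hR
    have h1 := ho _ hR
    rw [Polynomial.comp_eq_zero_iff] at h1
    rcases h1 with h1 | ⟨-, h1⟩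
    · exact hR0 (by rw [h1, map_zero])
    · have := hdeg (m * k)
      rw [h1, natDegree_C] at this
      omega
  refine ⟨E, hE, ?_, (hmem E).1 ((hE𝔟 E).2 dvd_rfl)⟩
  rw [← hE𝔟, hmem, ← diagPull_iterate_add, ← diagPull_rename]
  apply hinv
  rw [diagPull_rename]
  exact (hmem E).1 ((hE𝔟 E).2 dvd_rfl)

end CurveIdeal

section Points

variable {K : Type} [Field K] {σ : Type}

/-- A prime contained in `𝔞` modulo which all variables are algebraic over the variable `o` is
equal to `𝔞` if `o` is transcendental modulo `𝔞`. -/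
lemma le_of_forall_exists_rename_mem {𝔞 𝔮 : Ideal (MvPolynomial σ K)} (h𝔮 : 𝔮.IsPrime)
    (hle : 𝔮 ≤ 𝔞) {o : σ} (ho : ∀ b : K[X], aeval (MvPolynomial.X o) b ∈ 𝔞 → b = 0)
    (hp : ∀ j, ∃ p : MvPolynomial (Fin 2) K, p ≠ 0 ∧ MvPolynomial.rename ![o, j] p ∈ 𝔮) :
    𝔞 ≤ 𝔮 := by
  intro g hg
  by_contra hg𝔮
  let R := MvPolynomial σ K ⧸ 𝔮
  let η : K[X] →+* R := (Ideal.Quotient.mk 𝔮).comp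
    (aeval (R := K) (MvPolynomial.X (R := K) o) : K[X] →+* _)
  let _ : Algebra K[X] R := η.toAlgebra
  have hη : ∀ b, η b = 0 → b = 0 := fun b hb => ho b (hle (Ideal.Quotient.eq_zero_iff_mem.1 hb))
  have hinj : FaithfulSMul K[X] R :=
    (faithfulSMul_iff_algebraMap_injective _ _).2 ((injective_iff_map_eq_zero _).2 hη)
  have halg : ∀ g : MvPolynomial σ K,
      Ideal.Quotient.mk 𝔮 g ∈ Subalgebra.algebraicClosure K[X] R := by
    intro g
    induction g using MvPolynomial.induction_on with
    | C a =>
      have : Ideal.Quotient.mk 𝔮 (MvPolynomial.C a) = algebraMap K[X] R (C a) := by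
        change _ = Ideal.Quotient.mk 𝔮 (aeval _ (C a))
        rw [Polynomial.aeval_C, MvPolynomial.algebraMap_eq]
      rw [this]
      exact Subalgebra.algebraMap_mem _ _
    | add p q hp hq => rw [map_add]; exact add_mem hp hq
    | mul_X p j hp' =>
      rw [map_mul]
      refine mul_mem hp' ?_
      obtain ⟨p, hp0, hp⟩ := hp j
      refine ⟨(Polynomial.Bivariate.equivMvPolynomial K).symm p,
        (map_ne_zero_iff _ (Polynomial.Bivariate.equivMvPolynomial K).symm.injective).2 hp0, ?_⟩
      rw [← (Polynomial.Bivariate.equivMvPolynomial K).apply_symm_apply p,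
        rename_equivMvPolynomial, ← Ideal.Quotient.eq_zero_iff_mem, Polynomial.hom_eval₂] at hp
      exact hp
  obtain ⟨b, hb0, w, hw⟩ := IsAlgebraic.exists_nonzero_dvd (R := K[X]) (S := R) (halg g)
    (mem_nonZeroDivisors_of_ne_zero fun h => hg𝔮 (Ideal.Quotient.eq_zero_iff_mem.1 h))
  obtain ⟨w, rfl⟩ := Ideal.Quotient.mk_surjective w
  have h1 : aeval (MvPolynomial.X o) b - g * w ∈ 𝔮 := by
    rw [← Ideal.Quotient.eq_zero_iff_mem, map_sub, map_mul, sub_eq_zero]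
    exact hw
  refine hb0 (ho b ?_)
  have := 𝔞.add_mem (hle h1) (𝔞.mul_mem_right w hg)
  rwa [sub_add_cancel] at this

/-- Points off the zero locus of the prime `𝔞` at which nonzero relations between the variable `o`
and each variable hold are not dense in a set containing that zero locus. -/
lemma not_iInf_ker_eval_le [Finite σ] {𝔞 : Ideal (MvPolynomial σ K)} (h𝔞 : 𝔞.IsPrime) {o : σ}
    (ho : ∀ b : K[X], aeval (MvPolynomial.X o) b ∈ 𝔞 → b = 0) {Y : Set (σ → K)}
    (hY : ∀ y ∈ Y, ∃ A ∈ 𝔞, MvPolynomial.eval y A ≠ 0)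
    (hp : ∀ j, ∃ p : MvPolynomial (Fin 2) K, p ≠ 0 ∧
      ∀ y ∈ Y, MvPolynomial.eval y (MvPolynomial.rename ![o, j] p) = 0) :
    ¬ ⨅ y ∈ Y, RingHom.ker (MvPolynomial.eval y) ≤ 𝔞 := by
  intro hle
  set I : Ideal (MvPolynomial σ K) := ⨅ y ∈ Y, RingHom.ker (MvPolynomial.eval y) with hI
  have hmem : ∀ g, g ∈ I ↔ ∀ y ∈ Y, MvPolynomial.eval y g = 0 := fun g => by
    simp [hI, RingHom.mem_ker]
  have hmin : ∀ 𝔮 ∈ I.minimalPrimes, 𝔮 ≤ 𝔞 → 𝔞 ≤ 𝔮 := fun 𝔮 h𝔮 h =>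
    le_of_forall_exists_rename_mem h𝔮.1.1 h ho fun j => by
      obtain ⟨p, hp0, hp⟩ := hp j
      exact ⟨p, hp0, h𝔮.1.2 ((hmem _).2 hp)⟩
  have hfin : (I.minimalPrimes \ {𝔞}).Finite := I.finite_minimalPrimes_of_isNoetherianRing.sdiff
  have hle' : hfin.toFinset.inf id ≤ 𝔞 := by
    refine le_trans (fun g hg => (hmem g).2 fun y hy => ?_) hle
    have h1 : I ≤ RingHom.ker (MvPolynomial.eval y) := fun g hg => (hmem g).1 hg y hy
    have := RingHom.ker_isPrime (MvPolynomial.eval y)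
    obtain ⟨𝔮, h𝔮, h2⟩ := Ideal.exists_minimalPrimes_le h1
    have h3 : 𝔮 ≠ 𝔞 := by
      rintro rfl
      obtain ⟨A, hA, hne⟩ := hY y hy
      exact hne (h2 hA)
    have h4 : hfin.toFinset.inf id ≤ 𝔮 := Finset.inf_le (f := id) (by simp [h𝔮, h3])
    exact h2 (h4 hg)
  obtain ⟨𝔮, h𝔮, h⟩ := (Ideal.IsPrime.inf_le' h𝔞).1 hle'
  rw [Set.Finite.mem_toFinset] at h𝔮
  exact h𝔮.2 (le_antisymm h (hmin 𝔮 h𝔮.1 h))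

lemma IsCurveIdeal.exists_eval_eq [Finite σ] {𝔞 : Ideal (MvPolynomial σ K)} (hc : IsCurveIdeal 𝔞)
    {o : σ} (ho : ∀ b : K[X], aeval (MvPolynomial.X o) b ∈ 𝔞 → b = 0) {Y : Set (σ → K)}
    (hY : ∀ y ∈ Y, ∃ A ∈ 𝔞, MvPolynomial.eval y A ≠ 0)
    (hp : ∀ j, ∃ p : MvPolynomial (Fin 2) K, p ≠ 0 ∧
      ∀ y ∈ Y, MvPolynomial.eval y (MvPolynomial.rename ![o, j] p) = 0) :
    ∃ b : K[X], b ≠ 0 ∧ ∃ A ∈ 𝔞, ∀ y ∈ Y, MvPolynomial.eval y A = b.eval (y o) := by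
  obtain ⟨b, hb, hmem⟩ := hc.exists_aeval_X_mem
    (𝔟 := 𝔞 ⊔ ⨅ y ∈ Y, RingHom.ker (MvPolynomial.eval y)) le_sup_left
    (fun h => not_iInf_ker_eval_le (hc.isPrime ho) ho hY hp (le_sup_right.trans h)) o
  obtain ⟨A, hA, B, hB, h⟩ := Submodule.mem_sup.1 hmem
  refine ⟨b, hb, A, hA, fun y hy => ?_⟩
  have hB' : MvPolynomial.eval y B = 0 := by
    simp only [Ideal.mem_iInf, RingHom.mem_ker] at hB
    exact hB y hy
  rw [← eval_aeval_X, ← h, map_add, hB', add_zero]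

end Points

namespace ProductFormula

open Filter

variable {K : Type} [Field K] {σ : Type} {F : ProductFormula K} {f : K[X]}
  {𝔞 : Ideal (MvPolynomial σ K)} {a : σ → K}

lemma exists_lower_bound_of_finite [Finite σ]
    (hne : ∀ s, ∃ A ∈ 𝔞, MvPolynomial.eval (fun i => f.eval^[s] (a i)) A ≠ 0)
    (hpre : ∀ j, ¬ Function.Injective fun s => f.eval^[s] (a j)) :
    ∃ 𝒜 : Finset (MvPolynomial σ K), (∀ A ∈ 𝒜, A ∈ 𝔞) ∧ ∃ T : Set F.ι, T.Infinite ∧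
      ∀ᶠ i in cofinite, i ∈ T → ∃ c > 0, ∃ s₀, ∀ s ≥ s₀, ∃ A ∈ 𝒜,
        c ≤ F.fin i (MvPolynomial.eval (fun i => f.eval^[s] (a i)) A) := by
  classical
  have := F.infinite
  let q : ℕ → σ → K := fun s i => f.eval^[s] (a i)
  have hq : (Set.range q).Finite := (Set.Finite.pi fun j =>
      finite_range_iterate_of_not_injective (hpre j)).subset (by
    rintro _ ⟨s, rfl⟩ j -
    exact ⟨s, rfl⟩)
  have hA : ∀ y : Set.range q, ∃ A ∈ 𝔞, MvPolynomial.eval y.1 A ≠ 0 := by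
    rintro ⟨_, s, rfl⟩
    exact hne s
  choose A hA𝔞 hA0 using hA
  have := hq.to_subtype
  have hfin : (Set.range fun s => MvPolynomial.eval (q s) (A ⟨q s, s, rfl⟩)).Finite :=
    (Set.finite_range fun y : Set.range q => MvPolynomial.eval y.1 (A y)).subset (by
      rintro _ ⟨s, rfl⟩
      exact ⟨⟨q s, s, rfl⟩, rfl⟩)
  refine ⟨(Set.finite_range A).toFinset, fun B hB => ?_, Set.univ, Set.infinite_univ,
    Eventually.of_forall fun i _ => ?_⟩
  · obtain ⟨y, rfl⟩ := (Set.Finite.mem_toFinset _).1 hB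
    exact hA𝔞 y
  · obtain ⟨c, hc, h⟩ := exists_le_abv_of_finite hfin (Q := fun _ => True)
      (fun s _ => hA0 ⟨q s, s, rfl⟩) (F.fin i)
    exact ⟨c, hc, 0, fun s _ => ⟨_, (Set.Finite.mem_toFinset _).2 ⟨⟨q s, s, rfl⟩, rfl⟩,
      h s trivial⟩⟩

variable [CharZero K]

/-- The lower bound along a residue class obtained from a relation with the variable `o` which does
not vanish along that class. -/
lemma IsAdapted.eventually_lower_bound_residue {T : Set F.ι} {o : σ}
    (hT : F.IsAdapted T f fun s => f.eval^[s] (a o)) (hd : 2 ≤ f.natDegree)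
    {L : Type} [Field L] [IsAlgClosed L] [Algebra K L]
    (hf : ¬ ∃ a c, f.map (algebraMap K L) = C a * (X - C c) ^ f.natDegree + C c)
    {j : σ} (hj : ∀ b : K[X], aeval (MvPolynomial.X j) b ∈ 𝔞 → b ≠ 0 →
      ¬ Function.Injective fun s => f.eval^[s] (a j))
    {E : MvPolynomial (Fin 2) K} (hE : Irreducible E) {m k : ℕ} (hm : 1 ≤ m)
    (hEm : E ∣ diagPull (Fin 2) (f.comp^[m] X) E)
    (hmem : MvPolynomial.rename ![o, j] (diagPull (Fin 2) (f.comp^[m * k] X) E) ∈ 𝔞)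
    {r : ℕ} (hr : r < m) (hne : ∀ s, s % m = r → MvPolynomial.eval (fun i => f.eval^[s] (a i))
      (MvPolynomial.rename ![o, j] (diagPull (Fin 2) (f.comp^[m * k] X) E)) ≠ 0) :
    ∀ᶠ i in cofinite, i ∈ T → ∃ c > 0, ∃ s₀, ∀ s ≥ s₀, s % m = r →
      c ≤ F.fin i (MvPolynomial.eval (fun i => f.eval^[s] (a i))
        (MvPolynomial.rename ![o, j] (diagPull (Fin 2) (f.comp^[m * k] X) E))) := by
  have hdeg : ∀ s, 1 ≤ (f.comp^[s] X).natDegree := fun s => by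
    rw [natDegree_iterate_comp_X]
    exact Nat.one_le_pow _ _ (by omega)
  have hE' := (map_ne_zero_iff _ (diagPull_injective (ι := Fin 2) (hdeg (m * k)))).2 hE.ne_zero
  obtain ⟨H, hH⟩ := hEm
  by_cases h0 : E.degreeOf 0 = 0
  · obtain ⟨b, rfl⟩ := exists_eq_aeval_X (v := 1) (w := 0) (by decide) h0
    rw [diagPull_aeval_X] at hE'
    simp only [diagPull_aeval_X, rename_aeval_X] at hmem hne ⊢
    have hb := hj _ hmem fun h => hE' (by rw [h, map_zero])
    have hfin : (Set.range fun s => MvPolynomial.eval (fun i => f.eval^[s] (a i))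
        (aeval (MvPolynomial.X (![o, j] 1)) (b.comp (f.comp^[m * k] X)))).Finite := by
      simp only [eval_aeval_X]
      refine ((finite_range_iterate_of_not_injective hb).image
        fun y => (b.comp (f.comp^[m * k] X)).eval y).subset ?_
      rintro _ ⟨s, rfl⟩
      exact ⟨_, ⟨s, rfl⟩, rfl⟩
    refine Eventually.of_forall fun i _ => ?_
    obtain ⟨c, hc, h⟩ := exists_le_abv_of_finite hfin hne (F.fin i)
    exact ⟨c, hc, 0, fun s _ => h s⟩
  · have hmon : MonicIn 0 (diagPull (Fin 2) (f.comp^[m * k] X) E) :=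
      (monicIn_of_dvd_diagPull hd hf hE (Nat.pos_of_ne_zero h0) hm ⟨H, hH⟩).diagPull (hdeg _)
    have hrec : diagPull (Fin 2) (f.comp^[m] X) (diagPull (Fin 2) (f.comp^[m * k] X) E) =
        diagPull (Fin 2) (f.comp^[m * k] X) E * diagPull (Fin 2) (f.comp^[m * k] X) H := by
      rw [← map_mul, ← hH, ← diagPull_iterate_add, ← diagPull_iterate_add, add_comm]
    have hcomp : ∀ s, (fun i => f.eval^[s] (a i)) ∘ ![o, j] =
        fun l => f.eval^[s] ((a ∘ ![o, j]) l) := fun s => rfl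
    simp only [MvPolynomial.eval_rename, hcomp] at hne ⊢
    refine (IsAdapted.eventually_eval_eq_one (a := a ∘ ![o, j]) (j := 0) hT hmon hrec).mono
      fun i h hi => ?_
    obtain ⟨s₁, hs₁⟩ := h hi
    refine exists_le_abv_of_recurrence (fun s => ?_) hs₁ hr hne
    rw [eval_recurrence hrec]

lemma IsAdapted.exists_lower_bound_residue [Finite σ] {T : Set F.ι} {o : σ}
    (hT : F.IsAdapted T f fun s => f.eval^[s] (a o)) (hd : 2 ≤ f.natDegree)
    {L : Type} [Field L] [IsAlgClosed L] [Algebra K L]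
    (hf : ¬ ∃ a c, f.map (algebraMap K L) = C a * (X - C c) ^ f.natDegree + C c)
    (hc : IsCurveIdeal 𝔞) (ho : ∀ b : K[X], aeval (MvPolynomial.X o) b ∈ 𝔞 → b = 0)
    (hj : ∀ j, ∀ b : K[X], aeval (MvPolynomial.X j) b ∈ 𝔞 → b ≠ 0 →
      ¬ Function.Injective fun s => f.eval^[s] (a j)) {m k : ℕ} (hm : 1 ≤ m)
    (hinv : ∀ A, diagPull σ (f.comp^[m * k] X) A ∈ 𝔞 → diagPull σ (f.comp^[m + m * k] X) A ∈ 𝔞)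
    (hne : ∀ s, ∃ A ∈ 𝔞, MvPolynomial.eval (fun i => f.eval^[s] (a i)) A ≠ 0)
    {r : ℕ} (hr : r < m) :
    ∃ A ∈ 𝔞, ∀ᶠ i in cofinite, i ∈ T → ∃ c > 0, ∃ s₀, ∀ s ≥ s₀, s % m = r →
      c ≤ F.fin i (MvPolynomial.eval (fun i => f.eval^[s] (a i)) A) := by
  have h𝔞 := hc.isPrime ho
  choose E hE hEm hEmem using fun j =>
    exists_irreducible_rename_mem hd h𝔞 ho (hc.exists_rename_mem ho j) hinv
  by_cases h : ∃ j, ∀ s, s % m = r → MvPolynomial.eval (fun i => f.eval^[s] (a i))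
      (MvPolynomial.rename ![o, j] (diagPull (Fin 2) (f.comp^[m * k] X) (E j))) ≠ 0
  · obtain ⟨j, hjne⟩ := h
    exact ⟨_, hEmem j, hT.eventually_lower_bound_residue hd hf (hj j) (hE j) hm (hEm j) (hEmem j)
      hr hjne⟩
  push Not at h
  choose t ht ht0 using h
  obtain ⟨s₁, hs₁⟩ := (Set.finite_range t).bddAbove
  have hdeg : 1 ≤ (f.comp^[m * k] X).natDegree := by
    rw [natDegree_iterate_comp_X]
    exact Nat.one_le_pow _ _ (by omega)
  obtain ⟨b, hb, A, hA, hAb⟩ := hc.exists_eval_eq ho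
    (Y := {y | ∃ s ≥ s₁, s % m = r ∧ y = fun i => f.eval^[s] (a i)})
    (by rintro _ ⟨s, -, -, rfl⟩; exact hne s) fun j =>
      ⟨diagPull (Fin 2) (f.comp^[m * k] X) (E j),
        (map_ne_zero_iff _ (diagPull_injective hdeg)).2 (hE j).ne_zero, by
        rintro _ ⟨s, hs, hsr, rfl⟩
        obtain ⟨H, hH⟩ := hEm j
        have hrec : diagPull σ (f.comp^[m] X)
            (MvPolynomial.rename ![o, j] (diagPull (Fin 2) (f.comp^[m * k] X) (E j))) =
            MvPolynomial.rename ![o, j] (diagPull (Fin 2) (f.comp^[m * k] X) (E j)) *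
            MvPolynomial.rename ![o, j] (diagPull (Fin 2) (f.comp^[m * k] X) H) := by
          rw [← map_mul, ← map_mul, ← hH, diagPull_rename, ← diagPull_iterate_add,
            ← diagPull_iterate_add, add_comm]
        exact eq_zero_of_recurrence (g := fun s => MvPolynomial.eval (fun i => f.eval^[s] (a i)) _)
          (fun s => eval_recurrence hrec a s) ((hs₁ ⟨j, rfl⟩).trans hs) (hsr.trans (ht j).symm)
          (ht0 j)⟩
  refine ⟨A, hA, (hT.eventually_lower_bound hb).mono fun i h hi => ?_⟩
  obtain ⟨c, hc, s₀, hs₀⟩ := h hi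
  refine ⟨c, hc, max s₀ s₁, fun s hs hsr => ?_⟩
  rw [hAb _ ⟨s, (le_max_right _ _).trans hs, hsr, rfl⟩]
  exact hs₀ s ((le_max_left _ _).trans hs)

theorem exists_lower_bound_of_isCurveIdeal [Finite σ] (hd : 2 ≤ f.natDegree)
    {L : Type} [Field L] [IsAlgClosed L] [Algebra K L]
    (hf : ¬ ∃ a c, f.map (algebraMap K L) = C a * (X - C c) ^ f.natDegree + C c)
    (hc : IsCurveIdeal 𝔞) {m k : ℕ} (hm : 1 ≤ m)
    (hinv : ∀ A, diagPull σ (f.comp^[m * k] X) A ∈ 𝔞 → diagPull σ (f.comp^[m + m * k] X) A ∈ 𝔞)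
    (hne : ∀ s, ∃ A ∈ 𝔞, MvPolynomial.eval (fun i => f.eval^[s] (a i)) A ≠ 0) :
    ∃ 𝒜 : Finset (MvPolynomial σ K), (∀ A ∈ 𝒜, A ∈ 𝔞) ∧ ∃ T : Set F.ι, T.Infinite ∧
      ∀ᶠ i in cofinite, i ∈ T → ∃ c > 0, ∃ s₀, ∀ s ≥ s₀, ∃ A ∈ 𝒜,
        c ≤ F.fin i (MvPolynomial.eval (fun i => f.eval^[s] (a i)) A) := by
  classical
  by_cases hpre : ∀ j, ¬ Function.Injective fun s => f.eval^[s] (a j)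
  · exact exists_lower_bound_of_finite hne hpre
  by_cases hj : ∀ j, ∀ b : K[X], aeval (MvPolynomial.X j) b ∈ 𝔞 → b ≠ 0 →
      ¬ Function.Injective fun s => f.eval^[s] (a j)
  · push Not at hpre
    obtain ⟨o, hinj⟩ := hpre
    obtain ⟨T, hT⟩ := F.exists_isAdapted f hd (a o) hinj
    have ho : ∀ b : K[X], aeval (MvPolynomial.X o) b ∈ 𝔞 → b = 0 := fun b hb =>
      by_contra fun h => hj o b hb h hinj
    choose A hA𝔞 hA using fun r : Fin m =>
      hT.exists_lower_bound_residue hd hf hc ho hj hm hinv hne r.2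
    refine ⟨Finset.univ.image A, fun B hB => ?_, T, hT.infinite,
      (eventually_all.2 hA).mono fun i h hi => ?_⟩
    · obtain ⟨r, -, rfl⟩ := Finset.mem_image.1 hB
      exact hA𝔞 r
    · refine exists_le_of_forall_residue hm (Q := fun c s => ∃ B ∈ Finset.univ.image A,
        c ≤ F.fin i (MvPolynomial.eval (fun i => f.eval^[s] (a i)) B))
        (fun c c' s hcc ⟨B, hB, h⟩ => ⟨B, hB, hcc.trans h⟩) fun r hr => ?_
      obtain ⟨c, hc, s₀, hs₀⟩ := h ⟨r, hr⟩ hi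
      exact ⟨c, hc, s₀, fun s hs hsr => ⟨_, Finset.mem_image_of_mem _ (Finset.mem_univ ⟨r, hr⟩),
        hs₀ s hs hsr⟩⟩
  · push Not at hj
    obtain ⟨j, b, hb𝔞, hb, hinj⟩ := hj
    obtain ⟨T, hT⟩ := F.exists_isAdapted f hd (a j) hinj
    refine ⟨{aeval (MvPolynomial.X j) b}, by simpa using hb𝔞, T, hT.infinite,
      (hT.eventually_lower_bound hb).mono fun i h hi => ?_⟩
    obtain ⟨c, hc, s₀, hs₀⟩ := h hi
    exact ⟨c, hc, s₀, fun s hs => ⟨_, Finset.mem_singleton_self _, by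
      rw [eval_aeval_X]
      exact hs₀ s hs⟩⟩

end ProductFormula

section IrreducibleCurve

variable {L : Type} [Field L] {ι : Type} [DecidableEq ι]

lemma homCoords_cross_eq_zero_iff {s t : OnePoint L} :
    homCoords t 1 * homCoords s 0 - homCoords t 0 * homCoords s 1 = 0 ↔ s = t := by
  cases s using OnePoint.rec <;> cases t using OnePoint.rec <;>
    simp [homCoords_coe, homCoords_infty, eq_comm, sub_eq_zero]

lemma isZarClosed_singleton (t : ι → OnePoint L) : IsZarClosed {t} := by
  refine ⟨⟨Set.range fun i => MvPolynomial.C (homCoords (t i) 1) * MvPolynomial.X (i, 0) +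
    MvPolynomial.C (-homCoords (t i) 0) * MvPolynomial.X (i, 1), ?_⟩, ?_⟩
  · rintro _ ⟨i, rfl⟩ j
    exact ⟨_, ((isMultiHomogOf_C _).mul (isMultiHomogOf_X i 0) j).add
      ((isMultiHomogOf_C _).mul (isMultiHomogOf_X i 1) j)⟩
  · ext s
    simp [ClosedSubvar.pts, vanishesAt, ← homCoords_cross_eq_zero_iff, funext_iff, sub_eq_add_neg]

lemma irrSubvar_singleton (t : ι → OnePoint L) : IrrSubvar {t} :=
  ⟨Set.singleton_nonempty t, isZarClosed_singleton t, fun Z₁ Z₂ _ _ h => by simpa using h⟩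

lemma IrrSubvar.eq_of_varDim_le_one {S T : Set (ι → OnePoint L)} (hS : IrrSubvar S)
    (hdim : varDim S ≤ 1) (hT : IrrSubvar T) (hTS : T ⊆ S) (hnt : T.Nontrivial) : T = S := by
  obtain ⟨t, ht, t', ht', hne⟩ := hnt
  rw [varDim, Order.krullDim_le_one_iff] at hdim
  rcases hdim ⟨T, hT, hTS⟩ with h | h
  · have := h (b := ⟨{t}, irrSubvar_singleton t, by simpa using hTS ht⟩) (by simpa using ht)
    exact absurd ((this : T ⊆ {t}) ht') fun h => hne (by simpa using h.symm)
  · exact hTS.antisymm (h (b := ⟨S, hS, subset_rfl⟩) hTS)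

lemma IrrSubvar.vanishesAt_of_subset {S W : Set (ι → OnePoint L)} (hS : IrrSubvar S)
    (hdim : varDim S ≤ 1) (hWS : W ⊆ S) (hnt : W.Nontrivial)
    (hW : ∀ p q : MvPolynomial (ι × Fin 2) L, MultiHomog p → MultiHomog q →
      (∀ t ∈ W, vanishesAt (RingHom.id L) p t ∨ vanishesAt (RingHom.id L) q t) →
      (∀ t ∈ W, vanishesAt (RingHom.id L) p t) ∨ ∀ t ∈ W, vanishesAt (RingHom.id L) q t)
    {p : MvPolynomial (ι × Fin 2) L} (hp : MultiHomog p)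
    (hpW : ∀ t ∈ W, vanishesAt (RingHom.id L) p t) : ∀ t ∈ S, vanishesAt (RingHom.id L) p t := by
  let V : ClosedSubvar L ι :=
    ⟨{p | MultiHomog p ∧ ∀ t ∈ W, vanishesAt (RingHom.id L) p t}, fun p hp => hp.1⟩
  have hWV : W ⊆ V.pts (RingHom.id L) := fun t ht p hp => hp.2 t ht
  have hVle : ∀ Z, IsZarClosed Z → W ⊆ Z → V.pts (RingHom.id L) ⊆ Z := by
    rintro _ ⟨Z, rfl⟩ h t ht p hp
    exact ht p ⟨Z.homog p hp, fun s hs => h hs p hp⟩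
  have hV : IrrSubvar (V.pts (RingHom.id L)) := by
    refine ⟨hnt.nonempty.mono hWV, ⟨V, rfl⟩, fun Z₁ Z₂ h₁ h₂ h => ?_⟩
    by_contra! hcon
    have h1 : ¬ W ⊆ Z₁ := fun h => hcon.1 (hVle _ h₁ h)
    have h2 : ¬ W ⊆ Z₂ := fun h => hcon.2 (hVle _ h₂ h)
    obtain ⟨Z₁, rfl⟩ := h₁
    obtain ⟨Z₂, rfl⟩ := h₂
    obtain ⟨t, ht, htZ⟩ := Set.not_subset.1 h1
    obtain ⟨s, hs, hsZ⟩ := Set.not_subset.1 h2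
    simp only [ClosedSubvar.pts, Set.mem_ofPred_eq, not_forall] at htZ hsZ
    obtain ⟨p, hp, hpt⟩ := htZ
    obtain ⟨q, hq, hqs⟩ := hsZ
    rcases hW p q (Z₁.homog p hp) (Z₂.homog q hq) fun u hu => (h (hWV hu)).imp
      (fun h => h p hp) (fun h => h q hq) with h' | h'
    · exact hpt (h' t ht)
    · exact hqs (h' s hs)
  have := hS.eq_of_varDim_le_one hdim hV (hVle S hS.2.1 hWS) (hnt.mono hWV)
  intro t ht
  rw [← this] at ht
  exact ht p ⟨hp, hpW⟩

end IrreducibleCurve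

section StratumIdeal

variable {K L : Type} [Field K] [Field L] {ι : Type}

lemma chartPt_extend (M : Set ι) (x : ι → L) :
    chartPt M (Function.extend Subtype.val (fun i : {i // i ∉ M} => x i) 0) = chartPt M x := by
  funext i
  by_cases hi : i ∈ M
  · simp [chartPt, hi]
  · have := Subtype.val_injective.extend_apply (fun i : {i // i ∉ M} => x i) 0 ⟨i, hi⟩
    simp only at this
    simp [chartPt, hi, this]

lemma eval₂_killCompl {σ : Type} {g : σ → ι} (hg : Function.Injective g) (φ : K →+* L) (x : σ → L)
    (p : MvPolynomial ι K) : MvPolynomial.eval₂ φ x (MvPolynomial.killCompl hg p) =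
      MvPolynomial.eval₂ φ (Function.extend g x 0) p := by
  have h : (MvPolynomial.eval₂Hom φ x).comp (MvPolynomial.killCompl hg).toRingHom =
      MvPolynomial.eval₂Hom φ (Function.extend g x 0) := by
    apply MvPolynomial.ringHom_ext
    · intro r
      simp
    · intro i
      by_cases hi : i ∈ Set.range g
      · obtain ⟨j, rfl⟩ := hi
        rw [MvPolynomial.eval₂Hom_X', hg.extend_apply, RingHom.comp_apply, AlgHom.toRingHom_eq_coe,
          RingHom.coe_coe, ← MvPolynomial.rename_X (R := K), MvPolynomial.killCompl_rename_app,
          MvPolynomial.eval₂Hom_X']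
      · rw [MvPolynomial.eval₂Hom_X', Function.extend_apply' _ _ _ hi]
        simp [MvPolynomial.killCompl, hi]
  exact congr($h p)

variable [DecidableEq ι]

lemma vanishesAt_chartPt_extend (φ : K →+* L) (p : MvPolynomial (ι × Fin 2) K) (M : Set ι)
    (x : {i // i ∉ M} → L) :
    vanishesAt φ p (chartPt M (Function.extend Subtype.val x 0)) ↔
      MvPolynomial.eval₂ φ x (MvPolynomial.killCompl Subtype.val_injective (specZ K M p)) = 0 := by
  rw [vanishesAt_chartPt, eval₂_killCompl]

lemma IrrSubvar.le_vanishingIdeal [Fintype ι] [IsAlgClosed L] {S : Set (ι → OnePoint L)}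
    (hS : IrrSubvar S) (hdim : varDim S ≤ 1) (M : Set ι)
    {𝔯 : Ideal (MvPolynomial {i // i ∉ M} L)} (h𝔯 : 𝔯.IsPrime)
    (h𝔯S : ∀ x ∈ MvPolynomial.zeroLocus L 𝔯, chartPt M (Function.extend Subtype.val x 0) ∈ S)
    (hnt : (MvPolynomial.zeroLocus L 𝔯).Nontrivial) :
    𝔯 ≤ MvPolynomial.vanishingIdeal L
      {x | chartPt M (Function.extend Subtype.val x 0) ∈ S} := by
  have hinj : Function.Injective fun x : {i // i ∉ M} → L =>
      chartPt M (Function.extend Subtype.val x 0) := by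
    intro x y h
    funext i
    have := congr_fun h i
    simp only [chartPt, i.2, if_false, OnePoint.coe_eq_coe] at this
    rwa [Subtype.val_injective.extend_apply, Subtype.val_injective.extend_apply] at this
  intro g hg x hx
  have hM : ∀ i ∈ M, (MvPolynomial.rename Subtype.val g : MvPolynomial ι L).degreeOf i = 0 := by
    intro i hi
    by_contra h
    rw [← ne_eq, ← MvPolynomial.mem_vars_iff_degreeOf_ne_zero] at h
    have := MvPolynomial.vars_rename Subtype.val g h
    obtain ⟨j, -, rfl⟩ := Finset.mem_image.1 this
    exact j.2 hi
  have key : ∀ x : {i // i ∉ M} → L, vanishesAt (RingHom.id L)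
      (homog (fun _ => 1) (MvPolynomial.rename Subtype.val g))
      (chartPt M (Function.extend Subtype.val x 0)) ↔ MvPolynomial.aeval x g = 0 := by
    intro x
    rw [vanishesAt_homog_chartPt _ hM, MvPolynomial.eval₂_rename]
    have : (Function.extend Subtype.val x 0 : ι → L) ∘ Subtype.val = x :=
      Function.extend_comp Subtype.val_injective x 0
    rw [this]
    rfl
  rw [← key]
  refine hS.vanishesAt_of_subset (W := (fun x : {i // i ∉ M} → L =>
      chartPt M (Function.extend Subtype.val x 0)) '' MvPolynomial.zeroLocus L 𝔯) hdim
    (by rintro _ ⟨x, hx, rfl⟩; exact h𝔯S x hx) (hnt.image hinj) ?_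
    (multiHomog_homog _ _) ?_ _ hx
  · intro p q hp hq h
    simp only [Set.forall_mem_image, vanishesAt_chartPt_extend] at h ⊢
    have hmem : ∀ p, p ∈ 𝔯 ↔ ∀ x ∈ MvPolynomial.zeroLocus L 𝔯,
        MvPolynomial.eval₂ (RingHom.id L) x p = 0 := by
      intro p
      conv_lhs => rw [← MvPolynomial.IsPrime.vanishingIdeal_zeroLocus (K := L) 𝔯]
      rfl
    rw [← hmem, ← hmem]
    refine h𝔯.mem_or_mem ((hmem _).2 fun x hx => ?_)
    rw [MvPolynomial.eval₂_mul, mul_eq_zero]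
    exact h hx
  · simp only [Set.forall_mem_image, key]
    exact fun x hx => hx g hg

end StratumIdeal

section CurveIdeal

variable {K : Type} [Field K] {ι : Type} [DecidableEq ι]

/-- The ideal over `K` of the stratum of a closed subvariety where exactly the coordinates in `M`
are infinite. -/
noncomputable def ClosedSubvar.stratumIdeal (V : ClosedSubvar K ι) (M : Set ι) :
    Ideal (MvPolynomial {i // i ∉ M} K) :=
  MvPolynomial.vanishingIdeal K {x : {i // i ∉ M} → AlgebraicClosure K |
    chartPt M (Function.extend Subtype.val x 0) ∈ V.pts (algebraMap K (AlgebraicClosure K))}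

lemma ClosedSubvar.mem_stratumIdeal {V : ClosedSubvar K ι} {M : Set ι}
    {g : MvPolynomial {i // i ∉ M} K} : g ∈ V.stratumIdeal M ↔
      ∀ x, chartPt M (Function.extend Subtype.val x 0) ∈ V.pts (algebraMap K (AlgebraicClosure K)) →
        MvPolynomial.eval₂ (algebraMap K (AlgebraicClosure K)) x g = 0 := Iff.rfl

lemma ClosedSubvar.killCompl_mem_stratumIdeal {V : ClosedSubvar K ι} (M : Set ι)
    {p : MvPolynomial (ι × Fin 2) K} (hp : p ∈ V.polys) :
    MvPolynomial.killCompl Subtype.val_injective (specZ K M p) ∈ V.stratumIdeal M :=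
  mem_stratumIdeal.2 fun _ hx => (vanishesAt_chartPt_extend _ p M _).1 (hx p hp)

lemma exists_isPrime_map_mem_iff {σ : Type} {L : Type} [Field L] [Algebra K L]
    [Algebra.IsAlgebraic K L] (𝔯 : Ideal (MvPolynomial σ K)) (h𝔯 : 𝔯.IsPrime) :
    ∃ 𝔔 : Ideal (MvPolynomial σ L), 𝔔.IsPrime ∧
      ∀ g, MvPolynomial.map (algebraMap K L) g ∈ 𝔔 ↔ g ∈ 𝔯 := by
  let := MvPolynomial.algebraMvPolynomial (σ := σ) (R := K) (S := L)
  have : Algebra.IsIntegral (MvPolynomial σ K) (MvPolynomial σ L) := inferInstance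
  obtain ⟨𝔔, h𝔔, h⟩ := Ideal.exists_ideal_over_prime_of_isIntegral_of_isDomain
    (S := MvPolynomial σ L) 𝔯 (by
      rw [(RingHom.injective_iff_ker_eq_bot _).1
        (show Function.Injective (algebraMap (MvPolynomial σ K) (MvPolynomial σ L)) from
          MvPolynomial.map_injective _ (algebraMap K L).injective)]
      exact bot_le)
  exact ⟨𝔔, h𝔔, fun g => by rw [← h]; rfl⟩

lemma ClosedSubvar.isCurveIdeal_stratumIdeal [Fintype ι] (V : ClosedSubvar K ι)
    (hVirr : IrrSubvar (V.pts (algebraMap K (AlgebraicClosure K))))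
    (hVdim : varDim (V.pts (algebraMap K (AlgebraicClosure K))) ≤ 1) (M : Set ι) :
    IsCurveIdeal (V.stratumIdeal M) := by
  intro 𝔯 h𝔯 hle j hj
  set φ := algebraMap K (AlgebraicClosure K)
  obtain ⟨𝔔, h𝔔, hmem⟩ := exists_isPrime_map_mem_iff (L := AlgebraicClosure K) 𝔯 h𝔯
  have hvan := MvPolynomial.IsPrime.vanishingIdeal_zeroLocus (K := AlgebraicClosure K) 𝔔
  have hS : ∀ x ∈ MvPolynomial.zeroLocus (AlgebraicClosure K) 𝔔,
      chartPt M (Function.extend Subtype.val x 0) ∈ V.pts φ := by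
    intro x hx p hp
    rw [vanishesAt_chartPt_extend, ← MvPolynomial.eval_map]
    exact hx _ ((hmem _).2 (hle (V.killCompl_mem_stratumIdeal M hp)))
  have hnt : (MvPolynomial.zeroLocus (AlgebraicClosure K) 𝔔).Nontrivial := by
    rw [← Set.not_subsingleton_iff]
    intro hsub
    have hne : (MvPolynomial.zeroLocus (AlgebraicClosure K) 𝔔).Nonempty := by
      by_contra h
      rw [Set.not_nonempty_iff_eq_empty] at h
      rw [h, MvPolynomial.vanishingIdeal_empty] at hvan
      exact h𝔔.ne_top hvan.symm
    obtain ⟨z, hz⟩ := hne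
    have h_int : IsIntegral K (z j) := Algebra.IsIntegral.isIntegral _
    refine minpoly.ne_zero h_int (hj _ ((hmem _).1 ?_))
    rw [← hvan]
    intro x hx
    rw [hsub hx hz]
    have : MvPolynomial.map φ (aeval (MvPolynomial.X j) (minpoly K (z j))) =
        aeval (MvPolynomial.X j) ((minpoly K (z j)).map φ) := by
      rw [Polynomial.aeval_def, Polynomial.hom_eval₂, Polynomial.aeval_def, Polynomial.eval₂_map,
        MvPolynomial.map_X]
      congr 1
      ext r
      simp
    rw [this]
    change MvPolynomial.eval z _ = 0
    rw [eval_aeval_X, Polynomial.eval_map]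
    exact minpoly.aeval K (z j)
  intro g hg
  rw [mem_stratumIdeal]
  intro x hx
  have := hVirr.le_vanishingIdeal hVdim M h𝔔 hS hnt ((hmem g).2 hg) x hx
  rw [← MvPolynomial.eval_map]
  exact this

lemma ClosedSubvar.diagPull_mem_stratumIdeal {V : ClosedSubvar K ι} {M : Set ι} {f : K[X]}
    {a b : ℕ}
    (h : ∀ x, chartPt M x ∈ V.pts (algebraMap K (AlgebraicClosure K)) →
      ∃ y, chartPt M y ∈ V.pts (algebraMap K (AlgebraicClosure K)) ∧
        ∀ i ∉ M, (f.map (algebraMap K (AlgebraicClosure K))).eval^[a] (y i) =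
          (f.map (algebraMap K (AlgebraicClosure K))).eval^[b] (x i))
    {A : MvPolynomial {i // i ∉ M} K}
    (hA : diagPull _ (f.comp^[a] X) A ∈ V.stratumIdeal M) :
    diagPull _ (f.comp^[b] X) A ∈ V.stratumIdeal M := by
  rw [mem_stratumIdeal] at hA ⊢
  intro x hx
  obtain ⟨y, hy, hxy⟩ := h _ hx
  have := hA (fun i => y i) (by rwa [chartPt_extend])
  rw [eval₂_diagPull_iterate] at this ⊢
  convert this using 3 with i
  rw [hxy i i.2, Subtype.val_injective.extend_apply]

end CurveIdeal

namespace ProductFormula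

open Filter

variable {K : Type} [Field K] {F : ProductFormula K} [CharZero K]

theorem IsOver.infinitelyManyPlaces_of_curve {κ : Subfield K} (hF : F.IsOver κ) {n : ℕ}
    {f : K[X]} (hd : 2 ≤ f.natDegree)
    (hf : ¬ ∃ a c, f.map (algebraMap K (AlgebraicClosure K)) =
      C a * (X - C c) ^ f.natDegree + C c)
    (V : ClosedSubvar K (Fin n))
    (hVirr : IrrSubvar (V.pts (algebraMap K (AlgebraicClosure K))))
    (hVpre : SubvarPreperiodic (f.map (algebraMap K (AlgebraicClosure K)))
      (V.pts (algebraMap K (AlgebraicClosure K))))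
    (hVdim : varDim (V.pts (algebraMap K (AlgebraicClosure K))) ≤ 1)
    (M : Set (Fin n)) (a : Fin n → K)
    (hP : V.pts (RingHom.id K) ∩ fwdOrbit (splitMap f) (chartPt M a) = ∅) :
    InfinitelyManyPlaces K κ fun w => OrbitClosureAvoids w f (chartPt M a) V := by
  classical
  obtain ⟨m, k, hm, hmk⟩ := hVpre.exists_iterate_eq
  obtain ⟨𝒜, h𝒜, T, hT, hlow⟩ := F.exists_lower_bound_of_isCurveIdeal (𝔞 := V.stratumIdeal M)
    (a := fun i => a i) hd hf
    (V.isCurveIdeal_stratumIdeal hVirr hVdim M) hm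
    (fun A => ClosedSubvar.diagPull_mem_stratumIdeal fun x hx => (hmk M x hx).2) fun s => by
      have : chartPt M (fun i => f.eval^[s] (a i)) ∉ V.pts (RingHom.id K) := fun hs => by
        have : chartPt M (fun i => f.eval^[s] (a i)) ∈
            V.pts (RingHom.id K) ∩ fwdOrbit (splitMap f) (chartPt M a) :=
          ⟨hs, s, splitMap_iterate_chartPt f M a s⟩
        rwa [hP] at this
      simp only [ClosedSubvar.pts, Set.mem_ofPred_eq, not_forall] at this
      obtain ⟨p, hp, hps⟩ := this
      refine ⟨_, ClosedSubvar.killCompl_mem_stratumIdeal M hp, ?_⟩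
      rwa [← chartPt_extend, vanishesAt_chartPt_extend] at hps
  refine hF.infinitelyManyPlaces f V M a hP (𝒜.image (MvPolynomial.rename Subtype.val))
    (fun A hA x hx => ?_) hT (hlow.mono fun i h hi => ?_)
  · obtain ⟨B, hB, rfl⟩ := Finset.mem_image.1 hA
    rw [MvPolynomial.aeval_rename]
    exact ClosedSubvar.mem_stratumIdeal.1 (h𝒜 B hB) (fun i => x i) (by rwa [chartPt_extend])
  · obtain ⟨c, hc, s₀, hs₀⟩ := h hi
    refine ⟨c, hc, s₀, fun s hs => ?_⟩
    obtain ⟨A, hA, h⟩ := hs₀ s hs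
    refine ⟨_, Finset.mem_image_of_mem _ hA, ?_⟩
    rwa [MvPolynomial.eval_rename]

end ProductFormula

namespace IsDedekindDomain.HeightOneSpectrum
open scoped NNReal

variable {B K : Type} [CommRing B] [IsDedekindDomain B] [Field K] [Algebra B K] [IsFractionRing B K]

lemma finite_adicAbv_ne_one {b : HeightOneSpectrum B → ℝ≥0} (hb : ∀ v, 1 < b v) {x : K}
    (hx : x ≠ 0) : {v : HeightOneSpectrum B | v.adicAbv (hb v) x ≠ 1}.Finite := by
  have h_int : ∀ y : B, y ≠ 0 →
      {v : HeightOneSpectrum B | v.adicAbv (hb v) (algebraMap B K y) ≠ 1}.Finite := by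
    intro y hy
    refine (Ideal.finite_factors (I := Ideal.span {y}) (by simpa using hy)).subset ?_
    intro v hv
    have hv' : v.adicAbv (hb v) (algebraMap B K y) ≠ 1 := hv
    rw [Ne, v.adicAbv_coe_eq_one_iff (hb v), not_not] at hv'
    exact Ideal.dvd_iff_le.2 ((Ideal.span_singleton_le_iff_mem _).2 hv')
  obtain ⟨y, z, hz, rfl⟩ := IsFractionRing.div_surjective (A := B) x
  have hz0 : z ≠ 0 := nonZeroDivisors.ne_zero hz
  have hy0 : y ≠ 0 := by
    rintro rfl
    simp at hx
  refine ((h_int y hy0).union (h_int z hz0)).subset ?_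
  intro v hv
  by_contra h
  simp only [Set.mem_union, Set.mem_ofPred_eq, not_or, not_not] at h
  exact hv (by rw [map_div₀, h.1, h.2, div_one])

lemma exists_adicAbv_ne_one (v : HeightOneSpectrum B) {b : ℝ≥0} (hb : 1 < b) :
    ∃ x : K, x ≠ 0 ∧ v.adicAbv hb x ≠ 1 := by
  obtain ⟨x, hx, hx0⟩ := Submodule.exists_mem_ne_zero_of_ne_bot v.ne_bot
  exact ⟨algebraMap B K x, by simpa using hx0, ((v.adicAbv_coe_lt_one_iff hb x).2 hx).ne⟩

lemma exists_adicAbv_lt_one_not_lt_one {v v' : HeightOneSpectrum B} (h : v ≠ v') {b b' : ℝ≥0}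
    (hb : 1 < b) (hb' : 1 < b') : ∃ x : K, v.adicAbv hb x < 1 ∧ ¬ v'.adicAbv hb' x < 1 := by
  have hle : ¬ v.asIdeal ≤ v'.asIdeal := fun hle =>
    h (HeightOneSpectrum.ext (v.isMaximal.eq_of_le v'.isPrime.ne_top hle))
  obtain ⟨x, hx, hx'⟩ := SetLike.not_le_iff_exists.1 hle
  exact ⟨algebraMap B K x, (v.adicAbv_coe_lt_one_iff hb x).2 hx,
    fun h => hx' ((v'.adicAbv_coe_lt_one_iff hb' x).1 h)⟩

lemma adicAbv_algebraMap_eq_inv_pow (v : HeightOneSpectrum B) {b : ℝ≥0} (hb : 1 < b) {x : B}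
    (hx : x ≠ 0) : v.adicAbv hb (algebraMap B K x) =
      ((b⁻¹ ^ (Associates.mk v.asIdeal).count (Associates.mk (Ideal.span {x})).factors : ℝ≥0) : ℝ) := by
  rw [v.adicAbv_of_algebraMap hb x]
  change ((WithZeroMulInt.toNNReal (ne_zero_of_lt hb) (v.intValuation x) : ℝ≥0) : ℝ) = _
  have hexp : ∀ k : ℤ, WithZeroMulInt.toNNReal (ne_zero_of_lt hb) (WithZero.exp k) = b ^ k :=
    fun k => by
      rw [WithZeroMulInt.toNNReal_neg_apply _ WithZero.exp_ne_zero]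
      rfl
  rw [intValuation_if_neg v hx, hexp, zpow_neg, zpow_natCast, inv_pow]

/-- The product of the absolute values of `x`, normalized by a multiplicative function on ideals
and leaving out the primes where that function is trivial. -/
lemma finprod_adicAbv {b : HeightOneSpectrum B → ℝ≥0} (hb : ∀ v, 1 < b v) (β : Ideal B →* ℝ≥0)
    (T : Set (HeightOneSpectrum B)) (hT : ∀ v ∈ T, β v.asIdeal = (b v)⁻¹)
    (hT' : ∀ v ∉ T, β v.asIdeal = 1) {x : B} (hx : x ≠ 0) :
    ∏ᶠ v ∈ T, v.adicAbv (hb v) (algebraMap B K x) = β (Ideal.span {x}) := by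
  have hI : Ideal.span {x} ≠ 0 := by simpa using hx
  conv_rhs => rw [← Ideal.finprod_heightOneSpectrum_factorization hI]
  have hfin := Ideal.hasFiniteMulSupport hI
  let γ : Ideal B →* ℝ := (NNReal.toRealHom : ℝ≥0 →* ℝ).comp β
  change _ = γ _
  rw [γ.map_finprod hfin]
  refine finprod_congr fun v => ?_
  change _ = ((β _ : ℝ≥0) : ℝ)
  rw [maxPowDividing, map_pow]
  by_cases hv : v ∈ T
  · simp only [hv, finprod_true]
    rw [hT v hv, v.adicAbv_algebraMap_eq_inv_pow (hb v) hx]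
  · simp only [hv, finprod_false]
    rw [hT' v hv, one_pow, NNReal.coe_one]

lemma finprod_adicAbv_div {b : HeightOneSpectrum B → ℝ≥0} (hb : ∀ v, 1 < b v) (β : Ideal B →* ℝ≥0)
    (T : Set (HeightOneSpectrum B)) (hT : ∀ v ∈ T, β v.asIdeal = (b v)⁻¹)
    (hT' : ∀ v ∉ T, β v.asIdeal = 1) {x y : B} (hx : x ≠ 0) (hy : y ≠ 0) :
    (∏ᶠ v ∈ T, v.adicAbv (hb v) (algebraMap B K x / algebraMap B K y)) * β (Ideal.span {y}) =
      β (Ideal.span {x}) := by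
  have hs : ∀ z : K, z ≠ 0 →
      (T ∩ Function.mulSupport fun v => v.adicAbv (hb v) z).Finite := fun z hz =>
    (finite_adicAbv_ne_one hb hz).subset fun v hv => hv.2
  have hx' : algebraMap B K x ≠ 0 := by simpa using hx
  have hy' : algebraMap B K y ≠ 0 := by simpa using hy
  rw [← finprod_adicAbv (K := K) hb β T hT hT' hx, ← finprod_adicAbv (K := K) hb β T hT hT' hy,
    ← finprod_mem_mul_distrib' (hs _ (div_ne_zero hx' hy')) (hs _ hy')]
  simp_rw [← map_mul, div_mul_cancel₀ _ hy']

end IsDedekindDomain.HeightOneSpectrum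

lemma infinite_heightOneSpectrum {B : Type} [CommRing B] [IsDomain B] {p : ℕ → B}
    (h0 : ∀ k, p k ≠ 0) (hu : ∀ k, ¬ IsUnit (p k)) (hc : ∀ j k, j ≠ k → IsCoprime (p j) (p k)) :
    Infinite (IsDedekindDomain.HeightOneSpectrum B) := by
  choose I hI hmem using fun k => exists_max_ideal_of_mem_nonunits (hu k)
  refine Infinite.of_injective
    (fun k => (⟨I k, (hI k).isPrime, fun h => h0 k (by simpa [h] using hmem k)⟩ :
      IsDedekindDomain.HeightOneSpectrum B)) fun j k hjk => ?_
  by_contra hne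
  have hjk' : I j = I k := congrArg IsDedekindDomain.HeightOneSpectrum.asIdeal hjk
  obtain ⟨x, y, hxy⟩ := hc j k hne
  refine (hI j).ne_top ((Ideal.eq_top_iff_one _).2 (hxy ▸ ?_))
  exact (I j).add_mem ((I j).mul_mem_left _ (hmem j)) ((I j).mul_mem_left _ (hjk' ▸ hmem k))

lemma infinite_heightOneSpectrum_of_isIntegral {A B : Type} [CommRing A] [CommRing B] [IsDomain B]
    [Algebra A B] [Algebra.IsIntegral A B] [FaithfulSMul A B] {p : ℕ → A}
    (h0 : ∀ k, p k ≠ 0) (hu : ∀ k, ¬ IsUnit (p k)) (hc : ∀ j k, j ≠ k → IsCoprime (p j) (p k)) :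
    Infinite (IsDedekindDomain.HeightOneSpectrum B) := by
  refine infinite_heightOneSpectrum (p := fun k => algebraMap A B (p k)) (fun k => ?_)
    (fun k h => hu k ?_) fun j k hjk => (hc j k hjk).map (algebraMap A B)
  · simpa using h0 k
  · exact (Algebra.IsIntegral.isLocalHom (R := A) (S := B)).map_nonunit _ h

section NumberField
open NumberField

variable (K : Type) [Field K] [NumberField K]

instance infinite_heightOneSpectrum_ringOfIntegers :
    Infinite (IsDedekindDomain.HeightOneSpectrum (𝓞 K)) := by
  refine infinite_heightOneSpectrum_of_isIntegral (A := ℤ) (p := fun k => (Nat.nth Nat.Prime k : ℤ))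
    (fun k => ?_) (fun k h => ?_) fun j k hjk => ?_
  · exact_mod_cast (Nat.prime_nth_prime k).ne_zero
  · exact (Nat.prime_iff_prime_int.1 (Nat.prime_nth_prime k)).not_isUnit h
  · refine Nat.isCoprime_iff_coprime.2 ((Nat.coprime_primes (Nat.prime_nth_prime j)
      (Nat.prime_nth_prime k)).2 fun h => hjk ?_)
    exact Nat.nth_injective Nat.infinite_setOfPred_prime h

/-- The product formula of a number field. -/
noncomputable def NumberField.productFormula : ProductFormula K where
  ι := IsDedekindDomain.HeightOneSpectrum (𝓞 K)
  J := InfinitePlace K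
  fin v := v.adicAbv (NumberField.HeightOneSpectrum.one_lt_absNorm_nnreal v)
  inf w := w.1
  wt w := w.mult
  wt_pos w := w.mult_pos
  nonarch v x y := v.isNonarchimedean_adicAbv _ x y
  finite x hx := IsDedekindDomain.HeightOneSpectrum.finite_adicAbv_ne_one _ hx
  prod x hx := by
    rw [mul_comm, ← NumberField.prod_abs_eq_one hx]
    congr 1
    rw [← finprod_comp_equiv FinitePlace.equivHeightOneSpectrum.symm]
    refine finprod_congr fun v => ?_
    rw [FinitePlace.equivHeightOneSpectrum_symm_apply, FinitePlace.norm_embedding]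
    rfl

lemma NumberField.productFormula_isOver (κ : Subfield K) : (productFormula K).IsOver κ where
  nontrivial v := IsDedekindDomain.HeightOneSpectrum.exists_adicAbv_ne_one v _
  not_equiv _ _ h := IsDedekindDomain.HeightOneSpectrum.exists_adicAbv_lt_one_not_lt_one h _ _
  isPlaceOver := Or.inl inferInstance

end NumberField

open scoped NNReal

section IdealWeight
lemma map_eq_of_associated {A : Type} [CommRing A] {w : A →*₀ ℝ≥0} (hw : ∀ a, IsUnit a → w a = 1) {a b : A}
    (h : Associated a b) : w a = w b := by
  obtain ⟨u, rfl⟩ := h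
  rw [map_mul, hw u u.isUnit, mul_one]

variable {A : Type} [CommRing A] [IsDomain A] [IsPrincipalIdealRing A]

/-- The multiplicative extension to ideals of a multiplicative function trivial on units. -/
noncomputable def idealWeight (w : A →*₀ ℝ≥0) (hw : ∀ a, IsUnit a → w a = 1) : Ideal A →* ℝ≥0 where
  toFun I := w (Submodule.IsPrincipal.generator I)
  map_one' := by
    refine hw _ ?_
    rw [← Ideal.span_singleton_eq_top, Ideal.span_singleton_generator, Ideal.one_eq_top]
  map_mul' I J := by
    rw [← map_mul]
    refine map_eq_of_associated hw ?_
    rw [← Ideal.span_singleton_eq_span_singleton, Ideal.span_singleton_generator,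
      ← Ideal.span_singleton_mul_span_singleton, Ideal.span_singleton_generator,
      Ideal.span_singleton_generator]

lemma idealWeight_span (w : A →*₀ ℝ≥0) (hw : ∀ a, IsUnit a → w a = 1) (a : A) :
    idealWeight w hw (Ideal.span {a}) = w a :=
  map_eq_of_associated hw (Submodule.IsPrincipal.associated_generator_span_self a)

end IdealWeight

section PrimeWeight
open IsDedekindDomain

variable {A : Type} [CommRing A] [IsDomain A] [IsPrincipalIdealRing A]
  {B : Type} [CommRing B] [IsDedekindDomain B] [Algebra A B] [Module.Finite A B]
  [Module.IsTorsionFree A B]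
  (w : A →*₀ ℝ≥0) (hw : ∀ a, IsUnit a → w a = 1)

/-- The pullback of `idealWeight` along the relative norm. -/
noncomputable def primeWeight : Ideal B →* ℝ≥0 :=
  (idealWeight w hw).comp (Ideal.relNorm A : Ideal B →*₀ Ideal A)

lemma primeWeight_span (x : B) :
    primeWeight w hw (Ideal.span {x}) = w (Algebra.intNorm A B x) := by
  change idealWeight w hw (Ideal.relNorm A (Ideal.span {x})) = _
  rw [Ideal.relNorm_singleton, idealWeight_span]

lemma primeWeight_ne_zero (h0 : ∀ a ≠ 0, w a ≠ 0) (v : HeightOneSpectrum B) :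
    primeWeight w hw v.asIdeal ≠ 0 := by
  refine h0 _ fun h => v.ne_bot ?_
  rw [← Submodule.IsPrincipal.eq_bot_iff_generator_eq_zero] at h
  exact Ideal.relNorm_eq_bot_iff.1 h

lemma primeWeight_lt_one (h : ∀ a, ¬ IsUnit a → w a < 1) (v : HeightOneSpectrum B) :
    primeWeight w hw v.asIdeal < 1 := by
  refine h _ fun hu => v.isPrime.ne_top ?_
  rw [← Ideal.span_singleton_eq_top, Ideal.span_singleton_generator] at hu
  have := Ideal.relNorm_le_comap A v.asIdeal
  change Ideal.relNorm A v.asIdeal = ⊤ at hu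
  rw [hu, top_le_iff, Ideal.comap_eq_top_iff] at this
  exact this

lemma mem_of_primeWeight_lt_one {ϖ : A} (hϖ : Prime ϖ) (h : ∀ a, w a < 1 → ϖ ∣ a)
    (v : HeightOneSpectrum B) (hv : primeWeight w hw v.asIdeal < 1) :
    algebraMap A B ϖ ∈ v.asIdeal := by
  by_contra hmem
  have hirr : Irreducible ϖ := hϖ.irreducible
  have := PrincipalIdealRing.isMaximal_of_irreducible hirr
  let I := v.asIdeal.comap (algebraMap A B)
  have hprime : v.asIdeal.IsPrime := v.isPrime
  have hI : I ≠ ⊥ := Ideal.comap_ne_bot_of_algebraic_mem (x := Classical.choose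
    (Submodule.exists_mem_ne_zero_of_ne_bot v.ne_bot))
    (Classical.choose_spec (Submodule.exists_mem_ne_zero_of_ne_bot v.ne_bot)).2
    (Classical.choose_spec (Submodule.exists_mem_ne_zero_of_ne_bot v.ne_bot)).1
    (Algebra.IsIntegral.isIntegral (R := A) _).isAlgebraic
  have hImax : I.IsMaximal := IsPrime.to_maximal_ideal hI
  have hne : ¬ I ≤ Ideal.span {ϖ} := fun hle => hmem (by
    have hIe := hImax.eq_of_le this.ne_top hle
    have : ϖ ∈ I := by rw [hIe]; exact Ideal.mem_span_singleton_self ϖ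
    exact this)
  obtain ⟨m, hm, hm'⟩ := SetLike.not_le_iff_exists.1 hne
  have hdvd : ϖ ∣ Submodule.IsPrincipal.generator (Ideal.relNorm A v.asIdeal) := h _ hv
  have hN : Algebra.intNorm A B (algebraMap A B m) ∈ Ideal.relNorm A v.asIdeal := by
    rw [Ideal.relNorm_apply]
    exact Ideal.subset_span ⟨_, hm, rfl⟩
  rw [← Ideal.span_singleton_generator (Ideal.relNorm A v.asIdeal), Ideal.mem_span_singleton] at hN
  let : Algebra (FractionRing A) (FractionRing B) := FractionRing.liftAlgebra A (FractionRing B)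
  have hpow : Algebra.intNorm A B (algebraMap A B m) =
      m ^ Module.finrank (FractionRing A) (FractionRing B) := by
    apply FaithfulSMul.algebraMap_injective A (FractionRing A)
    rw [Algebra.algebraMap_intNorm_fractionRing, ← IsScalarTower.algebraMap_apply,
      IsScalarTower.algebraMap_apply A (FractionRing A) (FractionRing B), Algebra.norm_algebraMap,
      map_pow]
  rw [hpow] at hN
  exact hm' (Ideal.mem_span_singleton.2 (hϖ.dvd_of_dvd_pow (hdvd.trans hN)))

lemma finite_primeWeight_lt_one {ϖ : A} (hϖ : Prime ϖ) (h : ∀ a, w a < 1 → ϖ ∣ a) :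
    {v : HeightOneSpectrum B | primeWeight w hw v.asIdeal < 1}.Finite := by
  have h0 : algebraMap A B ϖ ≠ 0 := by simpa using hϖ.ne_zero
  refine (Ideal.finite_factors (I := Ideal.span {algebraMap A B ϖ}) (by simpa using h0)).subset ?_
  intro v hv
  exact Ideal.dvd_iff_le.2 ((Ideal.span_singleton_le_iff_mem _).2
    (mem_of_primeWeight_lt_one w hw hϖ h v hv))

end PrimeWeight

open scoped NNReal

/-- A family of pairwise inequivalent nontrivial nonarchimedean absolute values on `K`, bounded by
`1` on the image of `φ`, whose product at `x` is the value at the norm of `x` of the multiplicative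
function `w`. -/
structure WeightedFamily {A E : Type} (K : Type) [CommRing A] [Field E] [Field K]
    [Algebra E K] (φ : A →+* E) (w : A →*₀ ℝ≥0) where
  ι : Type
  abv : ι → AbsoluteValue K ℝ
  nonarch : ∀ i x y, abv i (x + y) ≤ max (abv i x) (abv i y)
  nontrivial : ∀ i, ∃ x : K, x ≠ 0 ∧ abv i x ≠ 1
  not_equiv : ∀ i i', i ≠ i' → ∃ x : K, abv i x < 1 ∧ ¬ abv i' x < 1
  finite : ∀ x ≠ 0, {i | abv i x ≠ 1}.Finite
  le_one : ∀ i a, abv i (algebraMap E K (φ a)) ≤ 1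
  prod : ∀ x ≠ 0, ∀ p q : A, p ≠ 0 → q ≠ 0 →
    φ q * Algebra.norm E x = φ p → (∏ᶠ i, abv i x) * w q = w p
  infinite : (∀ a, ¬ IsUnit a → w a < 1) → (∃ p : ℕ → A, (∀ k, p k ≠ 0) ∧ (∀ k, ¬ IsUnit (p k)) ∧
    ∀ j k, j ≠ k → IsCoprime (p j) (p k)) → Infinite ι
  finite_index : (∃ ϖ, Prime ϖ ∧ ∀ a, w a < 1 → ϖ ∣ a) → Finite ι

open IsDedekindDomain in
theorem nonempty_weightedFamily {A E K : Type} [CommRing A] [IsDomain A] [IsPrincipalIdealRing A]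
    [Field E] [Field K] [CharZero E] [Algebra E K] [FiniteDimensional E K] {φ : A →+* E}
    (hφ : Function.Injective φ) (hφ' : ∀ x, ∃ a b, x = φ a / φ b)
    {w : A →*₀ ℝ≥0} (hw : ∀ a, IsUnit a → w a = 1)
    (h0 : ∀ a ≠ 0, w a ≠ 0) (h1 : ∀ a, w a ≤ 1) : Nonempty (WeightedFamily K φ w) := by
  let : Algebra A E := φ.toAlgebra
  let : Algebra A K := ((algebraMap E K).comp φ).toAlgebra
  have : IsScalarTower A E K := IsScalarTower.of_algebraMap_eq fun _ => rfl
  have : FaithfulSMul A E := (faithfulSMul_iff_algebraMap_injective A E).2 hφ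
  have : IsFractionRing A E := IsFractionRing.of_field A E fun x => by
    obtain ⟨a, b, h⟩ := hφ' x
    exact ⟨a, b, h⟩
  let B := integralClosure A K
  have : IsDedekindDomain B := integralClosure.isDedekindDomain A E K
  have : IsFractionRing B K := IsIntegralClosure.isFractionRing_of_finite_extension A E K B
  have : Module.Finite A B := IsIntegralClosure.finite A E K B
  have : FaithfulSMul A K := (faithfulSMul_iff_algebraMap_injective A K).2 (by
    rw [IsScalarTower.algebraMap_eq A E K]
    exact (algebraMap E K).injective.comp (IsFractionRing.injective A E))
  let β : Ideal B →* ℝ≥0 := primeWeight w hw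
  let b : HeightOneSpectrum B → ℝ≥0 := fun v =>
    if β v.asIdeal < 1 then (β v.asIdeal)⁻¹ else 2
  have hβ0 : ∀ v : HeightOneSpectrum B, β v.asIdeal ≠ 0 := primeWeight_ne_zero w hw h0
  have hb : ∀ v, 1 < b v := by
    intro v
    by_cases h : β v.asIdeal < 1
    · simp only [b, if_pos h]
      exact (one_lt_inv₀ (pos_iff_ne_zero.2 (hβ0 v))).2 h
    · simp only [b, if_neg h]
      exact one_lt_two
  let T : Set (HeightOneSpectrum B) := {v | β v.asIdeal < 1}
  have hT : ∀ v ∈ T, β v.asIdeal = (b v)⁻¹ := fun v hv => by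
    have hv' : β v.asIdeal < 1 := hv
    simp only [b, if_pos hv', inv_inv]
  have hT' : ∀ v ∉ T, β v.asIdeal = 1 := fun v hv =>
    le_antisymm (h1 _) (not_lt.1 hv)
  refine ⟨{
    ι := T
    abv := fun v => v.1.adicAbv (hb v.1)
    nonarch := fun v x y => v.1.isNonarchimedean_adicAbv (hb v.1) x y
    nontrivial := fun v => v.1.exists_adicAbv_ne_one (hb v.1)
    not_equiv := fun v v' h => HeightOneSpectrum.exists_adicAbv_lt_one_not_lt_one
      (fun h' => h (Subtype.ext h')) (hb v.1) (hb v'.1)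
    finite := fun x hx => (HeightOneSpectrum.finite_adicAbv_ne_one hb hx).preimage
      Subtype.val_injective.injOn
    le_one := fun v a => by
      change v.1.adicAbv (hb v.1) (algebraMap A K a) ≤ 1
      rw [IsScalarTower.algebraMap_apply A B K]
      exact v.1.adicAbv_coe_le_one (hb v.1) _
    prod := fun x hx p q hp hq hpq => ?_
    infinite := fun hlt ⟨p, hp0, hpu, hpc⟩ => ?_
    finite_index := fun ⟨ϖ, hϖ, h⟩ => (finite_primeWeight_lt_one w hw hϖ h).to_subtype }⟩
  · obtain ⟨y, z, hz, rfl⟩ := IsFractionRing.div_surjective (A := B) x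
    have hz0 : z ≠ 0 := nonZeroDivisors.ne_zero hz
    have hy0 : y ≠ 0 := by
      rintro rfl
      simp at hx
    have hmul := HeightOneSpectrum.finprod_adicAbv_div (K := K) hb β T hT hT' hy0 hz0
    rw [← finprod_set_coe_eq_finprod_mem] at hmul
    have hsy : β (Ideal.span {y}) = w (Algebra.intNorm A B y) := primeWeight_span w hw y
    have hsz : β (Ideal.span {z}) = w (Algebra.intNorm A B z) := primeWeight_span w hw z
    rw [hsy, hsz] at hmul
    have hNz : algebraMap A E (Algebra.intNorm A B z) = Algebra.norm E (algebraMap B K z) :=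
      Algebra.algebraMap_intNorm z
    have hNy : algebraMap A E (Algebra.intNorm A B y) = Algebra.norm E (algebraMap B K y) :=
      Algebra.algebraMap_intNorm y
    have hz' : algebraMap B K z ≠ 0 := by simpa using hz0
    have hNz0 : Algebra.norm E (algebraMap B K z) ≠ 0 := Algebra.norm_ne_zero_iff.2 hz'
    have hcross : q * Algebra.intNorm A B y = p * Algebra.intNorm A B z := by
      apply IsFractionRing.injective A E
      change _ * Algebra.norm E _ = algebraMap A E p at hpq
      rw [map_mul, map_mul, ← hpq, hNy, hNz, mul_assoc, ← map_mul, div_mul_cancel₀ _ hz']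
      rfl
    have hwz : w (Algebra.intNorm A B z) ≠ 0 := h0 _ fun h => hNz0 (by rw [← hNz, h, map_zero])
    have hcross' := congrArg (fun a => ((w a : ℝ≥0) : ℝ)) hcross
    simp only [map_mul, NNReal.coe_mul] at hcross'
    have hwz' : ((w (Algebra.intNorm A B z) : ℝ≥0) : ℝ) ≠ 0 := by exact_mod_cast hwz
    apply mul_right_cancel₀ hwz'
    rw [← hcross', ← hmul]
    ring
  · have hTu : T = Set.univ := Set.eq_univ_of_forall fun v => primeWeight_lt_one w hw hlt v
    have := infinite_heightOneSpectrum_of_isIntegral (B := B) hp0 hpu hpc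
    rw [hTu]
    exact Set.infinite_coe_iff.2 Set.infinite_univ

open scoped NNReal

section PolynomialWeights
variable {k : Type} [Field k]

open Classical in
/-- The exponential `2 ^ (-natDegree)`, multiplicative on polynomials. -/
noncomputable def degreeWeight : k[X] →*₀ ℝ≥0 where
  toFun p := if p = 0 then 0 else (2⁻¹ : ℝ≥0) ^ p.natDegree
  map_zero' := if_pos rfl
  map_one' := by simp
  map_mul' p q := by
    by_cases hp : p = 0
    · simp [hp]
    by_cases hq : q = 0
    · simp [hq]
    rw [if_neg hp, if_neg hq, if_neg (mul_ne_zero hp hq), natDegree_mul hp hq, pow_add]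

lemma degreeWeight_apply {p : k[X]} (hp : p ≠ 0) :
    degreeWeight p = (2⁻¹ : ℝ≥0) ^ p.natDegree := if_neg hp

open Classical in
/-- The exponential `2 ^ (-natTrailingDegree)`, multiplicative on polynomials. -/
noncomputable def trailingWeight : k[X] →*₀ ℝ≥0 where
  toFun p := if p = 0 then 0 else (2⁻¹ : ℝ≥0) ^ p.natTrailingDegree
  map_zero' := if_pos rfl
  map_one' := by simp
  map_mul' p q := by
    by_cases hp : p = 0
    · simp [hp]
    by_cases hq : q = 0
    · simp [hq]
    rw [if_neg hp, if_neg hq, if_neg (mul_ne_zero hp hq), natTrailingDegree_mul hp hq, pow_add]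

lemma trailingWeight_apply {p : k[X]} (hp : p ≠ 0) :
    trailingWeight p = (2⁻¹ : ℝ≥0) ^ p.natTrailingDegree := if_neg hp

lemma inv_two_pow_le_one (n : ℕ) : (2⁻¹ : ℝ≥0) ^ n ≤ 1 :=
  pow_le_one₀ (by simp) (inv_le_one_of_one_le₀ one_le_two)

lemma inv_two_pow_lt_one {n : ℕ} (hn : n ≠ 0) : (2⁻¹ : ℝ≥0) ^ n < 1 :=
  pow_lt_one₀ (by simp) (inv_lt_one_of_one_lt₀ one_lt_two) hn

variable {E : Type} [Field E] [Algebra k E]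

lemma aeval_inv_reverse {t : E} (ht : t ≠ 0) (p : k[X]) :
    aeval t⁻¹ p.reverse * t ^ p.natDegree = aeval t p := by
  let := invertibleOfNonzero ht
  have := eval₂_reverse_mul_pow (algebraMap k E) t p
  rwa [invOf_eq_inv] at this

lemma aeval_inv_reverse_div {t : E} (ht : t ≠ 0) {p q : k[X]}
    (hq : aeval t q ≠ 0) :
    aeval t⁻¹ (q.reverse * X ^ p.natDegree) * (aeval t p / aeval t q) =
      aeval t⁻¹ (p.reverse * X ^ q.natDegree) := by
  have h1 := aeval_inv_reverse ht p
  have h2 := aeval_inv_reverse ht q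
  rw [← h2] at hq
  rw [← h1, ← h2]
  have h3 := left_ne_zero_of_mul hq
  simp only [map_mul, map_pow, aeval_X, inv_pow]
  generalize aeval t⁻¹ p.reverse = a, aeval t⁻¹ q.reverse = b at *
  field_simp

variable {K : Type} [Field K] [Algebra E K]

lemma WeightedFamily.infinite_of_degree [CharZero k] {t : E}
    (W : WeightedFamily K (aeval t : k[X] →ₐ[k] E).toRingHom degreeWeight) : Infinite W.ι := by
  refine W.infinite (fun a ha => ?_) ⟨fun n => X - Polynomial.C (n : k), fun n => X_sub_C_ne_zero _,
    fun n => not_isUnit_X_sub_C _, fun m n hmn => ?_⟩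
  · by_cases ha0 : a = 0
    · simp [ha0]
    · rw [degreeWeight_apply ha0]
      exact inv_two_pow_lt_one fun h => ha (isUnit_iff_degree_eq_zero.2 (by
        rw [degree_eq_natDegree ha0, h, Nat.cast_zero]))
  · exact isCoprime_X_sub_C_of_isUnit_sub (sub_ne_zero.2 fun h => hmn (Nat.cast_injective h)).isUnit

lemma WeightedFamily.finite_of_trailing {t : E}
    (W : WeightedFamily K (aeval t : k[X] →ₐ[k] E).toRingHom trailingWeight) : Finite W.ι := by
  refine W.finite_index ⟨X, prime_X, fun a ha => ?_⟩
  by_cases ha0 : a = 0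
  · simp [ha0]
  rw [trailingWeight_apply ha0] at ha
  rw [X_dvd_iff]
  by_contra h
  rw [natTrailingDegree_eq_zero.2 (Or.inr h), pow_zero] at ha
  exact lt_irrefl _ ha

variable (K) [FiniteDimensional E K] [CharZero E]

lemma nonempty_weightedFamily_degree {t : E} (ht : Transcendental k t)
    (hE : ∀ x : E, ∃ p q : k[X], x = aeval t p / aeval t q) :
    Nonempty (WeightedFamily K (aeval t : k[X] →ₐ[k] E).toRingHom degreeWeight) := by
  refine nonempty_weightedFamily (transcendental_iff_injective.1 ht) hE (fun a ha => ?_)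
    (fun a ha => ?_) fun a => ?_
  · rw [degreeWeight_apply ha.ne_zero, natDegree_eq_zero_of_isUnit ha, pow_zero]
  · rw [degreeWeight_apply ha]
    exact pow_ne_zero _ (by simp)
  · by_cases ha : a = 0
    · simp [ha]
    · rw [degreeWeight_apply ha]
      exact inv_two_pow_le_one _

lemma nonempty_weightedFamily_trailing {t : E} (ht : Transcendental k t)
    (hE : ∀ x : E, ∃ p q : k[X], x = aeval t p / aeval t q) :
    Nonempty (WeightedFamily K (aeval t : k[X] →ₐ[k] E).toRingHom trailingWeight) := by
  refine nonempty_weightedFamily (transcendental_iff_injective.1 ht) hE (fun a ha => ?_)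
    (fun a ha => ?_) fun a => ?_
  · rw [trailingWeight_apply ha.ne_zero, Nat.le_zero.1
      ((natTrailingDegree_le_natDegree a).trans (natDegree_eq_zero_of_isUnit ha).le), pow_zero]
  · rw [trailingWeight_apply ha]
    exact pow_ne_zero _ (by simp)
  · by_cases ha : a = 0
    · simp [ha]
    · rw [trailingWeight_apply ha]
      exact inv_two_pow_le_one _

variable {K}

lemma WeightedFamily.prod_mul_prod_eq_one {t : E} (ht : Transcendental k t)
    (hE : ∀ x : E, ∃ p q : k[X], x = aeval t p / aeval t q)
    (W : WeightedFamily K (aeval t : k[X] →ₐ[k] E).toRingHom degreeWeight)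
    (W' : WeightedFamily K (aeval t⁻¹ : k[X] →ₐ[k] E).toRingHom trailingWeight)
    {x : K} (hx : x ≠ 0) : (∏ᶠ i, W.abv i x) * ∏ᶠ j, W'.abv j x = 1 := by
  have ht0 : t ≠ 0 := by
    rintro rfl
    exact ht isAlgebraic_zero
  have hN : Algebra.norm E x ≠ 0 := Algebra.norm_ne_zero_iff.2 hx
  obtain ⟨p, q, hpq⟩ := hE (Algebra.norm E x)
  have hp' : aeval t p ≠ 0 := fun h => hN (by rw [hpq, h, zero_div])
  have hq' : aeval t q ≠ 0 := fun h => hN (by rw [hpq, h, div_zero])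
  have hp : p ≠ 0 := by
    rintro rfl
    simp at hp'
  have hq : q ≠ 0 := by
    rintro rfl
    simp at hq'
  have hrp : p.reverse ≠ 0 := by rwa [Ne, reverse_eq_zero]
  have hrq : q.reverse ≠ 0 := by rwa [Ne, reverse_eq_zero]
  have hX : ∀ n : ℕ, (X ^ n : k[X]) ≠ 0 := fun n => pow_ne_zero _ X_ne_zero
  have hw : ∀ {a : k[X]} (n : ℕ), a ≠ 0 → a.reverse ≠ 0 →
      trailingWeight (a.reverse * X ^ n) = (2⁻¹ : ℝ≥0) ^ n := fun {a} n _ ha => by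
    rw [trailingWeight_apply (mul_ne_zero ha (hX n)), natTrailingDegree_mul ha (hX n),
      natTrailingDegree_reverse, natTrailingDegree_X_pow, zero_add]
  have h1 := W.prod x hx p q hp hq (by
    change aeval t q * _ = aeval t p
    rw [hpq, mul_div_cancel₀ _ hq'])
  have h2 := W'.prod x hx (p.reverse * X ^ q.natDegree) (q.reverse * X ^ p.natDegree)
    (mul_ne_zero hrp (hX _)) (mul_ne_zero hrq (hX _)) (by
      rw [hpq]
      exact aeval_inv_reverse_div ht0 hq')
  rw [hw _ hp hrp, hw _ hq hrq] at h2
  rw [degreeWeight_apply hp, degreeWeight_apply hq] at h1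
  have hc : ∀ n : ℕ, (((2⁻¹ : ℝ≥0) ^ n : ℝ≥0) : ℝ) ≠ 0 := fun n => by simp
  apply mul_right_cancel₀ (mul_ne_zero (hc q.natDegree) (hc p.natDegree))
  rw [mul_mul_mul_comm, h1, h2, one_mul, mul_comm]

end PolynomialWeights

lemma WeightedFamily.abv_algebraMap_C_eq_one {k E K : Type} [Field k] [Field E] [Field K]
    [Algebra k E] [Algebra E K] {t : E} {w : k[X] →*₀ NNReal}
    (W : WeightedFamily K (aeval t : k[X] →ₐ[k] E).toRingHom w) (i : W.ι) {c : k} (hc : c ≠ 0) :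
    W.abv i (algebraMap E K (algebraMap k E c)) = 1 := by
  have h : ∀ c : k, W.abv i (algebraMap E K (algebraMap k E c)) ≤ 1 := fun c => by
    have := W.le_one i (Polynomial.C c)
    change W.abv i (algebraMap E K (aeval t (Polynomial.C c))) ≤ 1 at this
    rwa [aeval_C] at this
  refine le_antisymm (h c) ?_
  have h' := h c⁻¹
  rw [map_inv₀, map_inv₀, map_inv₀] at h'
  have hpos : 0 < W.abv i (algebraMap E K (algebraMap k E c)) :=
    (W.abv i).pos (by simpa using hc)
  exact (inv_le_one₀ hpos).1 h'

theorem exists_productFormula_of_transcendental {K : Type} [Field K] [CharZero K] {κ : Subfield K}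
    {t : K} (ht : Transcendental κ t) [FiniteDimensional (IntermediateField.adjoin κ {t}) K] :
    ∃ F : ProductFormula K, F.IsOver κ := by
  have hκ : CharZero κ := (algebraMap κ K).charZero
  let E := IntermediateField.adjoin κ {t}
  have hEz : CharZero E := (algebraMap E K).charZero
  let u : E := IntermediateField.AdjoinSimple.gen κ t
  have hu : algebraMap E K u = t := IntermediateField.AdjoinSimple.algebraMap_gen κ t
  have hut : Transcendental κ u := by
    intro h
    exact ht (by simpa [hu] using h.algebraMap (A := K))
  have hut' : Transcendental κ u⁻¹ := fun h => hut (by simpa using h.inv)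
  have hcoe : ∀ p : κ[X], algebraMap E K (aeval u p) = aeval t p := fun p => by
    rw [← hu, aeval_algebraMap_apply]
  have hE : ∀ x : E, ∃ p q : κ[X], x = aeval u p / aeval u q := fun x => by
    obtain ⟨p, q, h⟩ := (IntermediateField.mem_adjoin_simple_iff κ x.1).1 x.2
    refine ⟨p, q, (algebraMap E K).injective ?_⟩
    rw [map_div₀, hcoe, hcoe]
    exact h
  have hu0 : u ≠ 0 := fun h => hut (h ▸ isAlgebraic_zero)
  have hE' : ∀ x : E, ∃ p q : κ[X], x = aeval u⁻¹ p / aeval u⁻¹ q := fun x => by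
    obtain ⟨p, q, rfl⟩ := hE x
    by_cases hq : aeval u q = 0
    · exact ⟨0, 0, by simp [hq]⟩
    refine ⟨_, _, eq_div_of_mul_eq ?_ ((mul_comm _ _).trans (aeval_inv_reverse_div (p := p) hu0 hq))⟩
    have hq0 : q ≠ 0 := fun h => hq (by rw [h, map_zero])
    have hr : q.reverse * X ^ p.natDegree ≠ 0 :=
      mul_ne_zero (by rwa [Ne, reverse_eq_zero]) (pow_ne_zero _ X_ne_zero)
    exact fun h => hr (transcendental_iff.1 hut' _ h)
  obtain ⟨W⟩ := nonempty_weightedFamily_degree K hut hE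
  obtain ⟨W'⟩ := nonempty_weightedFamily_trailing K hut' hE'
  have := W.infinite_of_degree
  have := W'.finite_of_trailing
  let : Fintype W'.ι := Fintype.ofFinite _
  refine ⟨{
    ι := W.ι
    J := W'.ι
    fin := W.abv
    inf := W'.abv
    wt := fun _ => 1
    wt_pos := fun _ => le_rfl
    nonarch := W.nonarch
    finite := W.finite
    prod := fun x hx => by
      simp only [pow_one]
      rw [← finprod_eq_prod_of_fintype]
      exact W.prod_mul_prod_eq_one hut hE W' hx }, W.nontrivial, W.not_equiv,
    Or.inr fun i c hc hc0 => ?_⟩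
  exact W.abv_algebraMap_C_eq_one i (c := ⟨c, hc⟩) fun h => hc0 (congrArg Subtype.val h)

theorem NumberFieldOrFunctionFieldOver.charZero {K : Type} [Field K] {κ : Subfield K}
    (hK : NumberFieldOrFunctionFieldOver K κ) : CharZero K := by
  rcases hK with hK | ⟨hK, -, -⟩
  · exact hK.to_charZero
  · exact hK

theorem NumberFieldOrFunctionFieldOver.exists_productFormula {K : Type} [Field K] {κ : Subfield K}
    (hK : NumberFieldOrFunctionFieldOver K κ) : ∃ F : ProductFormula K, F.IsOver κ := by
  rcases hK with hK | ⟨hK, ⟨t, ht, hfin⟩, -⟩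
  · exact ⟨_, NumberField.productFormula_isOver K κ⟩
  · exact exists_productFormula_of_transcendental ht

/-- **Dynamical Hasse principle for disintegrated polynomials: curves and hypersurfaces**
(Theorem 3.8).

Let `K` be a number field or a function field of characteristic 0, `n ≥ 2`, `f ∈ K[X]` a
disintegrated polynomial of degree `d ≥ 2`, and `φ = (f,…,f)`. Let `V` be a
`φ`-preperiodic, absolutely irreducible curve or hypersurface in `(P^1_K)^n` and
`P ∈ (P^1)^n(K)` with `V(K) ∩ O_φ(P) = ∅`. Then for infinitely many non-archimedean
places `𝔭` of `K` the `𝔭`-adic closure of `O_φ(P)` does not meet `V(K_𝔭)`; consequently,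
for any finite set `S` of places containing the archimedean ones,
`V(K,S) ∩ 𝒞(O_φ(P)) = ∅`. -/
theorem dynamical_hasse_principle_disintegrated_curve_or_hypersurface
    (K : Type) [Field K] (κ : Subfield K)
    (hK : NumberFieldOrFunctionFieldOver K κ)
    (n : ℕ) (hn : 2 ≤ n)
    (d : ℕ) (hd : 2 ≤ d)
    (f : Polynomial K) (hf : f.natDegree = d) (hdis : IsDisintegrated f)
    (V : ClosedSubvar K (Fin n))
    (hVirr : IrrSubvar (V.pts (algebraMap K (AlgebraicClosure K))))
    (hVpre : SubvarPreperiodic (f.map (algebraMap K (AlgebraicClosure K)))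
      (V.pts (algebraMap K (AlgebraicClosure K))))
    (hVdim : varDim (V.pts (algebraMap K (AlgebraicClosure K))) = ((1 : ℕ∞) : WithBot ℕ∞) ∨
      varDim (V.pts (algebraMap K (AlgebraicClosure K))) = (((n - 1 : ℕ) : ℕ∞) : WithBot ℕ∞))
    (P : Fin n → OnePoint K)
    (hP : V.pts (RingHom.id K) ∩ fwdOrbit (splitMap f) P = ∅) :
    (InfinitelyManyPlaces K κ fun w => OrbitClosureAvoids w f P V) ∧
      ∀ S : Set (PlaceK K), IsAdmissibleS K S →
        ∀ C : ∀ w : PlaceK K, CompletionOf w,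
          VKS K κ S C n V ∩
            @closure _ (adelicTop K κ S C n)
              (adelicDiag K κ S C n '' fwdOrbit (splitMap f) P) = ∅ := by
  have := hK.charZero
  obtain ⟨F, hF⟩ := hK.exists_productFormula
  subst hf
  obtain ⟨x, -, hx⟩ := exists_eq_chartPt P
  generalize {i | P i = ∞} = M at hx
  subst hx
  have hf' : ¬ ∃ a c, f.map (algebraMap K (AlgebraicClosure K)) =
      C a * (X - C c) ^ f.natDegree + C c := by
    simpa only [natDegree_map] using
      not_exists_eq_of_not_isSpecialPolyAux (by rwa [natDegree_map]) hdis.2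
  have h : InfinitelyManyPlaces K κ fun w => OrbitClosureAvoids w f (chartPt M x) V := by
    rcases hVdim with hVdim | hVdim
    · exact hF.infinitelyManyPlaces_of_curve hd hf' V hVirr hVpre hVdim.le M x hP
    · exact hF.infinitelyManyPlaces_of_hypersurface (one_le_two.trans hn) hd hf' V hVirr hVpre
        hVdim M x hP
  exact ⟨h, fun S hS C => adelic_inter_eq_empty h hS.1 C⟩
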